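/- arXiv:2404.15123 — 7 statements merged into one kernel-verified Lean document; each statement's English description precedes it below -/
import Mathlib

section
/- Let f: ℕ → ℝ≥0 be a multiplicative function satisfying (1⋆f)(n) ≤ n for all n ≥ 1, where ⋆ denotes Dirichlet convolution. Then for any M ∈ ℕ, any real t ≥ 1 and any c ∈ ℝ, ∑_{(m,n): mn = M, ∑_{p prime, p ≥ t, p | m} 1/p ≥ c} f(n) ≪ M·e^{−100ct}, with an absolute implied constant. -/
/-- `∑_{p prime, p | k, p ≥ t} 1/p`. -/
noncomputable def primeSum (t : ℝ) (k : ℕ) : ℝ :=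
  ∑ p ∈ k.primeFactors, Set.indicator {q : ℕ | t ≤ (q : ℝ)} (fun q => 1 / (q : ℝ)) p

lemma primeSum_mul (t : ℝ) {a b : ℕ} (h : Nat.Coprime a b) :
    primeSum t (a * b) = primeSum t a + primeSum t b := by
  unfold primeSum
  rw [h.primeFactors_mul, Finset.sum_union h.disjoint_primeFactors]

lemma primeSum_one (t : ℝ) : primeSum t 1 = 0 := by simp [primeSum]

noncomputable def gg (t : ℝ) (p : ℕ) : ℝ :=
  Set.indicator {q : ℕ | t ≤ (q : ℝ)} (fun q => 1 / (q : ℝ)) p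

lemma primeSum_pow (t : ℝ) {p k : ℕ} (hp : p.Prime) (hk : k ≠ 0) :
    primeSum t (p ^ k) = gg t p := by
  unfold primeSum gg
  rw [Nat.primeFactors_prime_pow hk hp, Finset.sum_singleton]

noncomputable def hA (t : ℝ) : ArithmeticFunction ℝ :=
  ⟨fun n => if n = 0 then 0 else Real.exp (100 * t * primeSum t n), by simp⟩

noncomputable def fA (f : ℕ → ℝ) : ArithmeticFunction ℝ :=
  ⟨fun n => if n = 0 then 0 else f n, by simp⟩

lemma hA_apply (t : ℝ) {n : ℕ} (hn : n ≠ 0) :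
    hA t n = Real.exp (100 * t * primeSum t n) := by
  change (if n = 0 then 0 else _) = _
  simp [hn]

lemma fA_apply (f : ℕ → ℝ) {n : ℕ} (hn : n ≠ 0) : fA f n = f n := by
  change (if n = 0 then 0 else _) = _
  simp [hn]

lemma hA_mult (t : ℝ) : (hA t).IsMultiplicative := by
  rw [ArithmeticFunction.IsMultiplicative.iff_ne_zero]
  refine ⟨by rw [hA_apply t one_ne_zero, primeSum_one]; simp, ?_⟩
  intro m n hm hn h
  rw [hA_apply t hm, hA_apply t hn, hA_apply t (mul_ne_zero hm hn), primeSum_mul t h, mul_add,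
    Real.exp_add]

lemma fA_mult (f : ℕ → ℝ) (h1 : f 1 = 1)
    (hf : ∀ a b : ℕ, Nat.Coprime a b → f (a * b) = f a * f b) : (fA f).IsMultiplicative := by
  rw [ArithmeticFunction.IsMultiplicative.iff_ne_zero]
  refine ⟨by rw [fA_apply f one_ne_zero, h1], ?_⟩
  intro m n hm hn h
  rw [fA_apply f hm, fA_apply f hn, fA_apply f (mul_ne_zero hm hn), hf m n h]

lemma conv_apply (t : ℝ) (f : ℕ → ℝ) (M : ℕ) :
    (hA t * fA f) M = ∑ m ∈ M.divisors, Real.exp (100 * t * primeSum t m) * f (M / m) := by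
  rw [ArithmeticFunction.mul_apply,
    Nat.sum_divisorsAntidiagonal (fun a b => hA t a * fA f b)]
  refine Finset.sum_congr rfl fun m hm => ?_
  have hM := Nat.ne_zero_of_mem_divisors hm
  have hd := Nat.dvd_of_mem_divisors hm
  rw [hA_apply t (Nat.pos_of_mem_divisors hm).ne', fA_apply f]
  exact (Nat.div_pos (Nat.le_of_dvd (Nat.pos_of_ne_zero hM) hd) (Nat.pos_of_mem_divisors hm)).ne'

lemma conv_pow (t : ℝ) (f : ℕ → ℝ) {p : ℕ} (k : ℕ) (hp : p.Prime) :
    (hA t * fA f) (p ^ (k + 1)) = Real.exp (100 * t * gg t p) *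
      ∑ j ∈ Finset.range (k + 1), f (p ^ j) + f (p ^ (k + 1)) := by
  rw [conv_apply, Nat.sum_divisors_prime_pow hp, Finset.sum_range_succ']
  congr 1
  · rw [← Finset.sum_range_reflect, Finset.mul_sum]
    refine Finset.sum_congr rfl fun j hj => ?_
    rw [Finset.mem_range] at hj
    rw [primeSum_pow t hp (by omega), Nat.pow_div (by omega) hp.pos]
    congr 3
    omega
  · simp [primeSum_one]

lemma exp_bound {x : ℝ} (h0 : 0 ≤ x) (h1 : x ≤ 1) :
    Real.exp (100 * x) - 1 ≤ Real.exp 100 * x := by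
  have := convexOn_exp.2 (Set.mem_univ (100 : ℝ)) (Set.mem_univ (0 : ℝ)) h0
    (sub_nonneg.2 h1) (by ring)
  simp only [smul_eq_mul, mul_zero, add_zero, Real.exp_zero, mul_one] at this
  rw [mul_comm 100 x]
  nlinarith

lemma gg_bound {t : ℝ} (ht : 1 ≤ t) (p : ℕ) : 0 ≤ gg t p ∧ t * gg t p ≤ 1 := by
  unfold gg
  by_cases h : t ≤ (p : ℝ)
  · have hp : (0 : ℝ) < p := by linarith
    rw [Set.indicator_of_mem (by exact h)]
    refine ⟨by positivity, ?_⟩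
    rw [mul_one_div, div_le_one hp]; exact h
  · rw [Set.indicator_of_notMem (by exact h)]; simp

lemma local_bound {t : ℝ} (ht : 1 ≤ t) (f : ℕ → ℝ)
    (hs : ∀ n : ℕ, 1 ≤ n → ∑ d ∈ n.divisors, f d ≤ (n : ℝ)) {p k : ℕ} (hp : p.Prime)
    (hk : k ≠ 0) :
    (hA t * fA f) (p ^ k) ≤ (p : ℝ) ^ k * Real.exp (Real.exp 100 * (t * gg t p / p)) := by
  obtain ⟨k, rfl⟩ := Nat.exists_eq_succ_of_ne_zero hk
  have hp0 : (0 : ℝ) < p := by exact_mod_cast hp.pos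
  obtain ⟨g0, g1⟩ := gg_bound ht p
  have hx0 : 0 ≤ t * gg t p := by positivity
  have e := exp_bound hx0 g1
  have e0 : 0 ≤ Real.exp (100 * (t * gg t p)) - 1 := by
    have := Real.add_one_le_exp (100 * (t * gg t p)); linarith
  have s1 := hs (p ^ k) (Nat.pow_pos hp.pos)
  have s2 := hs (p ^ (k + 1)) (Nat.pow_pos hp.pos)
  rw [Nat.sum_divisors_prime_pow hp] at s1 s2
  rw [Finset.sum_range_succ] at s2
  push_cast at s1 s2
  rw [Nat.succ_eq_add_one, conv_pow t f k hp, mul_assoc]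
  set S := ∑ j ∈ Finset.range (k + 1), f (p ^ j)
  set E := Real.exp (100 * (t * gg t p))
  calc E * S + f (p ^ (k + 1)) = (E - 1) * S + (S + f (p ^ (k + 1))) := by ring
    _ ≤ (Real.exp 100 * (t * gg t p)) * (p : ℝ) ^ k + (p : ℝ) ^ (k + 1) := by
      have := mul_le_mul_of_nonneg_left s1 e0
      have := mul_le_mul_of_nonneg_right e (by positivity : 0 ≤ (p : ℝ) ^ k)
      linarith
    _ = (p : ℝ) ^ (k + 1) * (Real.exp 100 * (t * gg t p / p) + 1) := by
      field_simp
      ring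
    _ ≤ _ := by
      gcongr
      exact Real.add_one_le_exp _

lemma sum_bound {t : ℝ} (ht : 1 ≤ t) (s : Finset ℕ) :
    ∑ p ∈ s, t * gg t p / p ≤ 2 := by
  have key : ∀ p, t * gg t p / p = if t ≤ (p : ℝ) then t * ((p : ℝ) ^ 2)⁻¹ else 0 := by
    intro p
    unfold gg
    split_ifs with h
    · have hp : (0 : ℝ) < p := by linarith
      rw [Set.indicator_of_mem (by exact h)]
      field_simp
    · rw [Set.indicator_of_notMem (by exact h)]; simp
  simp_rw [key]
  rw [← Finset.sum_filter, ← Finset.mul_sum]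
  have hc : 1 ≤ ⌈t⌉₊ := Nat.one_le_ceil_iff.2 (by linarith)
  have h2 : ∑ p ∈ s with t ≤ ((p : ℕ) : ℝ), ((p : ℝ) ^ 2)⁻¹ ≤
      ∑ p ∈ Finset.Ioo (⌈t⌉₊ - 1) (s.sup id + 1), ((p : ℝ) ^ 2)⁻¹ := by
    apply Finset.sum_le_sum_of_subset_of_nonneg
    · intro p hp
      rw [Finset.mem_filter] at hp
      have a := Nat.ceil_le.2 hp.2
      have b : p ≤ s.sup id := Finset.le_sup (f := id) hp.1
      rw [Finset.mem_Ioo]; omega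
    · intros; positivity
  have h3 := sum_Ioo_inv_sq_le (α := ℝ) (⌈t⌉₊ - 1) (s.sup id + 1)
  rw [Nat.cast_sub hc] at h3
  push_cast at h3
  rw [sub_add_cancel] at h3
  have h4 := Nat.le_ceil t
  have h5 : 2 / (⌈t⌉₊ : ℝ) ≤ 2 / t := by gcongr
  calc _ ≤ t * (2 / t) := mul_le_mul_of_nonneg_left (by linarith) (by linarith)
    _ = 2 := by field_simp

/-- **Divisor anatomy property**: if `f` is a non-negative multiplicative
function with `(1⋆f)(n) ≤ n` for all `n ≥ 1`, then for any `M ∈ ℕ`, `t ≥ 1`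
and `c ∈ ℝ`, `∑_{mn = M, ∑_{p ≥ t, p | m} 1/p ≥ c} f(n) ≪ M e^{-100ct}`. -/
theorem divisor_anatomy :
    ∃ K : ℝ, 0 < K ∧ ∀ (f : ℕ → ℝ),
      (∀ n, 0 ≤ f n) → f 1 = 1 →
      (∀ a b : ℕ, Nat.Coprime a b → f (a * b) = f a * f b) →
      (∀ n : ℕ, 1 ≤ n → ∑ d ∈ n.divisors, f d ≤ (n : ℝ)) →
      ∀ (M : ℕ) (t c : ℝ), 1 ≤ t →
        (∑ m ∈ M.divisors,
          Set.indicator {m' : ℕ | c ≤ primeSum t m'} (fun m' => f (M / m')) m) ≤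
          K * M * Real.exp (-(100 * c * t)) := by
  refine ⟨Real.exp (Real.exp 100 * 2), Real.exp_pos _, ?_⟩
  intro f hf0 h1 hmul hs M t c ht
  rcases eq_or_ne M 0 with rfl | hM
  · simp
  have A : (∑ m ∈ M.divisors,
      Set.indicator {m' : ℕ | c ≤ primeSum t m'} (fun m' => f (M / m')) m) ≤
      (hA t * fA f) M * Real.exp (-(100 * c * t)) := by
    rw [conv_apply, Finset.sum_mul]
    refine Finset.sum_le_sum fun m _ => ?_
    have hf := hf0 (M / m)
    rw [mul_right_comm, ← Real.exp_add]
    by_cases h : c ≤ primeSum t m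
    · rw [Set.indicator_of_mem (by exact h)]
      apply le_mul_of_one_le_left hf
      apply Real.one_le_exp
      nlinarith
    · rw [Set.indicator_of_notMem (by exact h)]
      positivity
  refine A.trans (mul_le_mul_of_nonneg_right ?_ (Real.exp_pos _).le)
  rw [((hA_mult t).mul (fA_mult f h1 hmul)).multiplicative_factorization _ hM]
  have hMM : (M : ℝ) = ∏ p ∈ M.primeFactors, (p : ℝ) ^ M.factorization p := by
    conv_lhs => rw [← Nat.prod_factorization_pow_eq_self hM]
    rw [Finsupp.prod, Nat.support_factorization]
    push_cast
    rfl
  rw [Finsupp.prod, Nat.support_factorization]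
  calc _ ≤ ∏ p ∈ M.primeFactors, ((p : ℝ) ^ M.factorization p *
          Real.exp (Real.exp 100 * (t * gg t p / p))) := by
        refine Finset.prod_le_prod ?_ ?_
        · intro p _
          rw [conv_apply]
          exact Finset.sum_nonneg fun m _ => mul_nonneg (Real.exp_pos _).le (hf0 _)
        · intro p hp
          refine local_bound ht f hs (Nat.prime_of_mem_primeFactors hp) ?_
          rw [← Nat.support_factorization] at hp
          exact Finsupp.mem_support_iff.1 hp
    _ = M * Real.exp (Real.exp 100 * ∑ p ∈ M.primeFactors, t * gg t p / p) := by
        rw [Finset.prod_mul_distrib, ← hMM, ← Real.exp_sum, Finset.mul_sum]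
    _ ≤ M * Real.exp (Real.exp 100 * 2) := by
        gcongr
        exact sum_bound ht _
    _ = _ := mul_comm _ _
end

section
/- Let ψ: ℕ ∩ [1,N] → [0,1/2], let Ψ(N) := ∑_{n=1}^N 2φ(n)ψ(n)/n, D(n,m) := max(m·ψ(n), n·ψ(m))/gcd(n,m), and L_x(n,m) := ∑_{p prime, p | nm/gcd(n,m)², p ≥ x} 1/p. Let s, t ≥ 0 and A > 0 be fixed, let η ∈ (0,1/2), and let ℰ_{s,t,A} := {(n,m) : 1 ≤ n,m ≤ N, D(n,m) ≤ s·Ψ(N), L_t(n,m) ≥ 1/A}. Then ∑_{(n,m)∈ℰ_{s,t,A}} (ψ(n)φ(n)/n)·(ψ(m)φ(m)/m) ≪_η Ψ(N)²·s^{1/2+η}·e^{−(1−η)t/A}. -/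
/-- `Ψ(N) = ∑_{n=1}^N 2 φ(n) ψ(n) / n`. -/
noncomputable def Psi (ψ : ℕ → ℝ) (N : ℕ) : ℝ :=
  ∑ n ∈ Finset.Icc 1 N, 2 * (Nat.totient n : ℝ) * ψ n / n

/-- `D(n,m) = max(m ψ(n), n ψ(m)) / gcd(n,m)`. -/
noncomputable def Dfun (ψ : ℕ → ℝ) (n m : ℕ) : ℝ :=
  max ((m : ℝ) * ψ n) ((n : ℝ) * ψ m) / (Nat.gcd n m : ℝ)

/-- `L_x(n,m) = ∑_{p | nm/gcd(n,m)², p ≥ x} 1/p`, the sum over primes. -/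
noncomputable def Lfun (x : ℝ) (n m : ℕ) : ℝ :=
  ∑ p ∈ (n * m / Nat.gcd n m ^ 2).primeFactors,
    Set.indicator {q : ℕ | x ≤ (q : ℝ)} (fun q => 1 / (q : ℝ)) p


noncomputable def MM (q : ℝ) (i j : ℕ) : ℝ :=
  (if i = j then 1 else Real.exp 1) * q ^ ((i - j) + (j - i))

lemma MM_symm (q : ℝ) (i j : ℕ) : MM q i j = MM q j i := by
  unfold MM
  rw [add_comm (i - j)]
  simp only [eq_comm]

lemma MM_self (q : ℝ) (i : ℕ) : MM q i i = 1 := by simp [MM]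

lemma MM_nonneg (q : ℝ) (hq : 0 ≤ q) (i j : ℕ) : 0 ≤ MM q i j := by
  unfold MM
  split_ifs <;> positivity

lemma geo_bound (q : ℝ) (h0 : 0 < q) (h1 : q < 1) (I : Finset ℕ) (k : ℕ) :
    ∑ j ∈ I.erase k, q ^ ((k - j) + (j - k)) ≤ 2 * q / (1 - q) := by
  have hs := summable_geometric_of_lt_one h0.le h1
  have ht := tsum_geometric_of_lt_one h0.le h1
  have key : ∀ (J : Finset ℕ), ∑ d ∈ J, q ^ d ≤ (1 - q)⁻¹ := by
    intro J
    rw [← ht]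
    exact hs.sum_le_tsum J (fun i _ => by positivity)
  rw [← Finset.sum_filter_add_sum_filter_not _ (fun j => j < k)]
  have e1 : ∑ j ∈ (I.erase k).filter (fun j => j < k), q ^ ((k - j) + (j - k)) ≤ q * (1 - q)⁻¹ := by
    calc _ = ∑ j ∈ (I.erase k).filter (fun j => j < k), q * q ^ (k - j - 1) := by
          apply Finset.sum_congr rfl
          intro j hj
          simp at hj
          rw [← pow_succ']
          congr 1; omega
      _ = q * ∑ d ∈ ((I.erase k).filter (fun j => j < k)).image (fun j => k - j - 1), q ^ d := by
          rw [Finset.sum_image, Finset.mul_sum]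
          intro a ha b hb hab
          simp at ha hb hab
          omega
      _ ≤ _ := by gcongr; exact key _
  have e2 : ∑ j ∈ (I.erase k).filter (fun j => ¬ j < k), q ^ ((k - j) + (j - k)) ≤ q * (1 - q)⁻¹ := by
    calc _ = ∑ j ∈ (I.erase k).filter (fun j => ¬ j < k), q * q ^ (j - k - 1) := by
          apply Finset.sum_congr rfl
          intro j hj
          simp at hj
          rw [← pow_succ']
          congr 1; omega
      _ = q * ∑ d ∈ ((I.erase k).filter (fun j => ¬ j < k)).image (fun j => j - k - 1), q ^ d := by
          rw [Finset.sum_image, Finset.mul_sum]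
          intro a ha b hb hab
          simp at ha hb hab
          omega
      _ ≤ _ := by gcongr; exact key _
  have : 2 * q / (1 - q) = q * (1 - q)⁻¹ + q * (1 - q)⁻¹ := by rw [div_eq_mul_inv]; ring
  rw [this]
  exact add_le_add e1 e2

lemma MM_row (q : ℝ) (h0 : 0 < q) (h1 : q < 1) (I : Finset ℕ) (k : ℕ) :
    ∑ j ∈ I.erase k, MM q k j ≤ Real.exp 1 * (2 * q / (1 - q)) := by
  calc _ = ∑ j ∈ I.erase k, Real.exp 1 * q ^ ((k - j) + (j - k)) := by
        apply Finset.sum_congr rfl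
        intro j hj
        have := Finset.ne_of_mem_erase hj
        simp [MM, this.symm]
    _ = Real.exp 1 * ∑ j ∈ I.erase k, q ^ ((k - j) + (j - k)) := by rw [Finset.mul_sum]
    _ ≤ _ := by gcongr; exact geo_bound q h0 h1 I k

lemma schur_off (q : ℝ) (h0 : 0 < q) (h1 : q < 1) (I : Finset ℕ) (a b : ℕ → ℝ) :
    ∑ i ∈ I, ∑ j ∈ I.erase i, MM q i j * (a i * b j) ≤
      Real.exp 1 * (2 * q / (1 - q)) * ((∑ i ∈ I, a i ^ 2 + ∑ i ∈ I, b i ^ 2) / 2) := by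
  have e1 : ∑ i ∈ I, ∑ j ∈ I.erase i, MM q i j * (a i * b j) ≤
      ∑ i ∈ I, ∑ j ∈ I.erase i, (MM q i j * (a i ^ 2 / 2) + MM q i j * (b j ^ 2 / 2)) := by
    apply Finset.sum_le_sum; intro i _
    apply Finset.sum_le_sum; intro j _
    have := MM_nonneg q h0.le i j
    nlinarith [mul_nonneg this (sq_nonneg (a i - b j))]
  have e2 : ∑ i ∈ I, ∑ j ∈ I.erase i, MM q i j * (a i ^ 2 / 2) ≤
      ∑ i ∈ I, Real.exp 1 * (2 * q / (1 - q)) * (a i ^ 2 / 2) := by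
    apply Finset.sum_le_sum; intro i _
    rw [← Finset.sum_mul]
    gcongr
    exact MM_row q h0 h1 I i
  have e3 : ∑ i ∈ I, ∑ j ∈ I.erase i, MM q i j * (b j ^ 2 / 2) ≤
      ∑ i ∈ I, Real.exp 1 * (2 * q / (1 - q)) * (b i ^ 2 / 2) := by
    have : ∑ i ∈ I, ∑ j ∈ I.erase i, MM q i j * (b j ^ 2 / 2)
        = ∑ j ∈ I, ∑ i ∈ I.erase j, MM q i j * (b j ^ 2 / 2) := by
      apply Finset.sum_comm'
      intro x y
      simp [Finset.mem_erase]
      tauto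
    rw [this]
    apply Finset.sum_le_sum; intro i _
    rw [← Finset.sum_mul]
    gcongr
    simp_rw [MM_symm q _ i]
    exact MM_row q h0 h1 I i
  simp_rw [Finset.sum_add_distrib] at e1
  rw [← Finset.mul_sum, ← Finset.sum_div] at e2 e3
  linarith

lemma split_diag (I : Finset ℕ) (m : ℕ → ℕ → ℝ) :
    ∑ i ∈ I, ∑ j ∈ I, m i j = ∑ i ∈ I, m i i + ∑ i ∈ I, ∑ j ∈ I.erase i, m i j := by
  rw [← Finset.sum_add_distrib]
  apply Finset.sum_congr rfl
  intro i hi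
  rw [Finset.add_sum_erase I (fun j => m i j) hi]

lemma split_at (I : Finset ℕ) (m : ℕ → ℕ → ℝ) (k : ℕ) (hk : k ∈ I) :
    ∑ i ∈ I, ∑ j ∈ I, m i j = m k k + ∑ j ∈ I.erase k, m k j + ∑ i ∈ I.erase k, m i k
      + ∑ i ∈ I.erase k, ∑ j ∈ I.erase k, m i j := by
  rw [← Finset.add_sum_erase I _ hk, ← Finset.add_sum_erase I _ hk, add_assoc _ (∑ i ∈ I.erase k, m i k),
    ← Finset.sum_add_distrib]
  congr 1
  apply Finset.sum_congr rfl
  intro i hi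
  rw [← Finset.add_sum_erase I _ hk]

lemma schur_full (q : ℝ) (h0 : 0 < q) (h1 : q < 1) (I : Finset ℕ) (a b : ℕ → ℝ) :
    ∑ i ∈ I, ∑ j ∈ I, MM q i j * (a i * b j) ≤
      (1 + Real.exp 1 * (2 * q / (1 - q))) * ((∑ i ∈ I, a i ^ 2 + ∑ i ∈ I, b i ^ 2) / 2) := by
  rw [split_diag]
  have := schur_off q h0 h1 I a b
  have e : ∑ i ∈ I, MM q i i * (a i * b i) ≤ (∑ i ∈ I, a i ^ 2 + ∑ i ∈ I, b i ^ 2) / 2 := by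
    rw [← Finset.sum_add_distrib, Finset.sum_div]
    apply Finset.sum_le_sum
    intro i _
    rw [MM_self]
    nlinarith [sq_nonneg (a i - b i)]
  linarith

lemma sum_pow_le (a : ℝ) (h1 : 1/2 < a) (J : Finset ℕ) (X : ℕ → ℝ) (hX : ∀ i, 0 ≤ X i) :
    ∑ i ∈ J, (X i ^ a) ^ 2 ≤ (∑ i ∈ J, X i) ^ (2 * a - 1) * ∑ i ∈ J, X i := by
  rw [Finset.mul_sum]
  apply Finset.sum_le_sum
  intro i hi
  have e : (X i ^ a) ^ 2 = X i ^ (2 * a - 1) * X i := by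
    rw [← Real.rpow_natCast, ← Real.rpow_mul (hX i)]
    rcases (hX i).eq_or_lt with h | h
    · rw [← h, Real.zero_rpow (by norm_num; linarith)]; simp
    · nth_rewrite 3 [← Real.rpow_one (X i)]
      rw [← Real.rpow_add h]; congr 1; push_cast; ring
  rw [e]
  apply mul_le_mul_of_nonneg_right _ (hX i)
  apply Real.rpow_le_rpow (hX i) _ (by linarith)
  exact Finset.single_le_sum (fun i _ => hX i) hi

lemma schur_norm (a : ℝ) (h1 : 1/2 < a) (q : ℝ) (h0 : 0 < q) (hq1 : q < 1) (I : Finset ℕ) (X Y : ℕ → ℝ)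
    (hX : ∀ i, 0 ≤ X i) (hY : ∀ i, 0 ≤ Y i) (sX : ∑ i ∈ I, X i = 1) (sY : ∑ i ∈ I, Y i = 1) :
    ∑ i ∈ I, ∑ j ∈ I, MM q i j * (X i ^ a * Y j ^ a) ≤ 1 + Real.exp 1 * (2 * q / (1 - q)) := by
  have := schur_full q h0 hq1 I (fun i => X i ^ a) (fun i => Y i ^ a)
  have e1 := sum_pow_le a h1 I X hX
  have e2 := sum_pow_le a h1 I Y hY
  rw [sX] at e1; rw [sY] at e2
  simp at e1 e2
  refine this.trans ?_
  have : 0 ≤ Real.exp 1 * (2 * q / (1 - q)) := by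
    have : 0 < 1 - q := by linarith
    positivity
  have h2 : (∑ i ∈ I, (X i ^ a) ^ 2 + ∑ i ∈ I, (Y i ^ a) ^ 2) / 2 ≤ 1 := by linarith
  nlinarith

/-- row bound by weighted AM-GM -/
lemma row_amgm (a : ℝ) (h1 : 1/2 < a) (h2 : a < 1) (h : ℝ) (hh : 0 < h) :
    ∃ c : ℝ, 0 < c ∧ ∀ p : ℕ, 2 ≤ p → ∀ (I : Finset ℕ) (Y : ℕ → ℝ) (k : ℕ), (∀ i, 0 ≤ Y i) →
      ∑ j ∈ I.erase k, MM ((p:ℝ) ^ (-(1 - a))) k j * Y j ^ a ≤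
        c / p + h * ∑ j ∈ I.erase k, Y j := by
  set c : ℝ := (Real.exp 1 * h ^ (-a)) ^ (1 / (1 - a)) with hc
  have hc0 : 0 < c := by positivity
  have hca : c ^ (1 - a) * h ^ a = Real.exp 1 := by
    rw [hc, ← Real.rpow_mul (by positivity), one_div_mul_cancel (by linarith), Real.rpow_one, mul_assoc,
      ← Real.rpow_add hh]
    simp
  refine ⟨c * 4, by positivity, ?_⟩
  intro p hp I Y k hY
  have hp' : (2:ℝ) ≤ p := by exact_mod_cast hp
  have hp0 : (0:ℝ) < p := by linarith
  have key : ∀ j ∈ I.erase k, MM ((p:ℝ) ^ (-(1 - a))) k j * Y j ^ a ≤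
      c * ((p:ℝ)⁻¹) ^ ((k - j) + (j - k)) + h * Y j := by
    intro j hj
    have hne := (Finset.ne_of_mem_erase hj).symm
    set d := (k - j) + (j - k)
    have hu : 0 ≤ ((p:ℝ)⁻¹) ^ d := by positivity
    have e : ((p:ℝ) ^ (-(1 - a))) ^ d = (((p:ℝ)⁻¹) ^ d) ^ (1 - a) := by
      rw [Real.rpow_neg hp0.le, ← Real.inv_rpow hp0.le, ← Real.rpow_natCast, ← Real.rpow_natCast,
        ← Real.rpow_mul (by positivity), ← Real.rpow_mul (by positivity), mul_comm]
    have am := Real.geom_mean_le_arith_mean2_weighted (w₁ := 1 - a) (w₂ := a) (p₁ := c * ((p:ℝ)⁻¹) ^ d)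
      (p₂ := h * Y j) (by linarith) (by linarith) (by positivity) (mul_nonneg hh.le (hY j)) (by ring)
    rw [Real.mul_rpow hc0.le hu, Real.mul_rpow hh.le (hY j)] at am
    have : MM ((p:ℝ) ^ (-(1 - a))) k j * Y j ^ a = c ^ (1 - a) * (((p:ℝ)⁻¹) ^ d) ^ (1 - a) * (h ^ a * Y j ^ a) := by
      unfold MM
      rw [if_neg hne, e, ← hca]; ring
    rw [this]
    refine am.trans ?_
    have t1 : 0 ≤ c * ((p:ℝ)⁻¹) ^ d := by positivity
    have t2 : 0 ≤ h * Y j := mul_nonneg hh.le (hY j)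
    nlinarith
  refine (Finset.sum_le_sum key).trans ?_
  rw [Finset.sum_add_distrib, ← Finset.mul_sum, ← Finset.mul_sum]
  gcongr
  have hi : (p:ℝ)⁻¹ ≤ 1/2 := by rw [inv_eq_one_div]; exact one_div_le_one_div_of_le (by norm_num) hp'
  have := geo_bound ((p:ℝ)⁻¹) (by positivity) (by linarith) I k
  rw [mul_div_assoc]
  gcongr
  refine this.trans ?_
  rw [div_le_div_iff₀ (by linarith) hp0]
  have : (p:ℝ)⁻¹ * p = 1 := inv_mul_cancel₀ hp0.ne'
  nlinarith

lemma exists_p0 (a : ℝ) (h2 : a < 1) (e : ℝ) (he : 0 < e) :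
    ∃ p0 : ℕ, 2 ≤ p0 ∧ ∀ p : ℕ, p0 ≤ p → (p:ℝ) ^ (-(1 - a)) ≤ e := by
  have h := (tendsto_rpow_neg_atTop (y := 1 - a) (by linarith)).comp (tendsto_natCast_atTop_atTop (R := ℝ))
  have h' := h.eventually_le_const he
  obtain ⟨n, hn⟩ := Filter.eventually_atTop.1 h'
  exact ⟨max n 2, le_max_right _ _, fun p hp => hn p ((le_max_left _ _).trans hp)⟩

set_option maxHeartbeats 2000000 in
theorem lemA (a : ℝ) (h1 : 1/2 < a) (h2 : a < 1) : ∃ C : ℝ, 0 < C ∧ ∃ p0 : ℕ, 2 ≤ p0 ∧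
    ∀ p : ℕ, p0 ≤ p → ∀ (I : Finset ℕ) (X Y : ℕ → ℝ), (∀ i, 0 ≤ X i) → (∀ i, 0 ≤ Y i) →
      ∑ i ∈ I, X i = 1 → ∑ i ∈ I, Y i = 1 →
      1 < ∑ i ∈ I, ∑ j ∈ I, MM ((p:ℝ) ^ (-(1 - a))) i j * (X i ^ a * Y j ^ a) →
      ∃ k ∈ I,
        (∑ i ∈ I, ∑ j ∈ I, (if i ≠ k ∧ j ≠ k then 1 else 0) *
          (MM ((p:ℝ) ^ (-(1 - a))) i j * (X i ^ a * Y j ^ a))) ≤ C * (p:ℝ) ^ (-(2 * a)) ∧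
        (∑ i ∈ I, ∑ j ∈ I, (if i ≠ k ∨ j ≠ k then 1 else 0) *
          (MM ((p:ℝ) ^ (-(1 - a))) i j * (X i ^ a * Y j ^ a))) ≤ C / p := by
  set d0 : ℝ := (a/8) ^ (1 / (2 * a - 1)) with hd0
  have hd0p : 0 < d0 := by positivity
  have hd0e : d0 ^ (2 * a - 1) = a / 8 := by
    rw [hd0, ← Real.rpow_mul (by positivity), one_div_mul_cancel (by linarith), Real.rpow_one]
  have hd01 : d0 < 1 := Real.rpow_lt_one (by positivity) (by linarith) (by apply one_div_pos.2; linarith)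
  have hlt : (1 - d0) ^ (a - 1/2) < 1 := Real.rpow_lt_one (by linarith) (by linarith) (by linarith)
  set e0 : ℝ := 1 - (1 - d0) ^ (a - 1/2) with he0
  have he0p : 0 < e0 := by linarith
  have he01 : e0 ≤ 1 := by
    have : 0 ≤ (1 - d0) ^ (a - 1/2) := Real.rpow_nonneg (by linarith) _
    linarith
  obtain ⟨c, hc, hrow⟩ := row_amgm a h1 h2 (a / 8) (by positivity)
  obtain ⟨p0, hp02, hp0⟩ := exists_p0 a h2 (min (1/2) (e0 / (4 * Real.exp 1))) (by positivity)
  set D0 : ℝ := 8 * c / a with hD0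
  have hD0p : 0 < D0 := by positivity
  set C : ℝ := 2 * D0 ^ (2 * a) + (2 * c + a / 8 * D0) + a / 8 * D0 with hC
  refine ⟨C, by positivity, p0, hp02, ?_⟩
  intro p hp I X Y hX hY sX sY hbig
  have hp2 : 2 ≤ p := hp02.trans hp
  have hp2' : (2:ℝ) ≤ p := by exact_mod_cast hp2
  have hpp : (0:ℝ) < p := by linarith
  have hqs := hp0 p hp
  have hrow' := hrow p hp2
  set q : ℝ := (p:ℝ) ^ (-(1 - a)) with hq
  have hq0 : 0 < q := by positivity
  have hqh : q ≤ 1/2 := hqs.trans (min_le_left _ _)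
  have hqe : q ≤ e0 / (4 * Real.exp 1) := hqs.trans (min_le_right _ _)
  set E : ℝ := Real.exp 1 * (2 * q / (1 - q)) with hE
  have hEe : E ≤ e0 := by
    have : 2 * q / (1 - q) ≤ 4 * q := by
      rw [div_le_iff₀ (by linarith)]; nlinarith
    have h3 : Real.exp 1 * (4 * q) ≤ e0 := by
      rw [le_div_iff₀ (by positivity)] at hqe; linarith
    exact (mul_le_mul_of_nonneg_left this (Real.exp_pos 1).le).trans h3
  have hE0 : 0 ≤ E := by
    have : 0 < 1 - q := by linarith
    positivity
  -- diagonal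
  have sqX := sum_pow_le a h1 I X hX
  have sqY := sum_pow_le a h1 I Y hY
  rw [sX] at sqX; rw [sY] at sqY
  simp only [Real.one_rpow, mul_one] at sqX sqY
  have hoff := schur_off q hq0 (by linarith) I (fun i => X i ^ a) (fun i => Y i ^ a)
  have hdiag : 1 - E < ∑ i ∈ I, X i ^ a * Y i ^ a := by
    rw [split_diag] at hbig
    simp only [MM_self, one_mul] at hbig
    have : E * ((∑ i ∈ I, (X i ^ a) ^ 2 + ∑ i ∈ I, (Y i ^ a) ^ 2) / 2) ≤ E * 1 := by
      gcongr; linarith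
    linarith
  obtain ⟨k, hk, hkE⟩ : ∃ k ∈ I, 1 - E ≤ (X k * Y k) ^ (a - 1/2) := by
    by_contra hcon
    push Not at hcon
    have : ∑ i ∈ I, X i ^ a * Y i ^ a ≤ ∑ i ∈ I, (1 - E) * ((X i + Y i) / 2) := by
      apply Finset.sum_le_sum
      intro i hi
      have hxy : 0 ≤ X i * Y i := mul_nonneg (hX i) (hY i)
      have e1 : X i ^ a * Y i ^ a = (X i * Y i) ^ (a - 1/2) * (X i * Y i) ^ ((1:ℝ)/2) := by
        rw [← Real.mul_rpow (hX i) (hY i)]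
        rcases hxy.eq_or_lt with h | h
        · rw [← h, Real.zero_rpow (by linarith : a ≠ 0), Real.zero_rpow (by norm_num : (1:ℝ)/2 ≠ 0), mul_zero]
        · rw [← Real.rpow_add h]; congr 1; ring
      have e2 : (X i * Y i) ^ ((1:ℝ)/2) ≤ (X i + Y i) / 2 := by
        rw [← Real.sqrt_eq_rpow]
        apply Real.sqrt_le_iff.2
        constructor
        · linarith [hX i, hY i]
        · nlinarith [sq_nonneg (X i - Y i)]
      rw [e1]
      exact mul_le_mul (hcon i hi).le e2 (by positivity) (by linarith)
    rw [← Finset.mul_sum, ← Finset.sum_div, Finset.sum_add_distrib, sX, sY] at this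
    linarith
  have leX : ∀ i ∈ I, X i ≤ 1 := fun i hi => by
    rw [← sX]; exact Finset.single_le_sum (fun i _ => hX i) hi
  have leY : ∀ i ∈ I, Y i ≤ 1 := fun i hi => by
    rw [← sY]; exact Finset.single_le_sum (fun i _ => hY i) hi
  have hXY : 1 - d0 ≤ X k * Y k := by
    by_contra hcon
    push Not at hcon
    have := Real.rpow_lt_rpow (mul_nonneg (hX k) (hY k)) hcon (by linarith : 0 < a - 1/2)
    linarith
  have hXk : 1 - d0 ≤ X k := by have := mul_le_mul_of_nonneg_left (leY k hk) (hX k); linarith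
  have hYk : 1 - d0 ≤ Y k := by have := mul_le_mul_of_nonneg_right (leX k hk) (hY k); linarith
  have sX' := Finset.add_sum_erase I X hk
  have sY' := Finset.add_sum_erase I Y hk
  rw [sX] at sX'; rw [sY] at sY'
  have r1 := hrow' I Y k hY
  have r2 := hrow' I X k hX
  have rest := schur_full q hq0 (by linarith) (I.erase k) (fun i => X i ^ a) (fun i => Y i ^ a)
  have sqX' := sum_pow_le a h1 (I.erase k) X hX
  have sqY' := sum_pow_le a h1 (I.erase k) Y hY
  have hδ0 : 0 ≤ ∑ i ∈ I.erase k, X i := Finset.sum_nonneg (fun i _ => hX i)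
  have hε0 : 0 ≤ ∑ i ∈ I.erase k, Y i := Finset.sum_nonneg (fun i _ => hY i)
  set δ := ∑ i ∈ I.erase k, X i
  set ε := ∑ i ∈ I.erase k, Y i
  have R1 : ∑ j ∈ I.erase k, MM q k j * (X k ^ a * Y j ^ a) ≤ c / p + a / 8 * ε := by
    refine le_trans (Finset.sum_le_sum ?_) r1
    intro j hj
    have : X k ^ a ≤ 1 := Real.rpow_le_one (hX k) (leX k hk) (by linarith)
    have t : 0 ≤ MM q k j * Y j ^ a := mul_nonneg (MM_nonneg q hq0.le _ _) (Real.rpow_nonneg (hY j) _)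
    have := mul_le_mul_of_nonneg_right this t
    linarith
  have R2 : ∑ i ∈ I.erase k, MM q i k * (X i ^ a * Y k ^ a) ≤ c / p + a / 8 * δ := by
    refine le_trans (Finset.sum_le_sum ?_) r2
    intro j hj
    have : Y k ^ a ≤ 1 := Real.rpow_le_one (hY k) (leY k hk) (by linarith)
    have t : 0 ≤ MM q k j * X j ^ a := mul_nonneg (MM_nonneg q hq0.le _ _) (Real.rpow_nonneg (hX j) _)
    rw [MM_symm q j k]
    have := mul_le_mul_of_nonneg_right this t
    linarith
  have R3 : ∑ i ∈ I.erase k, ∑ j ∈ I.erase k, MM q i j * (X i ^ a * Y j ^ a) ≤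
      δ ^ (2 * a - 1) * δ + ε ^ (2 * a - 1) * ε := by
    refine rest.trans ?_
    have t0 : 0 ≤ ∑ i ∈ I.erase k, (X i ^ a) ^ 2 + ∑ i ∈ I.erase k, (Y i ^ a) ^ 2 :=
      add_nonneg (Finset.sum_nonneg fun i _ => sq_nonneg _) (Finset.sum_nonneg fun i _ => sq_nonneg _)
    have : E ≤ 1 := by linarith
    have := mul_le_mul_of_nonneg_right this t0
    linarith
  have R3δ : δ ^ (2 * a - 1) ≤ a / 8 := by
    rw [← hd0e]; exact Real.rpow_le_rpow hδ0 (by linarith) (by linarith)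
  have R3ε : ε ^ (2 * a - 1) ≤ a / 8 := by
    rw [← hd0e]; exact Real.rpow_le_rpow hε0 (by linarith) (by linarith)
  have R0 : X k ^ a * Y k ^ a ≤ 1 - a / 2 * (δ + ε) := by
    have b1 : X k ^ a ≤ 1 - a * δ := by
      have := rpow_one_add_le_one_add_mul_self (s := -δ) (by linarith) (p := a) (by linarith) h2.le
      have hx : X k = 1 + -δ := by linarith
      rw [hx]; linarith
    have b2 : Y k ^ a ≤ 1 - a * ε := by
      have := rpow_one_add_le_one_add_mul_self (s := -ε) (by linarith) (p := a) (by linarith) h2.le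
      have hx : Y k = 1 + -ε := by linarith
      rw [hx]; linarith
    have c1 : 0 ≤ X k ^ a := Real.rpow_nonneg (hX k) _
    have c2 : 0 ≤ Y k ^ a := Real.rpow_nonneg (hY k) _
    have c3 : X k ^ a ≤ 1 := Real.rpow_le_one (hX k) (leX k hk) (by linarith)
    have c4 : Y k ^ a ≤ 1 := Real.rpow_le_one (hY k) (leY k hk) (by linarith)
    have d1 := mul_le_mul_of_nonneg_left c4 c1
    have d2 := mul_le_mul_of_nonneg_right c3 c2
    linarith
  rw [split_at I _ k hk, MM_self, one_mul] at hbig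
  have R3s : δ ^ (2 * a - 1) * δ + ε ^ (2 * a - 1) * ε ≤ a / 8 * (δ + ε) := by
    have d1 := mul_le_mul_of_nonneg_right R3δ hδ0
    have d2 := mul_le_mul_of_nonneg_right R3ε hε0
    linarith
  have hD : δ + ε ≤ D0 / p := by
    have : a / 4 * (δ + ε) ≤ 2 * (c / p) := by linarith
    have e : D0 / p = 4 / a * (2 * (c / p)) := by rw [hD0]; field_simp; ring
    rw [e]
    have e' : δ + ε = 4 / a * (a / 4 * (δ + ε)) := by field_simp
    rw [e']
    gcongr
  have powb : ∀ z : ℝ, 0 ≤ z → z ≤ D0 / p → z ^ (2 * a - 1) * z ≤ D0 ^ (2 * a) * (p:ℝ) ^ (-(2 * a)) := by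
    intro z hz hz'
    have : z ^ (2 * a - 1) * z = z ^ (2 * a) := by
      rcases hz.eq_or_lt with h | h
      · rw [← h, Real.zero_rpow (by linarith : 2 * a ≠ 0), mul_zero]
      · nth_rewrite 2 [← Real.rpow_one z]
        rw [← Real.rpow_add h]; congr 1; ring
    rw [this, Real.rpow_neg hpp.le, ← div_eq_mul_inv, ← Real.div_rpow hD0p.le hpp.le]
    exact Real.rpow_le_rpow hz hz' (by linarith)
  have R3' : ∑ i ∈ I.erase k, ∑ j ∈ I.erase k, MM q i j * (X i ^ a * Y j ^ a) ≤
      2 * D0 ^ (2 * a) * (p:ℝ) ^ (-(2 * a)) := by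
    have := powb δ hδ0 (by linarith)
    have := powb ε hε0 (by linarith)
    linarith
  have hne : ∀ i ∈ I.erase k, i ≠ k := fun i hi => Finset.ne_of_mem_erase hi
  refine ⟨k, hk, ?_, ?_⟩
  · rw [split_at I _ k hk]
    simp only [ne_eq, not_true_eq_false, and_false, false_and, if_false, zero_mul, Finset.sum_const_zero, add_zero, zero_add]
    have : ∑ i ∈ I.erase k, ∑ j ∈ I.erase k, (if ¬ i = k ∧ ¬ j = k then (1:ℝ) else 0) * (MM q i j * (X i ^ a * Y j ^ a))
        = ∑ i ∈ I.erase k, ∑ j ∈ I.erase k, MM q i j * (X i ^ a * Y j ^ a) := by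
      apply Finset.sum_congr rfl; intro i hi
      apply Finset.sum_congr rfl; intro j hj
      rw [if_pos ⟨hne i hi, hne j hj⟩, one_mul]
    rw [this]
    refine R3'.trans ?_
    gcongr
    rw [hC]
    have : 0 ≤ (2 * c + a / 8 * D0) + a / 8 * D0 := by positivity
    linarith
  · rw [split_at I _ k hk]
    have s1 : ∑ i ∈ I.erase k, ∑ j ∈ I.erase k, (if i ≠ k ∨ j ≠ k then (1:ℝ) else 0) * (MM q i j * (X i ^ a * Y j ^ a))
        = ∑ i ∈ I.erase k, ∑ j ∈ I.erase k, MM q i j * (X i ^ a * Y j ^ a) := by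
      apply Finset.sum_congr rfl; intro i hi
      apply Finset.sum_congr rfl; intro j hj
      rw [if_pos (Or.inl (hne i hi)), one_mul]
    have s2 : ∑ j ∈ I.erase k, (if k ≠ k ∨ j ≠ k then (1:ℝ) else 0) * (MM q k j * (X k ^ a * Y j ^ a))
        = ∑ j ∈ I.erase k, MM q k j * (X k ^ a * Y j ^ a) := by
      apply Finset.sum_congr rfl; intro j hj
      rw [if_pos (Or.inr (hne j hj)), one_mul]
    have s3 : ∑ i ∈ I.erase k, (if i ≠ k ∨ k ≠ k then (1:ℝ) else 0) * (MM q i k * (X i ^ a * Y k ^ a))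
        = ∑ i ∈ I.erase k, MM q i k * (X i ^ a * Y k ^ a) := by
      apply Finset.sum_congr rfl; intro j hj
      rw [if_pos (Or.inl (hne j hj)), one_mul]
    rw [s1, s2, s3]
    simp only [ne_eq, not_true_eq_false, or_false, if_false, zero_mul, zero_add]
    have R3'' : ∑ i ∈ I.erase k, ∑ j ∈ I.erase k, MM q i j * (X i ^ a * Y j ^ a) ≤ a / 8 * (δ + ε) := by
      linarith
    have hfin : C / p = 2 * D0 ^ (2 * a) / p + (2 * (c / p) + a / 8 * (D0 / p)) + a / 8 * (D0 / p) := by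
      rw [hC]; ring
    have : 0 ≤ 2 * D0 ^ (2 * a) / p := by positivity
    have : a / 8 * (δ + ε) ≤ a / 8 * (D0 / p) := by gcongr
    rw [hfin]
    linarith


noncomputable def rrf (e : ℕ → ℕ → ℕ) (P : Finset ℕ) (v w : ℕ) : ℝ :=
  ∏ p ∈ P, (p:ℝ) ^ (e v p - e w p)

noncomputable def rhof (e : ℕ → ℕ → ℕ) (P : Finset ℕ) (v : ℕ) : ℝ :=
  ∏ p ∈ P, (if e v p = 0 then 1 else 1 - 1 / (p:ℝ))

noncomputable def LLf (e : ℕ → ℕ → ℕ) (lam : ℕ → ℝ) (P : Finset ℕ) (v w : ℕ) : ℝ :=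
  ∑ p ∈ P, (if e v p = e w p then 0 else lam p)

def Cfg (e : ℕ → ℕ → ℕ) (lam : ℕ → ℝ) (P V W : Finset ℕ) (E : Finset (ℕ × ℕ)) (x y : ℕ → ℝ) (τ : ℝ) :
    Prop :=
  (∀ v ∈ V, ∀ v' ∈ V, (∀ p ∈ P, e v p = e v' p) → v = v') ∧
  (∀ v ∈ W, ∀ v' ∈ W, (∀ p ∈ P, e v p = e v' p) → v = v') ∧
  (E ⊆ V ×ˢ W) ∧ (∀ v, 0 ≤ x v) ∧ (∀ v, 0 ≤ y v) ∧
  (∀ q ∈ E, x q.1 * rrf e P q.2 q.1 ≤ rhof e P q.1 ∧ y q.2 * rrf e P q.1 q.2 ≤ rhof e P q.2 ∧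
    τ ≤ LLf e lam P q.1 q.2)

def Claim (e : ℕ → ℕ → ℕ) (lam : ℕ → ℝ) (a : ℝ) (P : Finset ℕ) (K : ℝ) : Prop :=
  ∀ (V W : Finset ℕ) (E : Finset (ℕ × ℕ)) (x y : ℕ → ℝ) (τ : ℝ), Cfg e lam P V W E x y τ →
    ∑ q ∈ E, x q.1 * y q.2 ≤ K * ((∑ v ∈ V, x v) * (∑ w ∈ W, y w)) ^ a * Real.exp (-τ)

lemma rhof_insert_le (e : ℕ → ℕ → ℕ) (P : Finset ℕ) (p : ℕ) (hp : p ∉ P)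
    (hP : ∀ r ∈ P, 2 ≤ r) (v : ℕ) : rhof e (insert p P) v ≤ rhof e P v := by
  unfold rhof
  rw [Finset.prod_insert hp]
  have h0 : 0 ≤ ∏ p ∈ P, (if e v p = 0 then (1:ℝ) else 1 - 1 / (p:ℝ)) := by
    apply Finset.prod_nonneg
    intro r hr
    split_ifs
    · norm_num
    · have : (2:ℝ) ≤ r := by exact_mod_cast hP r hr
      have : 1 / (r:ℝ) ≤ 1 := by rw [div_le_one (by linarith)]; linarith
      linarith
  have h1 : (if e v p = 0 then (1:ℝ) else 1 - 1 / (p:ℝ)) ≤ 1 := by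
    split_ifs
    · exact le_rfl
    · have : (0:ℝ) ≤ 1 / (p:ℝ) := by positivity
      linarith
  exact mul_le_of_le_one_left h0 h1

lemma step_ij (e : ℕ → ℕ → ℕ) (lam : ℕ → ℝ) (a : ℝ) (P : Finset ℕ) (K : ℝ)
    (hK : 0 ≤ K) (hC : Claim e lam a P K) (hP : ∀ r ∈ P, 2 ≤ r) (p : ℕ) (hp : p ∉ P) (hp2 : 2 ≤ p)
    (hl : lam p ≤ 1) (V W : Finset ℕ) (E : Finset (ℕ × ℕ)) (x y : ℕ → ℝ) (τ : ℝ)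
    (hcfg : Cfg e lam (insert p P) V W E x y τ) (i j : ℕ) :
    ∑ q ∈ E.filter (fun q => e q.1 p = i ∧ e q.2 p = j), x q.1 * y q.2 ≤
      K * Real.exp (-τ) * (MM ((p:ℝ) ^ (-(1 - a))) i j *
        ((∑ v ∈ V.filter (fun v => e v p = i), x v) ^ a * (∑ w ∈ W.filter (fun w => e w p = j), y w) ^ a)) := by
  obtain ⟨iV, iW, hE, hx, hy, hedge⟩ := hcfg
  have hp2' : (2:ℝ) ≤ p := by exact_mod_cast hp2
  have hp0 : (0:ℝ) < p := by linarith
  have := hC (V.filter (fun v => e v p = i)) (W.filter (fun w => e w p = j))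
    (E.filter (fun q => e q.1 p = i ∧ e q.2 p = j)) (fun v => (p:ℝ) ^ (j - i) * x v)
    (fun v => (p:ℝ) ^ (i - j) * y v) (τ - (if i = j then 0 else lam p)) ?_
  · simp only [← Finset.mul_sum] at this
    set Fi := ∑ v ∈ V.filter (fun v => e v p = i), x v
    set Gj := ∑ v ∈ W.filter (fun v => e v p = j), y v
    have hFi : 0 ≤ Fi := Finset.sum_nonneg (fun v _ => hx v)
    have hGj : 0 ≤ Gj := Finset.sum_nonneg (fun v _ => hy v)
    set d := (i - j) + (j - i) with hd
    have l1 : ∑ q ∈ E.filter (fun q => e q.1 p = i ∧ e q.2 p = j), (p:ℝ) ^ (j - i) * x q.1 * ((p:ℝ) ^ (i - j) * y q.2)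
        = (p:ℝ) ^ d * ∑ q ∈ E.filter (fun q => e q.1 p = i ∧ e q.2 p = j), x q.1 * y q.2 := by
      rw [Finset.mul_sum]
      apply Finset.sum_congr rfl
      intro q _
      rw [hd, pow_add]; ring
    have l2 : ((p:ℝ) ^ (j - i) * Fi * ((p:ℝ) ^ (i - j) * Gj)) ^ a = ((p:ℝ) ^ d) ^ a * (Fi ^ a * Gj ^ a) := by
      rw [← Real.mul_rpow hFi hGj, ← Real.mul_rpow (by positivity) (by positivity), hd, pow_add]
      congr 1; ring
    rw [l1, l2] at this
    have hexp : Real.exp (-(τ - (if i = j then 0 else lam p))) ≤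
        Real.exp (-τ) * (if i = j then 1 else Real.exp 1) := by
      split_ifs
      · simp
      · rw [← Real.exp_add]; apply Real.exp_le_exp.2; linarith
    have hqd : ((p:ℝ) ^ d) ^ a = (p:ℝ) ^ d * ((p:ℝ) ^ (-(1 - a))) ^ d := by
      rw [← Real.rpow_natCast, ← Real.rpow_natCast, ← Real.rpow_mul hp0.le, ← Real.rpow_mul hp0.le,
        ← Real.rpow_add hp0]
      congr 1; ring
    have h3 := this.trans (mul_le_mul_of_nonneg_left hexp (by positivity))
    rw [hqd] at h3
    refine le_of_mul_le_mul_left (h3.trans (le_of_eq ?_)) (by positivity : (0:ℝ) < (p:ℝ) ^ d)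
    unfold MM
    ring
  · refine ⟨?_, ?_, ?_, ?_, ?_, ?_⟩
    · intro v hv v' hv' h
      simp only [Finset.mem_filter] at hv hv'
      apply iV v hv.1 v' hv'.1
      intro r hr
      rcases Finset.mem_insert.1 hr with rfl | hr
      · rw [hv.2, hv'.2]
      · exact h r hr
    · intro v hv v' hv' h
      simp only [Finset.mem_filter] at hv hv'
      apply iW v hv.1 v' hv'.1
      intro r hr
      rcases Finset.mem_insert.1 hr with rfl | hr
      · rw [hv.2, hv'.2]
      · exact h r hr
    · intro q hq
      simp only [Finset.mem_filter, Finset.mem_product] at hq ⊢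
      have := Finset.mem_product.1 (hE hq.1)
      exact ⟨⟨this.1, hq.2.1⟩, ⟨this.2, hq.2.2⟩⟩
    · intro v; have := hx v; positivity
    · intro v; have := hy v; positivity
    · intro q hq
      simp only [Finset.mem_filter] at hq
      obtain ⟨hq, h1, h2⟩ := hq
      obtain ⟨c1, c2, c3⟩ := hedge q hq
      refine ⟨?_, ?_, ?_⟩
      · refine le_trans (le_of_eq ?_) (c1.trans (rhof_insert_le e P p hp hP _))
        unfold rrf
        rw [Finset.prod_insert hp, h1, h2]; ring
      · refine le_trans (le_of_eq ?_) (c2.trans (rhof_insert_le e P p hp hP _))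
        unfold rrf
        rw [Finset.prod_insert hp, h1, h2]; ring
      · unfold LLf at c3 ⊢
        rw [Finset.sum_insert hp, h1, h2] at c3
        linarith

lemma fiber_sum (e : ℕ → ℕ → ℕ) (p : ℕ) (V W : Finset ℕ) (E : Finset (ℕ × ℕ)) (x y : ℕ → ℝ)
    (hE : E ⊆ V ×ˢ W) (I : Finset ℕ) (hV : ∀ v ∈ V, e v p ∈ I) (hW : ∀ w ∈ W, e w p ∈ I) (c : ℕ → ℕ → ℝ) :
    ∑ q ∈ E, c (e q.1 p) (e q.2 p) * (x q.1 * y q.2) =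
      ∑ i ∈ I, ∑ j ∈ I, c i j * ∑ q ∈ E.filter (fun q => e q.1 p = i ∧ e q.2 p = j), x q.1 * y q.2 := by
  rw [← Finset.sum_product']
  rw [← Finset.sum_fiberwise_of_maps_to (t := I ×ˢ I) (g := fun q : ℕ × ℕ => (e q.1 p, e q.2 p))]
  · apply Finset.sum_congr rfl
    intro ij _
    rw [Finset.mul_sum]
    have : E.filter (fun q => (e q.1 p, e q.2 p) = ij) = E.filter (fun q => e q.1 p = ij.1 ∧ e q.2 p = ij.2) := by
      apply Finset.filter_congr
      intro q _
      rw [Prod.ext_iff]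
    rw [this]
    apply Finset.sum_congr rfl
    intro q hq
    simp only [Finset.mem_filter] at hq
    rw [hq.2.1, hq.2.2]
  · intro q hq
    have := Finset.mem_product.1 (hE hq)
    exact Finset.mem_product.2 ⟨hV _ this.1, hW _ this.2⟩

lemma edge_le (V W : Finset ℕ) (E : Finset (ℕ × ℕ)) (x y : ℕ → ℝ) (hE : E ⊆ V ×ˢ W)
    (hx : ∀ v, 0 ≤ x v) (hy : ∀ v, 0 ≤ y v) :
    ∑ q ∈ E, x q.1 * y q.2 ≤ (∑ v ∈ V, x v) * (∑ w ∈ W, y w) := by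
  rw [Finset.sum_mul_sum, ← Finset.sum_product']
  exact Finset.sum_le_sum_of_subset_of_nonneg hE (fun q _ _ => mul_nonneg (hx _) (hy _))

/-- the step at one prime, in normalised form -/
lemma step_norm (e : ℕ → ℕ → ℕ) (lam : ℕ → ℝ) (a : ℝ) (P : Finset ℕ) (K : ℝ)
    (hK : 0 ≤ K) (hC : Claim e lam a P K) (hP : ∀ r ∈ P, 2 ≤ r) (p : ℕ) (hp : p ∉ P) (hp2 : 2 ≤ p)
    (hl : lam p ≤ 1) (V W : Finset ℕ) (E : Finset (ℕ × ℕ)) (x y : ℕ → ℝ) (τ : ℝ)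
    (hcfg : Cfg e lam (insert p P) V W E x y τ) (hF : 0 < ∑ v ∈ V, x v) (hG : 0 < ∑ v ∈ W, y v) :
    ∃ (I : Finset ℕ) (X Y : ℕ → ℝ), (∀ i, 0 ≤ X i) ∧ (∀ i, 0 ≤ Y i) ∧
      ∑ i ∈ I, X i = 1 ∧ ∑ i ∈ I, Y i = 1 ∧ ∀ c : ℕ → ℕ → ℝ, (∀ i j, 0 ≤ c i j) →
      ∑ q ∈ E, c (e q.1 p) (e q.2 p) * (x q.1 * y q.2) ≤
        (K * ((∑ v ∈ V, x v) * (∑ w ∈ W, y w)) ^ a * Real.exp (-τ)) *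
          ∑ i ∈ I, ∑ j ∈ I, c i j * (MM ((p:ℝ) ^ (-(1 - a))) i j * (X i ^ a * Y j ^ a)) := by
  have hij := step_ij e lam a P K hK hC hP p hp hp2 hl V W E x y τ hcfg
  obtain ⟨iV, iW, hE, hx, hy, hedge⟩ := hcfg
  set F := ∑ v ∈ V, x v
  set G := ∑ v ∈ W, y v
  set I := V.image (fun v => e v p) ∪ W.image (fun v => e v p)
  have hV : ∀ v ∈ V, e v p ∈ I := fun v hv =>
    Finset.mem_union_left _ (Finset.mem_image_of_mem (fun v => e v p) hv)
  have hW : ∀ v ∈ W, e v p ∈ I := fun v hv =>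
    Finset.mem_union_right _ (Finset.mem_image_of_mem (fun v => e v p) hv)
  have nX : ∀ i, 0 ≤ ∑ v ∈ V.filter (fun v => e v p = i), x v := fun i => Finset.sum_nonneg (fun v _ => hx v)
  have nY : ∀ i, 0 ≤ ∑ v ∈ W.filter (fun v => e v p = i), y v := fun i => Finset.sum_nonneg (fun v _ => hy v)
  refine ⟨I, fun i => (∑ v ∈ V.filter (fun v => e v p = i), x v) / F,
    fun i => (∑ v ∈ W.filter (fun v => e v p = i), y v) / G, fun i => div_nonneg (nX i) hF.le,
    fun i => div_nonneg (nY i) hG.le, ?_, ?_, ?_⟩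
  · rw [← Finset.sum_div, Finset.sum_fiberwise_of_maps_to hV]
    exact div_self hF.ne'
  · rw [← Finset.sum_div, Finset.sum_fiberwise_of_maps_to hW]
    exact div_self hG.ne'
  · intro c hc
    rw [fiber_sum e p V W E x y hE I hV hW c, Finset.mul_sum]
    apply Finset.sum_le_sum; intro i _
    rw [Finset.mul_sum]
    apply Finset.sum_le_sum; intro j _
    refine (mul_le_mul_of_nonneg_left (hij i j) (hc i j)).trans (le_of_eq ?_)
    rw [Real.div_rpow (nX i) hF.le, Real.div_rpow (nY j) hG.le, Real.mul_rpow hF.le hG.le]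
    have : F ^ a ≠ 0 := (Real.rpow_pos_of_pos hF a).ne'
    have : G ^ a ≠ 0 := (Real.rpow_pos_of_pos hG a).ne'
    field_simp

/-- small primes -/
lemma small_step (a : ℝ) (h1 : 1/2 < a) (h2 : a < 1) : ∃ C : ℝ, 1 ≤ C ∧
    ∀ (e : ℕ → ℕ → ℕ) (lam : ℕ → ℝ) (P : Finset ℕ) (K : ℝ), 0 ≤ K → Claim e lam a P K →
    (∀ r ∈ P, 2 ≤ r) → ∀ p : ℕ, p ∉ P → 2 ≤ p → lam p ≤ 1 → Claim e lam a (insert p P) (C * K) := by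
  set q2 : ℝ := (2:ℝ) ^ (-(1 - a)) with hq2
  have hq20 : 0 < q2 := by positivity
  have hq21 : q2 < 1 := Real.rpow_lt_one_of_one_lt_of_neg (by norm_num) (by linarith)
  refine ⟨1 + Real.exp 1 * (2 * q2 / (1 - q2)), ?_, ?_⟩
  · have : 0 < 1 - q2 := by linarith
    have : 0 ≤ Real.exp 1 * (2 * q2 / (1 - q2)) := by positivity
    linarith
  intro e lam P K hK hC hP p hp hp2 hl V W E x y τ hcfg
  have hp2' : (2:ℝ) ≤ p := by exact_mod_cast hp2
  have hE := hcfg.2.2.1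
  have hx := hcfg.2.2.2.1
  have hy := hcfg.2.2.2.2.1
  have hF0 : 0 ≤ ∑ v ∈ V, x v := Finset.sum_nonneg (fun v _ => hx v)
  have hG0 : 0 ≤ ∑ v ∈ W, y v := Finset.sum_nonneg (fun v _ => hy v)
  have hle := edge_le V W E x y hE hx hy
  rcases hF0.eq_or_lt with hF | hF
  · rw [← hF] at hle ⊢
    rw [zero_mul] at hle ⊢
    rw [Real.zero_rpow (by linarith)]
    simpa using hle
  rcases hG0.eq_or_lt with hG | hG
  · rw [← hG] at hle ⊢
    rw [mul_zero] at hle ⊢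
    rw [Real.zero_rpow (by linarith)]
    simpa using hle
  obtain ⟨I, X, Y, hX, hY, sX, sY, hc⟩ := step_norm e lam a P K hK hC hP p hp hp2 hl V W E x y τ hcfg hF hG
  have := hc (fun _ _ => 1) (fun _ _ => zero_le_one)
  simp only [one_mul] at this
  set q : ℝ := (p:ℝ) ^ (-(1 - a)) with hq
  have hq0 : 0 < q := by positivity
  have hqq : q ≤ q2 := Real.rpow_le_rpow_of_nonpos (by norm_num) hp2' (by linarith)
  have hs := schur_norm a h1 q hq0 (by linarith) I X Y hX hY sX sY
  have hm : 1 + Real.exp 1 * (2 * q / (1 - q)) ≤ 1 + Real.exp 1 * (2 * q2 / (1 - q2)) := by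
    have : 0 < 1 - q2 := by linarith
    gcongr
  refine this.trans ?_
  refine (mul_le_mul_of_nonneg_left (hs.trans hm) (by positivity)).trans (le_of_eq ?_)
  ring

/-- subgraph of large minimum degree -/
lemma min_deg (E : Finset (ℕ × ℕ)) (x y : ℕ → ℝ) (hx : ∀ v, 0 ≤ x v) (hy : ∀ v, 0 ≤ y v)
    (c1 c2 : ℝ) (hc2 : 0 ≤ c2) (n : ℕ) : ∀ V W : Finset ℕ, V.card + W.card = n →
    0 < (∑ v ∈ V, ∑ w ∈ W, if (v, w) ∈ E then x v * y w else 0) - c1 * ∑ v ∈ V, x v - c2 * ∑ w ∈ W, y w →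
    ∃ V' W' : Finset ℕ, V' ⊆ V ∧ W' ⊆ W ∧ V'.Nonempty ∧
      (∀ v ∈ V', c1 ≤ ∑ w ∈ W', if (v, w) ∈ E then y w else 0) ∧
      (∀ w ∈ W', c2 ≤ ∑ v ∈ V', if (v, w) ∈ E then x v else 0) := by
  induction n with
  | zero =>
    intro V W hn h
    have : V = ∅ := by rw [← Finset.card_eq_zero]; omega
    have : W = ∅ := by rw [← Finset.card_eq_zero]; omega
    subst V W
    simp at h
  | succ n ih =>
    intro V W hn h
    by_cases hV : ∃ v ∈ V, (∑ w ∈ W, if (v, w) ∈ E then y w else 0) < c1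
    · obtain ⟨v, hv, hd⟩ := hV
      obtain ⟨V', W', a1, a2, a3⟩ := ih (V.erase v) W (by rw [Finset.card_erase_of_mem hv]; have := Finset.card_pos.2 ⟨v, hv⟩; omega) (by
        rw [← Finset.add_sum_erase V _ hv, ← Finset.add_sum_erase V x hv] at h
        have : (∑ w ∈ W, if (v, w) ∈ E then x v * y w else 0) = x v * ∑ w ∈ W, if (v, w) ∈ E then y w else 0 := by
          rw [Finset.mul_sum]; apply Finset.sum_congr rfl; intro w _; split_ifs <;> simp
        rw [this] at h
        nlinarith [mul_le_mul_of_nonneg_left hd.le (hx v)])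
      exact ⟨V', W', a1.trans (Finset.erase_subset _ _), a2, a3⟩
    by_cases hW : ∃ w ∈ W, (∑ v ∈ V, if (v, w) ∈ E then x v else 0) < c2
    · obtain ⟨w, hw, hd⟩ := hW
      obtain ⟨V', W', a1, a2, a3⟩ := ih V (W.erase w) (by rw [Finset.card_erase_of_mem hw]; have := Finset.card_pos.2 ⟨w, hw⟩; omega) (by
        rw [Finset.sum_comm] at h ⊢
        rw [← Finset.add_sum_erase W _ hw, ← Finset.add_sum_erase W y hw] at h
        have : (∑ v ∈ V, if (v, w) ∈ E then x v * y w else 0) = y w * ∑ v ∈ V, if (v, w) ∈ E then x v else 0 := by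
          rw [Finset.mul_sum]; apply Finset.sum_congr rfl; intro v _; split_ifs
          · ring
          · simp
        rw [this] at h
        nlinarith [mul_le_mul_of_nonneg_left hd.le (hy w)])
      exact ⟨V', W', a1, a2.trans (Finset.erase_subset _ _), a3⟩
    push Not at hV hW
    refine ⟨V, W, subset_rfl, subset_rfl, ?_, hV, hW⟩
    by_contra hne
    rw [Finset.not_nonempty_iff_eq_empty] at hne
    subst hne
    have := mul_nonneg hc2 (Finset.sum_nonneg (fun w (_ : w ∈ W) => hy w))
    simp at h
    linarith


def plusf (e : ℕ → ℕ → ℕ) (k : ℕ → ℕ) (P : Finset ℕ) (v : ℕ) : ℕ := ∏ p ∈ P, p ^ (e v p - k p)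

def lowf (e : ℕ → ℕ → ℕ) (k : ℕ → ℕ) (P : Finset ℕ) (v : ℕ) : ℕ := ∏ p ∈ P, p ^ (min (e v p) (k p))

lemma sigma_bound (k : ℕ → ℕ) (P : Finset ℕ) (hP : ∀ p ∈ P, p.Prime) :
    ((∑ d ∈ (∏ p ∈ P, p ^ k p).divisors, d : ℕ) : ℝ) * (∏ p ∈ P, (if k p = 0 then 1 else 1 - 1 / (p:ℝ)))
      ≤ ((∏ p ∈ P, p ^ k p : ℕ) : ℝ) := by
  induction P using Finset.induction_on with
  | empty => simp
  | insert p P hp ih =>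
    have ih := ih (fun r hr => hP r (Finset.mem_insert_of_mem hr))
    have hpp := hP p (Finset.mem_insert_self _ _)
    have hp2 : (2:ℝ) ≤ p := by exact_mod_cast hpp.two_le
    rw [Finset.prod_insert hp, Finset.prod_insert hp]
    have hcop : Nat.Coprime (p ^ k p) (∏ p ∈ P, p ^ k p) := by
      apply Nat.Coprime.prod_right
      intro r hr
      apply Nat.Coprime.pow
      apply (Nat.coprime_primes hpp (hP r (Finset.mem_insert_of_mem hr))).2
      rintro rfl
      exact hp hr
    rw [hcop.sum_divisors_mul]
    have h1 : ((∑ d ∈ (p ^ k p).divisors, d : ℕ) : ℝ) * (if k p = 0 then 1 else 1 - 1 / (p:ℝ)) ≤ ((p ^ k p : ℕ) : ℝ) := by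
      split_ifs with h
      · simp [h]
      · rw [Nat.sum_divisors_prime_pow hpp]
        push_cast
        have g := geom_sum_mul (p:ℝ) (k p + 1)
        have : (p:ℝ) * ((∑ i ∈ Finset.range (k p + 1), (p:ℝ) ^ i) * (1 - 1 / (p:ℝ))) ≤ p * (p:ℝ) ^ k p := by
          have e : (p:ℝ) * ((∑ i ∈ Finset.range (k p + 1), (p:ℝ) ^ i) * (1 - 1 / (p:ℝ)))
            = (∑ i ∈ Finset.range (k p + 1), (p:ℝ) ^ i) * (p - 1) := by field_simp
          rw [e, g, pow_succ]; linarith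
        exact le_of_mul_le_mul_left this (by linarith)
    have n1 : 0 ≤ ∏ p ∈ P, (if k p = 0 then (1:ℝ) else 1 - 1 / (p:ℝ)) := by
      apply Finset.prod_nonneg
      intro r hr
      have : (2:ℝ) ≤ r := by exact_mod_cast (hP r (Finset.mem_insert_of_mem hr)).two_le
      have : 1 / (r:ℝ) ≤ 1 := by rw [div_le_one (by linarith)]; linarith
      split_ifs <;> linarith
    have := mul_le_mul h1 ih (mul_nonneg (Nat.cast_nonneg _) n1) (Nat.cast_nonneg _)
    push_cast at this ⊢
    refine le_trans (le_of_eq ?_) this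
    ring

lemma fact_prod (P : Finset ℕ) (hP : ∀ p ∈ P, p.Prime) (g : ℕ → ℕ) (r : ℕ) (hr : r ∈ P) :
    (∏ p ∈ P, p ^ g p).factorization r = g r := by
  rw [Nat.factorization_prod (fun p hp => pow_ne_zero _ (hP p hp).ne_zero), Finsupp.finsetSum_apply,
    Finset.sum_eq_single r]
  · simp [(hP r hr).factorization_pow]
  · intro b hb hbr
    rw [(hP b hb).factorization_pow]
    simp [hbr]
  · intro h; exact absurd hr h

lemma deg_bound (e : ℕ → ℕ → ℕ) (k : ℕ → ℕ) (P : Finset ℕ) (hP : ∀ p ∈ P, p.Prime) (v0 : ℕ) (Γ : Finset ℕ)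
    (inj : ∀ v ∈ Γ, ∀ v' ∈ Γ, (∀ p ∈ P, e v p = e v' p) → v = v') (y : ℕ → ℝ) (hy : ∀ w, 0 ≤ y w)
    (hedge : ∀ w ∈ Γ, y w * rrf e P v0 w ≤ rhof e P w)
    (hcop : ∀ w ∈ Γ, ∀ p ∈ P, e v0 p = k p ∨ e w p = k p)
    (hoff : ∀ w ∈ Γ, ∑ p ∈ P, (if e w p = k p then 0 else 1 / (p:ℝ)) ≤ 1) (Y : ℕ)
    (hY : ∀ w ∈ Γ, plusf e k P w ≤ Y) :
    (∑ w ∈ Γ, y w) * plusf e k P v0 ≤ Real.exp 2 * Y := by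
  set N0 : ℕ := ∏ p ∈ P, p ^ k p with hN0
  have hpos : ∀ p ∈ P, (0:ℝ) < p := fun p hp => by exact_mod_cast (hP p hp).pos
  have hN0p : 0 < N0 := Finset.prod_pos (fun p hp => pow_pos (hP p hp).pos _)
  set R : ℝ := ∏ p ∈ P, (if k p = 0 then 1 else 1 - 1 / (p:ℝ)) with hR
  have hR0 : 0 ≤ R := by
    apply Finset.prod_nonneg
    intro r hr
    have : (2:ℝ) ≤ r := by exact_mod_cast (hP r hr).two_le
    have : 1 / (r:ℝ) ≤ 1 := by rw [div_le_one (by linarith)]; linarith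
    split_ifs <;> linarith
  have key : ∀ w ∈ Γ, y w * plusf e k P v0 * N0 ≤ Real.exp 2 * R * lowf e k P w := by
    intro w hw
    have e1 : (plusf e k P v0 : ℝ) * N0 = rrf e P v0 w * lowf e k P w := by
      unfold plusf lowf rrf
      rw [hN0]
      push_cast
      rw [← Finset.prod_mul_distrib, ← Finset.prod_mul_distrib]
      apply Finset.prod_congr rfl
      intro p hp
      rw [← pow_add, ← pow_add]
      congr 1
      rcases hcop w hw p hp with h | h <;> omega
    have e2 : rhof e P w ≤ R * Real.exp 2 := by
      have : rhof e P w ≤ ∏ p ∈ P, ((if k p = 0 then 1 else 1 - 1 / (p:ℝ)) *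
          Real.exp (2 * (if e w p = k p then 0 else 1 / (p:ℝ)))) := by
        unfold rhof
        apply Finset.prod_le_prod
        · intro r hr
          have : (2:ℝ) ≤ r := by exact_mod_cast (hP r hr).two_le
          have : 1 / (r:ℝ) ≤ 1 := by rw [div_le_one (by linarith)]; linarith
          split_ifs <;> linarith
        · intro r hr
          have h2 : (2:ℝ) ≤ r := by exact_mod_cast (hP r hr).two_le
          have hh : 1 / (r:ℝ) ≤ 1 / 2 := one_div_le_one_div_of_le (by norm_num) h2
          have hn : 0 ≤ 1 / (r:ℝ) := by positivity
          by_cases h : e w r = k r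
          · rw [h]; simp
          · rw [if_neg h]
            set z := 1 / (r:ℝ)
            have hexp : 1 + 2 * z ≤ Real.exp (2 * z) := by linarith [Real.add_one_le_exp (2 * z)]
            have l1 : (if e w r = 0 then (1:ℝ) else 1 - z) ≤ 1 := by split_ifs <;> linarith
            refine l1.trans ?_
            have l2 : 1 - z ≤ (if k r = 0 then (1:ℝ) else 1 - z) := by split_ifs <;> linarith
            calc (1:ℝ) ≤ (1 - z) * (1 + 2 * z) := by nlinarith
              _ ≤ _ := mul_le_mul l2 hexp (by linarith) (by linarith)
      refine this.trans ?_
      rw [Finset.prod_mul_distrib, ← Real.exp_sum, ← Finset.mul_sum]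
      apply mul_le_mul_of_nonneg_left _ hR0
      apply Real.exp_le_exp.2
      linarith [hoff w hw]
    calc y w * plusf e k P v0 * N0 = y w * rrf e P v0 w * lowf e k P w := by rw [mul_assoc, e1]; ring
      _ ≤ (R * Real.exp 2) * lowf e k P w :=
          mul_le_mul_of_nonneg_right ((hedge w hw).trans e2) (Nat.cast_nonneg _)
      _ = _ := by ring
  have hsum : ∑ w ∈ Γ, (lowf e k P w : ℝ) ≤ Y * ((∑ d ∈ N0.divisors, d : ℕ) : ℝ) := by
    have : ∑ w ∈ Γ, lowf e k P w ≤ Y * ∑ d ∈ N0.divisors, d := by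
      calc ∑ w ∈ Γ, lowf e k P w = ∑ z ∈ Γ.image (fun w => (plusf e k P w, lowf e k P w)), z.2 := by
            rw [Finset.sum_image]
            intro w hw w' hw' h
            simp only [Prod.mk.injEq] at h
            apply inj w hw w' hw'
            intro p hp
            have f1 := fact_prod P hP (fun p => e w p - k p) p hp
            have f2 := fact_prod P hP (fun p => e w' p - k p) p hp
            have f3 := fact_prod P hP (fun p => min (e w p) (k p)) p hp
            have f4 := fact_prod P hP (fun p => min (e w' p) (k p)) p hp
            unfold plusf lowf at h
            rw [h.1] at f1
            rw [h.2] at f3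
            omega
        _ ≤ ∑ z ∈ Finset.Icc 1 Y ×ˢ N0.divisors, z.2 := by
            apply Finset.sum_le_sum_of_subset
            intro z hz
            simp only [Finset.mem_image] at hz
            obtain ⟨w, hw, rfl⟩ := hz
            simp only [Finset.mem_product, Finset.mem_Icc, Nat.mem_divisors]
            refine ⟨⟨Finset.prod_pos (fun p hp => pow_pos (hP p hp).pos _), hY w hw⟩, ?_, hN0p.ne'⟩
            apply Finset.prod_dvd_prod_of_dvd
            intro p _
            exact pow_dvd_pow _ (min_le_right _ _)
        _ = Y * ∑ d ∈ N0.divisors, d := by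
            rw [Finset.sum_product]
            simp
    exact_mod_cast this
  have hs := sigma_bound k P hP
  have tot : ((∑ w ∈ Γ, y w) * plusf e k P v0) * N0 ≤ (Real.exp 2 * Y) * N0 := by
    calc ((∑ w ∈ Γ, y w) * plusf e k P v0) * N0 = ∑ w ∈ Γ, y w * plusf e k P v0 * N0 := by
          rw [Finset.sum_mul, Finset.sum_mul]
      _ ≤ ∑ w ∈ Γ, Real.exp 2 * R * lowf e k P w := Finset.sum_le_sum key
      _ = Real.exp 2 * R * ∑ w ∈ Γ, (lowf e k P w : ℝ) := by rw [Finset.mul_sum]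
      _ ≤ Real.exp 2 * R * (Y * ((∑ d ∈ N0.divisors, d : ℕ) : ℝ)) := by gcongr
      _ = Real.exp 2 * Y * (((∑ d ∈ N0.divisors, d : ℕ) : ℝ) * R) := by ring
      _ ≤ _ := by gcongr
  exact le_of_mul_le_mul_right tot (by exact_mod_cast hN0p)

lemma structured (e : ℕ → ℕ → ℕ) (k : ℕ → ℕ) (P : Finset ℕ) (hP : ∀ p ∈ P, p.Prime) (V W : Finset ℕ)
    (E : Finset (ℕ × ℕ)) (x y : ℕ → ℝ) (hx : ∀ w, 0 ≤ x w) (hy : ∀ w, 0 ≤ y w)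
    (injV : ∀ v ∈ V, ∀ v' ∈ V, (∀ p ∈ P, e v p = e v' p) → v = v')
    (injW : ∀ v ∈ W, ∀ v' ∈ W, (∀ p ∈ P, e v p = e v' p) → v = v')
    (hedge : ∀ q ∈ E, x q.1 * rrf e P q.2 q.1 ≤ rhof e P q.1 ∧ y q.2 * rrf e P q.1 q.2 ≤ rhof e P q.2)
    (hcop : ∀ q ∈ E, ∀ p ∈ P, e q.1 p = k p ∨ e q.2 p = k p)
    (hoff1 : ∀ q ∈ E, ∑ p ∈ P, (if e q.1 p = k p then 0 else 1 / (p:ℝ)) ≤ 1)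
    (hoff2 : ∀ q ∈ E, ∑ p ∈ P, (if e q.2 p = k p then 0 else 1 / (p:ℝ)) ≤ 1)
    (hV : V.Nonempty) (c1 c2 : ℝ) (hc1 : 0 < c1) (hc2 : 0 < c2)
    (d1 : ∀ v ∈ V, c1 ≤ ∑ w ∈ W, if (v, w) ∈ E then y w else 0)
    (d2 : ∀ w ∈ W, c2 ≤ ∑ v ∈ V, if (v, w) ∈ E then x v else 0) : c1 * c2 ≤ Real.exp 2 * Real.exp 2 := by
  obtain ⟨v0, hv0, hmax⟩ := Finset.exists_max_image V (plusf e k P) hV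
  have D1 := d1 v0 hv0
  rw [← Finset.sum_filter] at D1
  have hne : (W.filter (fun w => (v0, w) ∈ E)).Nonempty := by
    by_contra h
    rw [Finset.not_nonempty_iff_eq_empty] at h
    rw [h] at D1
    simp at D1; linarith
  obtain ⟨w0, hw0, hmaxw⟩ := Finset.exists_max_image _ (plusf e k P) hne
  have hw0' := (Finset.mem_filter.1 hw0)
  have D2 := d2 w0 hw0'.1
  rw [← Finset.sum_filter] at D2
  have b1 := deg_bound e k P hP v0 (W.filter (fun w => (v0, w) ∈ E))
    (fun v hv v' hv' h => injW v (Finset.mem_filter.1 hv).1 v' (Finset.mem_filter.1 hv').1 h) y hy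
    (fun w hw => (hedge _ (Finset.mem_filter.1 hw).2).2)
    (fun w hw => hcop _ (Finset.mem_filter.1 hw).2)
    (fun w hw => hoff2 _ (Finset.mem_filter.1 hw).2) (plusf e k P w0) hmaxw
  have b2 := deg_bound e k P hP w0 (V.filter (fun v => (v, w0) ∈ E))
    (fun v hv v' hv' h => injV v (Finset.mem_filter.1 hv).1 v' (Finset.mem_filter.1 hv').1 h) x hx
    (fun w hw => (hedge _ (Finset.mem_filter.1 hw).2).1)
    (fun w hw p hp => (hcop _ (Finset.mem_filter.1 hw).2 p hp).symm)
    (fun w hw => hoff1 _ (Finset.mem_filter.1 hw).2) (plusf e k P v0)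
    (fun v hv => hmax v (Finset.mem_filter.1 hv).1)
  have p1 : (0:ℝ) < plusf e k P v0 := by
    have : 0 < plusf e k P v0 := Finset.prod_pos (fun p hp => pow_pos (hP p hp).pos _)
    exact_mod_cast this
  have p2 : (0:ℝ) < plusf e k P w0 := by
    have : 0 < plusf e k P w0 := Finset.prod_pos (fun p hp => pow_pos (hP p hp).pos _)
    exact_mod_cast this
  set s := (plusf e k P v0 : ℝ)
  set r := (plusf e k P w0 : ℝ)
  have q1 : c1 * s ≤ Real.exp 2 * r := (mul_le_mul_of_nonneg_right D1 p1.le).trans b1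
  have q2 : c2 * r ≤ Real.exp 2 * s := (mul_le_mul_of_nonneg_right D2 p2.le).trans b2
  have := mul_le_mul q1 q2 (by positivity) (by positivity)
  refine le_of_mul_le_mul_right (a := s * r) ?_ (by positivity)
  linarith

lemma tail_small (a : ℝ) (h1 : 1/2 < a) (C : ℝ) : ∃ n0 : ℕ, ∀ P : Finset ℕ, (∀ p ∈ P, n0 ≤ p) →
    ∑ p ∈ P, (C * (p:ℝ) ^ (-(2 * a)) + C * ((p:ℝ) ^ 2)⁻¹) ≤ 1 / 4 := by
  have hs : Summable (fun p : ℕ => C * (p:ℝ) ^ (-(2 * a)) + C * ((p:ℝ) ^ 2)⁻¹) := by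
    apply Summable.add
    · apply Summable.mul_left
      exact Real.summable_nat_rpow.2 (by linarith)
    · apply Summable.mul_left
      exact Real.summable_nat_pow_inv.2 (by norm_num)
  obtain ⟨s, hs⟩ := summable_iff_vanishing_norm.1 hs (1/4) (by norm_num)
  refine ⟨s.sup id + 1, fun P hP => ?_⟩
  have := hs P (by
    rw [Finset.disjoint_left]
    intro p hp hps
    have h1 := hP p hp
    have h2 := Finset.le_sup (f := id) hps
    simp at h2
    omega)
  exact (le_abs_self _).trans this.le


lemma core (e : ℕ → ℕ → ℕ) (lam : ℕ → ℝ) (hl0 : ∀ p, 0 ≤ lam p)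
    (hls : ∀ Q : Finset ℕ, ∑ p ∈ Q, lam p / p ≤ 2) (a C : ℝ) (hC : 0 < C) (P : Finset ℕ)
    (hP : ∀ p ∈ P, p.Prime)
    (htail : ∑ p ∈ P, (C * (p:ℝ) ^ (-(2 * a)) + C * ((p:ℝ) ^ 2)⁻¹) ≤ 1 / 4)
    (V W : Finset ℕ) (E : Finset (ℕ × ℕ)) (x y : ℕ → ℝ) (τ : ℝ) (hcfg : Cfg e lam P V W E x y τ)
    (S : ℝ) (hS : S = ∑ q ∈ E, x q.1 * y q.2) (hS0 : 0 < S)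
    (hF : 0 < ∑ v ∈ V, x v) (hG : 0 < ∑ v ∈ W, y v) (k : ℕ → ℕ)
    (hk1 : ∀ p ∈ P, ∑ q ∈ E, (if e q.1 p ≠ k p ∧ e q.2 p ≠ k p then 1 else 0) * (x q.1 * y q.2)
      ≤ C * (p:ℝ) ^ (-(2 * a)) * S)
    (hk2 : ∀ p ∈ P, ∑ q ∈ E, (if e q.1 p ≠ k p ∨ e q.2 p ≠ k p then 1 else 0) * (x q.1 * y q.2)
      ≤ C / p * S) :
    τ ≤ 8 * C ∧ S ^ 2 ≤ 64 * (Real.exp 2 * Real.exp 2) * ((∑ v ∈ V, x v) * (∑ w ∈ W, y w)) := by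
  classical
  obtain ⟨iV, iW, hE, hx, hy, hedge⟩ := hcfg
  set F := ∑ v ∈ V, x v
  set G := ∑ v ∈ W, y v
  let bo : ℕ × ℕ → ℕ → ℝ := fun q p => if e q.1 p ≠ k p ∧ e q.2 p ≠ k p then 1 else 0
  let ao : ℕ × ℕ → ℕ → ℝ := fun q p => if e q.1 p ≠ k p ∨ e q.2 p ≠ k p then 1 else 0
  have bo0 : ∀ q p, 0 ≤ bo q p := fun q p => by simp only [bo]; split_ifs <;> norm_num
  have ao0 : ∀ q p, 0 ≤ ao q p := fun q p => by simp only [ao]; split_ifs <;> norm_num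
  let b : ℕ × ℕ → ℝ := fun q => ∑ p ∈ P, (bo q p + ao q p * (1 / p) + ao q p * (lam p / (8 * C)))
  have t0 : ∀ q p, 0 ≤ bo q p + ao q p * (1 / (p:ℝ)) + ao q p * (lam p / (8 * C)) := fun q p => by
    have := bo0 q p; have := ao0 q p; have := hl0 p
    positivity
  have hxy : ∀ q : ℕ × ℕ, 0 ≤ x q.1 * y q.2 := fun q => mul_nonneg (hx _) (hy _)
  have hb : ∑ q ∈ E, b q * (x q.1 * y q.2) ≤ S / 2 := by
    have e1 : ∑ q ∈ E, b q * (x q.1 * y q.2) = ∑ p ∈ P, (∑ q ∈ E, bo q p * (x q.1 * y q.2)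
        + (1 / (p:ℝ)) * ∑ q ∈ E, ao q p * (x q.1 * y q.2)
        + (lam p / (8 * C)) * ∑ q ∈ E, ao q p * (x q.1 * y q.2)) := by
      simp only [b, Finset.sum_mul]
      rw [Finset.sum_comm]
      apply Finset.sum_congr rfl
      intro p _
      rw [Finset.mul_sum, Finset.mul_sum, ← Finset.sum_add_distrib, ← Finset.sum_add_distrib]
      apply Finset.sum_congr rfl
      intro q _
      ring
    rw [e1]
    calc _ ≤ ∑ p ∈ P, ((C * (p:ℝ) ^ (-(2 * a)) + C * ((p:ℝ) ^ 2)⁻¹) * S + (lam p / p) * (S / 8)) := by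
          apply Finset.sum_le_sum
          intro p hp
          have hp0 : (0:ℝ) < p := by exact_mod_cast (hP p hp).pos
          have h1 := hk1 p hp
          have h2 := mul_le_mul_of_nonneg_left (hk2 p hp) (by positivity : 0 ≤ 1 / (p:ℝ))
          have h3 := mul_le_mul_of_nonneg_left (hk2 p hp) (by have := hl0 p; positivity : 0 ≤ lam p / (8 * C))
          have g2 : 1 / (p:ℝ) * (C / p * S) = C * ((p:ℝ) ^ 2)⁻¹ * S := by field_simp
          have g3 : lam p / (8 * C) * (C / p * S) = (lam p / p) * (S / 8) := by field_simp
          rw [g2] at h2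
          rw [g3] at h3
          simp only [bo, ao]
          linarith
      _ = (∑ p ∈ P, (C * (p:ℝ) ^ (-(2 * a)) + C * ((p:ℝ) ^ 2)⁻¹)) * S + (∑ p ∈ P, lam p / p) * (S / 8) := by
          rw [Finset.sum_add_distrib, Finset.sum_mul, Finset.sum_mul]
      _ ≤ 1 / 4 * S + 2 * (S / 8) := by
          have := hls P
          gcongr
      _ = S / 2 := by ring
  set E' := E.filter (fun q => b q < 1) with hE'
  set S' := ∑ q ∈ E', x q.1 * y q.2 with hS'
  have hS'S : S / 2 ≤ S' := by
    have h1 := Finset.sum_filter_add_sum_filter_not E (fun q => b q < 1) (fun q => x q.1 * y q.2)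
    have h2 : ∑ q ∈ E with ¬ b q < 1, x q.1 * y q.2 ≤ ∑ q ∈ E, b q * (x q.1 * y q.2) := by
      calc _ ≤ ∑ q ∈ E with ¬ b q < 1, b q * (x q.1 * y q.2) := by
            apply Finset.sum_le_sum
            intro q hq
            have := (Finset.mem_filter.1 hq).2
            push Not at this
            exact le_mul_of_one_le_left (hxy q) this
        _ ≤ _ := Finset.sum_le_sum_of_subset_of_nonneg (Finset.filter_subset _ _)
            (fun q _ _ => mul_nonneg (Finset.sum_nonneg (fun p _ => t0 q p)) (hxy q))
    rw [← hS] at h1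
    linarith
  have hS'0 : 0 < S' := by linarith
  have hE'E : E' ⊆ E := Finset.filter_subset _ _
  have hbp : ∀ q ∈ E', ∀ p ∈ P, bo q p + ao q p * (1 / (p:ℝ)) + ao q p * (lam p / (8 * C)) < 1 := by
    intro q hq p hp
    exact (Finset.single_le_sum (f := fun p => bo q p + ao q p * (1 / (p:ℝ)) + ao q p * (lam p / (8 * C)))
      (fun p _ => t0 q p) hp).trans_lt (Finset.mem_filter.1 hq).2
  have hcop : ∀ q ∈ E', ∀ p ∈ P, e q.1 p = k p ∨ e q.2 p = k p := by
    intro q hq p hp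
    by_contra h
    push Not at h
    have h1 := hbp q hq p hp
    have h2 : bo q p = 1 := if_pos h
    have := ao0 q p; have := hl0 p
    have : 0 ≤ ao q p * (1 / (p:ℝ)) := by positivity
    have : 0 ≤ ao q p * (lam p / (8 * C)) := by positivity
    linarith
  have hao : ∀ q ∈ E', ∑ p ∈ P, ao q p * (1 / (p:ℝ)) ≤ 1 := by
    intro q hq
    refine le_trans ?_ (Finset.mem_filter.1 hq).2.le
    apply Finset.sum_le_sum
    intro p _
    have := bo0 q p
    have := ao0 q p; have := hl0 p
    have : 0 ≤ ao q p * (lam p / (8 * C)) := by positivity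
    linarith
  have hoff1 : ∀ q ∈ E', ∑ p ∈ P, (if e q.1 p = k p then 0 else 1 / (p:ℝ)) ≤ 1 := by
    intro q hq
    refine le_trans ?_ (hao q hq)
    apply Finset.sum_le_sum
    intro p _
    split_ifs with h
    · have := ao0 q p; positivity
    · have : ao q p = 1 := if_pos (Or.inl h)
      rw [this, one_mul]
  have hoff2 : ∀ q ∈ E', ∑ p ∈ P, (if e q.2 p = k p then 0 else 1 / (p:ℝ)) ≤ 1 := by
    intro q hq
    refine le_trans ?_ (hao q hq)
    apply Finset.sum_le_sum
    intro p _
    split_ifs with h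
    · have := ao0 q p; positivity
    · have : ao q p = 1 := if_pos (Or.inr h)
      rw [this, one_mul]
  have hne : E'.Nonempty := by
    by_contra h
    rw [Finset.not_nonempty_iff_eq_empty] at h
    rw [hS', h] at hS'0
    simp at hS'0
  constructor
  · obtain ⟨q, hq⟩ := hne
    have h1 := (hedge q (hE'E hq)).2.2
    have h2 : LLf e lam P q.1 q.2 ≤ 8 * C * b q := by
      unfold LLf
      simp only [b]
      rw [Finset.mul_sum]
      apply Finset.sum_le_sum
      intro p _
      have n1 := bo0 q p
      have n2 := ao0 q p; have n3 := hl0 p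
      split_ifs with h
      · have := t0 q p; positivity
      · have : ao q p = 1 := if_pos (by
          by_contra h'
          push Not at h'
          exact h (h'.1.trans h'.2.symm))
        rw [this]
        have g : lam p = 8 * C * (1 * (lam p / (8 * C))) := by field_simp
        have : 0 ≤ 8 * C * (bo q p + 1 * (1 / (p:ℝ))) := by positivity
        nlinarith
    have h3 := (Finset.mem_filter.1 hq).2
    nlinarith
  · have hdb : (∑ v ∈ V, ∑ w ∈ W, if (v, w) ∈ E' then x v * y w else 0) = S' := by
      rw [← Finset.sum_product' (f := fun v w => if (v, w) ∈ E' then x v * y w else 0), hS',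
        ← Finset.sum_filter]
      apply Finset.sum_congr
      · ext q
        simp only [Finset.mem_filter, Prod.mk.eta]
        exact ⟨fun h => h.2, fun h => ⟨hE (hE'E h), h⟩⟩
      · intros; rfl
    obtain ⟨V', W', hV', hW', hVn, d1, d2⟩ := min_deg E' x y hx hy (S' / (4 * F)) (S' / (4 * G)) (by positivity) _ V W rfl (by
      rw [hdb]
      have g1 : S' / (4 * F) * F = S' / 4 := by field_simp
      have g2 : S' / (4 * G) * G = S' / 4 := by field_simp
      change 0 < S' - S' / (4 * F) * F - S' / (4 * G) * G
      rw [g1, g2]; linarith)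
    have hst := structured e k P hP V' W' E' x y hx hy
      (fun v hv v' hv' => iV v (hV' hv) v' (hV' hv')) (fun v hv v' hv' => iW v (hW' hv) v' (hW' hv'))
      (fun q hq => ⟨(hedge q (hE'E hq)).1, (hedge q (hE'E hq)).2.1⟩) hcop hoff1 hoff2 hVn _ _
      (by positivity) (by positivity) d1 d2
    have : S' / (4 * F) * (S' / (4 * G)) = S' ^ 2 / (16 * (F * G)) := by field_simp; norm_num
    rw [this, div_le_iff₀ (by positivity)] at hst
    nlinarith

lemma large (a : ℝ) (h1 : 1/2 < a) (h2 : a < 1) : ∃ K : ℝ, 0 < K ∧ ∃ p0 : ℕ, ∀ (e : ℕ → ℕ → ℕ) (lam : ℕ → ℝ),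
    (∀ p, 0 ≤ lam p ∧ lam p ≤ 1) → (∀ Q : Finset ℕ, ∑ p ∈ Q, lam p / p ≤ 2) →
    ∀ P : Finset ℕ, (∀ p ∈ P, p.Prime ∧ p0 ≤ p) → Claim e lam a P K := by
  obtain ⟨C, hC, p0, hp0, hA⟩ := lemA a h1 h2
  obtain ⟨n0, hn0⟩ := tail_small a h1 C
  set D : ℝ := 8 * Real.exp 2 with hD
  have hD1 : 1 ≤ D := by
    have := Real.add_one_le_exp (2:ℝ)
    linarith
  refine ⟨D * Real.exp (8 * C), by positivity, max p0 n0, ?_⟩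
  intro e lam hl hls P
  induction P using Finset.strongInduction with
  | H P ih =>
  intro hP V W E x y τ hcfg
  by_contra hcon
  push Not at hcon
  set F := ∑ v ∈ V, x v with hFd
  set G := ∑ v ∈ W, y v with hGd
  set S := ∑ q ∈ E, x q.1 * y q.2 with hS
  set K : ℝ := D * Real.exp (8 * C) with hK
  have hK0 : 0 < K := by positivity
  have hx := hcfg.2.2.2.1
  have hy := hcfg.2.2.2.2.1
  have hle : S ≤ F * G := edge_le V W E x y hcfg.2.2.1 hx hy
  have hF0 : 0 ≤ F := Finset.sum_nonneg (fun v _ => hx v)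
  have hG0 : 0 ≤ G := Finset.sum_nonneg (fun v _ => hy v)
  have hT0 : 0 ≤ K * (F * G) ^ a * Real.exp (-τ) := by positivity
  set T := K * (F * G) ^ a * Real.exp (-τ) with hT
  have hS0 : 0 < S := by linarith
  have hFG : 0 < F * G := by linarith
  have hF : 0 < F := by
    rcases hF0.eq_or_lt with h | h
    · rw [← h, zero_mul] at hFG; exact absurd hFG (lt_irrefl _)
    · exact h
  have hG : 0 < G := by
    rcases hG0.eq_or_lt with h | h
    · rw [← h, mul_zero] at hFG; exact absurd hFG (lt_irrefl _)
    · exact h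
  have hex : ∀ p, ∃ k : ℕ, p ∈ P →
      ∑ q ∈ E, (if e q.1 p ≠ k ∧ e q.2 p ≠ k then 1 else 0) * (x q.1 * y q.2)
        ≤ C * (p:ℝ) ^ (-(2 * a)) * S ∧
      ∑ q ∈ E, (if e q.1 p ≠ k ∨ e q.2 p ≠ k then 1 else 0) * (x q.1 * y q.2) ≤ C / p * S := by
    intro p
    by_cases hp : p ∈ P
    · have hpp := hP p hp
      have hcl := ih (P.erase p) (Finset.erase_ssubset hp) (fun r hr => hP r (Finset.mem_of_mem_erase hr))
      obtain ⟨I, X, Y, hX, hY, sX, sY, hc⟩ := step_norm e lam a (P.erase p) K hK0.le hcl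
        (fun r hr => (hP r (Finset.mem_of_mem_erase hr)).1.two_le) p (Finset.notMem_erase _ _) hpp.1.two_le
        (hl p).2 V W E x y τ (by rw [Finset.insert_erase hp]; exact hcfg) hF hG
      have c1 := hc (fun _ _ => 1) (fun _ _ => zero_le_one)
      simp only [one_mul] at c1
      have hgt : 1 < ∑ i ∈ I, ∑ j ∈ I, MM ((p:ℝ) ^ (-(1 - a))) i j * (X i ^ a * Y j ^ a) := by
        by_contra h
        push Not at h
        have := mul_le_mul_of_nonneg_left h hT0
        change S ≤ T * _ at c1
        linarith
      obtain ⟨k, _, k1, k2⟩ := hA p ((le_max_left _ _).trans hpp.2) I X Y hX hY sX sY hgt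
      refine ⟨k, fun _ => ⟨?_, ?_⟩⟩
      · have c2 := hc (fun i j => if i ≠ k ∧ j ≠ k then 1 else 0) (fun i j => by split_ifs <;> norm_num)
        refine c2.trans ?_
        change T * _ ≤ _
        rw [mul_comm]
        exact mul_le_mul k1 hcon.le hT0 (by positivity)
      · have c2 := hc (fun i j => if i ≠ k ∨ j ≠ k then 1 else 0) (fun i j => by split_ifs <;> norm_num)
        refine c2.trans ?_
        change T * _ ≤ _
        rw [mul_comm]
        exact mul_le_mul k2 hcon.le hT0 (by positivity)
    · exact ⟨0, fun h => absurd h hp⟩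
  choose k hk using hex
  obtain ⟨r1, r2⟩ := core e lam (fun p => (hl p).1) hls a C hC P (fun p hp => (hP p hp).1)
    (hn0 P (fun p hp => (le_max_right _ _).trans (hP p hp).2)) V W E x y τ hcfg S hS hS0 hF hG k
    (fun p hp => (hk p hp).1) (fun p hp => (hk p hp).2)
  change S ^ 2 ≤ 64 * (Real.exp 2 * Real.exp 2) * (F * G) at r2
  set Z := F * G with hZ
  have hS2 : S ≤ D * Z ^ a := by
    by_cases hZ1 : 1 ≤ Z
    · have : Z ≤ (Z ^ a) ^ 2 := by
        rw [← Real.rpow_natCast, ← Real.rpow_mul hFG.le]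
        calc Z = Z ^ (1:ℝ) := (Real.rpow_one _).symm
          _ ≤ _ := Real.rpow_le_rpow_of_exponent_le hZ1 (by push_cast; linarith)
      apply (pow_le_pow_iff_left₀ hS0.le (by positivity) two_ne_zero).1
      rw [mul_pow, hD]
      refine r2.trans ?_
      have e2 : 0 ≤ 64 * (Real.exp 2 * Real.exp 2) := by positivity
      nlinarith [mul_le_mul_of_nonneg_left this e2]
    · push Not at hZ1
      have : Z ≤ Z ^ a := by
        calc Z = Z ^ (1:ℝ) := (Real.rpow_one _).symm
          _ ≤ _ := Real.rpow_le_rpow_of_exponent_ge hFG hZ1.le h2.le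
      have : Z ^ a ≤ D * Z ^ a := le_mul_of_one_le_left (by positivity) hD1
      linarith
  have h3 : 1 ≤ Real.exp (8 * C) * Real.exp (-τ) := by
    rw [← Real.exp_add]; exact Real.one_le_exp (by linarith)
  have : D * Z ^ a ≤ T := by
    calc D * Z ^ a ≤ (D * Z ^ a) * (Real.exp (8 * C) * Real.exp (-τ)) := le_mul_of_one_le_right (by positivity) h3
      _ = T := by rw [hT, hK]; ring
  linarith

lemma allp (a : ℝ) (h1 : 1/2 < a) (h2 : a < 1) : ∃ K : ℝ, 0 < K ∧ ∀ (e : ℕ → ℕ → ℕ) (lam : ℕ → ℝ),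
    (∀ p, 0 ≤ lam p ∧ lam p ≤ 1) → (∀ Q : Finset ℕ, ∑ p ∈ Q, lam p / p ≤ 2) →
    ∀ P : Finset ℕ, (∀ p ∈ P, p.Prime) → Claim e lam a P K := by
  obtain ⟨K, hK, p0, hL⟩ := large a h1 h2
  obtain ⟨C, hC, hS⟩ := small_step a h1 h2
  refine ⟨C ^ p0 * K, by positivity, ?_⟩
  intro e lam hl hls P hP
  have key : ∀ Q : Finset ℕ, (∀ p ∈ Q, p.Prime ∧ p < p0) →
      Claim e lam a (Q ∪ P.filter (fun p => p0 ≤ p)) (C ^ Q.card * K) := by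
    intro Q
    induction Q using Finset.induction_on with
    | empty =>
      intro _
      simp only [Finset.card_empty, pow_zero, one_mul, Finset.empty_union]
      exact hL e lam hl hls _ (fun p hp => ⟨hP p (Finset.mem_filter.1 hp).1, (Finset.mem_filter.1 hp).2⟩)
    | insert p Q hp ih =>
      intro hQ
      have ih := ih (fun r hr => hQ r (Finset.mem_insert_of_mem hr))
      have hpp := hQ p (Finset.mem_insert_self _ _)
      rw [Finset.insert_union, Finset.card_insert_of_notMem hp, pow_succ, mul_comm (C ^ Q.card) C, mul_assoc]
      apply hS e lam _ _ (by positivity) ih _ p _ hpp.1.two_le (hl p).2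
      · intro r hr
        rcases Finset.mem_union.1 hr with h | h
        · exact (hQ r (Finset.mem_insert_of_mem h)).1.two_le
        · exact (hP r (Finset.mem_filter.1 h).1).two_le
      · intro h
        rcases Finset.mem_union.1 h with h | h
        · exact hp h
        · have := (Finset.mem_filter.1 h).2
          omega
  have hk := key (P.filter (fun p => ¬ p0 ≤ p)) (fun p hp => ⟨hP p (Finset.mem_filter.1 hp).1, by
    have := (Finset.mem_filter.1 hp).2; omega⟩)
  rw [Finset.union_comm, Finset.filter_union_filter_not_eq] at hk
  intro V W E x y τ hcfg
  refine (hk V W E x y τ hcfg).trans ?_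
  have hcard : (P.filter (fun p => ¬ p0 ≤ p)).card ≤ p0 := by
    calc _ ≤ (Finset.range p0).card := Finset.card_le_card (fun p hp => by
            have := (Finset.mem_filter.1 hp).2
            rw [Finset.mem_range]; omega)
      _ = p0 := Finset.card_range _
  have hx := hcfg.2.2.2.1
  have hy := hcfg.2.2.2.2.1
  have hF0 : 0 ≤ ∑ v ∈ V, x v := Finset.sum_nonneg (fun v _ => hx v)
  have hG0 : 0 ≤ ∑ v ∈ W, y v := Finset.sum_nonneg (fun v _ => hy v)
  have := pow_le_pow_right₀ hC hcard
  gcongr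

def fc (n p : ℕ) : ℕ := n.factorization p

def PN (N : ℕ) : Finset ℕ := (Finset.range (N + 1)).filter Nat.Prime

noncomputable def lamf (t : ℝ) (p : ℕ) : ℝ := if t ≤ (p:ℝ) then t / p else 0

lemma pf_sub (N n : ℕ) (hn : n ∈ Finset.Icc 1 N) : n.primeFactors ⊆ PN N := by
  intro p hp
  have hn := Finset.mem_Icc.1 hn
  have h := Nat.le_of_mem_primeFactors hp
  exact Finset.mem_filter.2 ⟨Finset.mem_range.2 (by omega), Nat.prime_of_mem_primeFactors hp⟩

lemma rhof_eq (N n : ℕ) (hn : n ∈ Finset.Icc 1 N) : rhof fc (PN N) n = (Nat.totient n : ℝ) / n := by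
  have hn' := Finset.mem_Icc.1 hn
  have h := Nat.totient_eq_mul_prod_factors n
  have h' : (Nat.totient n : ℝ) = n * ∏ p ∈ n.primeFactors, (1 - (p:ℝ)⁻¹) := by
    have := congrArg (fun z : ℚ => (z : ℝ)) h
    push_cast at this
    exact this
  have hn0 : (n:ℝ) ≠ 0 := by have : n ≠ 0 := by omega
                             exact_mod_cast this
  rw [h', mul_div_cancel_left₀ _ hn0]
  unfold rhof
  rw [← Finset.prod_subset (pf_sub N n hn)]
  · apply Finset.prod_congr rfl
    intro p hp
    have : fc n p ≠ 0 := by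
      have := (Nat.support_factorization n) ▸ hp
      exact Finsupp.mem_support_iff.1 this
    rw [if_neg this, one_div]
  · intro p _ hp
    rw [if_pos]
    rw [← Nat.support_factorization] at hp
    exact Finsupp.notMem_support_iff.1 hp

lemma prod_fc (N n : ℕ) (hn : n ∈ Finset.Icc 1 N) : ∏ p ∈ PN N, p ^ (fc n p) = n := by
  have hn' := Finset.mem_Icc.1 hn
  have h := Nat.prod_factorization_pow_eq_self (n := n) (by omega)
  rw [Finsupp.prod_of_support_subset (s := PN N)] at h
  · exact h
  · rw [Nat.support_factorization]; exact pf_sub N n hn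
  · simp

lemma rrf_mul (N n m : ℕ) (hn : n ∈ Finset.Icc 1 N) (hm : m ∈ Finset.Icc 1 N) :
    rrf fc (PN N) m n * (Nat.gcd n m : ℝ) = m := by
  have hn' := Finset.mem_Icc.1 hn
  have hm' := Finset.mem_Icc.1 hm
  have hg : Nat.gcd n m ∈ Finset.Icc 1 N := Finset.mem_Icc.2
    ⟨Nat.gcd_pos_of_pos_left _ (by omega), (Nat.gcd_le_left _ (by omega)).trans hn'.2⟩
  rw [← prod_fc N _ hg]
  conv_rhs => rw [← prod_fc N m hm]
  unfold rrf
  push_cast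
  rw [← Finset.prod_mul_distrib]
  apply Finset.prod_congr rfl
  intro p _
  rw [← pow_add]
  congr 1
  unfold fc
  rw [Nat.factorization_gcd (by omega) (by omega), Finsupp.inf_apply]
  change _ - _ + min _ _ = _
  omega

lemma LLf_ge (N n m : ℕ) (hn : n ∈ Finset.Icc 1 N) (hm : m ∈ Finset.Icc 1 N) (t : ℝ) (ht : 0 ≤ t) :
    t * Lfun t n m ≤ LLf fc (lamf t) (PN N) n m := by
  have hn' := Finset.mem_Icc.1 hn
  have hm' := Finset.mem_Icc.1 hm
  have hn0 : n ≠ 0 := by omega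
  have hm0 : m ≠ 0 := by omega
  have hl0 : ∀ p, 0 ≤ lamf t p := fun p => by unfold lamf; split_ifs <;> positivity
  have key : ∀ p ∈ (n * m / Nat.gcd n m ^ 2).primeFactors, p ∈ PN N ∧ fc n p ≠ fc m p := by
    intro p hp
    have hd : Nat.gcd n m ^ 2 ∣ n * m := by
      rw [sq]; exact mul_dvd_mul (Nat.gcd_dvd_left _ _) (Nat.gcd_dvd_right _ _)
    have hpp := Nat.prime_of_mem_primeFactors hp
    rw [← Nat.support_factorization, Finsupp.mem_support_iff, Nat.factorization_div hd,
      Nat.factorization_mul hn0 hm0, Nat.factorization_pow, Nat.factorization_gcd hn0 hm0] at hp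
    simp only [Finsupp.coe_tsub, Finsupp.coe_add, Pi.sub_apply, Pi.add_apply, Finsupp.smul_apply,
      Finsupp.inf_apply, smul_eq_mul] at hp
    change _ + _ - 2 * min _ _ ≠ 0 at hp
    have h : n.factorization p ≠ m.factorization p := by omega
    refine ⟨?_, h⟩
    by_cases h0 : n.factorization p = 0
    · have : m.factorization p ≠ 0 := by omega
      apply pf_sub N m hm
      rw [← Nat.support_factorization]; exact Finsupp.mem_support_iff.2 this
    · apply pf_sub N n hn
      rw [← Nat.support_factorization]; exact Finsupp.mem_support_iff.2 h0
  unfold Lfun LLf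
  rw [Finset.mul_sum]
  calc _ ≤ ∑ p ∈ (n * m / Nat.gcd n m ^ 2).primeFactors, (if fc n p = fc m p then 0 else lamf t p) := by
        apply Finset.sum_le_sum
        intro p hp
        rw [if_neg (key p hp).2]
        unfold lamf
        by_cases h : t ≤ (p:ℝ)
        · rw [Set.indicator_of_mem (by exact h), if_pos h]
          apply le_of_eq; ring
        · rw [Set.indicator_of_notMem (by exact h), if_neg h, mul_zero]
    _ ≤ _ := Finset.sum_le_sum_of_subset_of_nonneg (fun p hp => (key p hp).1)
        (fun p _ _ => by split_ifs; exacts [le_rfl, hl0 p])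

lemma lam_sum (t : ℝ) (ht : 0 ≤ t) (Q : Finset ℕ) : ∑ p ∈ Q, lamf t p / p ≤ 2 := by
  rcases ht.eq_or_lt with h | h
  · subst h
    have : ∀ p ∈ Q, lamf 0 p / (p:ℝ) = 0 := fun p _ => by unfold lamf; simp
    rw [Finset.sum_eq_zero this]; norm_num
  have hk : 0 < ⌈t⌉₊ := Nat.ceil_pos.2 h
  obtain ⟨k, hk'⟩ : ∃ k, ⌈t⌉₊ = k + 1 := ⟨⌈t⌉₊ - 1, by omega⟩
  have htk : t ≤ (k:ℝ) + 1 := by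
    have := Nat.le_ceil t
    rw [hk'] at this; exact_mod_cast this
  set n := Q.sup id + 1
  have hs := sum_Ioo_inv_sq_le (α := ℝ) k n
  calc ∑ p ∈ Q, lamf t p / p ≤ ∑ p ∈ Q, (if t ≤ (p:ℝ) then t * ((p:ℝ) ^ 2)⁻¹ else 0) := by
        apply Finset.sum_le_sum
        intro p _
        unfold lamf
        split_ifs
        · apply le_of_eq; rw [div_div, ← sq, div_eq_mul_inv]
        · simp
    _ = ∑ p ∈ Q.filter (fun p : ℕ => t ≤ (p:ℝ)), t * ((p:ℝ) ^ 2)⁻¹ := by rw [Finset.sum_filter]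
    _ ≤ ∑ p ∈ Finset.Ioo k n, t * ((p:ℝ) ^ 2)⁻¹ := by
        apply Finset.sum_le_sum_of_subset_of_nonneg
        · intro p hp
          have hp := Finset.mem_filter.1 hp
          have h1 := Finset.le_sup (f := id) hp.1
          have h2 := Nat.ceil_le.2 hp.2
          simp only [id] at h1
          exact Finset.mem_Ioo.2 ⟨by omega, by omega⟩
        · intros; positivity
    _ ≤ t * (2 / (k + 1)) := by
        rw [← Finset.mul_sum]; gcongr
    _ ≤ 2 := by
        rw [mul_div_assoc', div_le_iff₀ (by positivity)]; linarith

/-- For `s, t ≥ 0`, `A > 0` and `η ∈ (0,1/2)`, with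
`ℰ_{s,t,A} = {(n,m) : 1 ≤ n,m ≤ N, D(n,m) ≤ sΨ(N), L_t(n,m) ≥ 1/A}`,
`∑_{(n,m) ∈ ℰ_{s,t,A}} (ψ(n)φ(n)/n)(ψ(m)φ(m)/m) ≪_η Ψ(N)² s^{1/2+η} e^{-(1-η)t/A}`. -/
theorem gcd_anatomy_condition_bound (η : ℝ) (hη : η ∈ Set.Ioo (0:ℝ) (1/2)) :
    ∃ K : ℝ, 0 < K ∧ ∀ (N : ℕ) (ψ : ℕ → ℝ),
      (∀ n, ψ n ∈ Set.Icc (0:ℝ) (1/2)) →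
      ∀ (s t A : ℝ), 0 ≤ s → 0 ≤ t → 0 < A →
      ∑ nm ∈ Finset.Icc 1 N ×ˢ Finset.Icc 1 N,
        Set.indicator
          {q : ℕ × ℕ | Dfun ψ q.1 q.2 ≤ s * Psi ψ N ∧ 1 / A ≤ Lfun t q.1 q.2}
          (fun q => (ψ q.1 * (Nat.totient q.1 : ℝ) / q.1) *
            (ψ q.2 * (Nat.totient q.2 : ℝ) / q.2)) nm ≤
        K * Psi ψ N ^ 2 * s ^ ((1:ℝ)/2 + η) * Real.exp (-((1 - η) * t / A)) := by
  classical
  obtain ⟨hη0, hη1⟩ := hη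
  set a : ℝ := 3/4 - η/2 with ha
  obtain ⟨K, hK, hall⟩ := allp a (by linarith) (by linarith)
  refine ⟨K, hK, ?_⟩
  intro N ψ hψ s t A hs ht hA
  set f : ℕ → ℝ := fun n => ψ n * (Nat.totient n : ℝ) / n with hf
  have hf0 : ∀ n, 0 ≤ f n := fun n => by have := (hψ n).1; simp only [hf]; positivity
  have hPs : Psi ψ N = 2 * ∑ n ∈ Finset.Icc 1 N, f n := by
    unfold Psi; rw [Finset.mul_sum]; apply Finset.sum_congr rfl; intro n _; simp only [hf]; ring
  set Ps := Psi ψ N with hPsd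
  have hPs0 : 0 ≤ Ps := by
    rw [hPs]; have := Finset.sum_nonneg (s := Finset.Icc 1 N) (fun n _ => hf0 n); linarith
  set B : Set (ℕ × ℕ) := {q : ℕ × ℕ | Dfun ψ q.1 q.2 ≤ s * Ps ∧ 1 / A ≤ Lfun t q.1 q.2} with hB
  have hrhs : 0 ≤ K * Ps ^ 2 * s ^ ((1:ℝ)/2 + η) * Real.exp (-((1 - η) * t / A)) := by positivity
  set E := (Finset.Icc 1 N ×ˢ Finset.Icc 1 N).filter (fun q => q ∈ B) with hE
  have hsum : ∑ nm ∈ Finset.Icc 1 N ×ˢ Finset.Icc 1 N,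
        Set.indicator B (fun q => (ψ q.1 * (Nat.totient q.1 : ℝ) / q.1) *
            (ψ q.2 * (Nat.totient q.2 : ℝ) / q.2)) nm = ∑ q ∈ E, f q.1 * f q.2 := by
    rw [hE, Finset.sum_filter]
    apply Finset.sum_congr rfl
    intro q _
    rw [Set.indicator_apply]
  rw [hsum]
  have hD : ∀ q ∈ E, q.1 ∈ Finset.Icc 1 N ∧ q.2 ∈ Finset.Icc 1 N ∧
      ψ q.1 * rrf fc (PN N) q.2 q.1 ≤ s * Ps ∧ ψ q.2 * rrf fc (PN N) q.1 q.2 ≤ s * Ps ∧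
      1 / A ≤ Lfun t q.1 q.2 := by
    intro q hq
    obtain ⟨hq1, hq2⟩ := Finset.mem_filter.1 hq
    obtain ⟨h1, h2⟩ := Finset.mem_product.1 hq1
    have g : (0:ℝ) < Nat.gcd q.1 q.2 := by
      have := Nat.gcd_pos_of_pos_left q.2 (Finset.mem_Icc.1 h1).1
      exact_mod_cast this
    have hd := hq2.1
    unfold Dfun at hd
    rw [div_le_iff₀ g] at hd
    have r1 := rrf_mul N q.1 q.2 h1 h2
    have r2 := rrf_mul N q.2 q.1 h2 h1
    rw [Nat.gcd_comm] at r2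
    refine ⟨h1, h2, ?_, ?_, hq2.2⟩
    · refine le_of_mul_le_mul_right ?_ g
      rw [mul_assoc, r1, mul_comm]
      exact (le_max_left _ _).trans hd
    · refine le_of_mul_le_mul_right ?_ g
      rw [mul_assoc, r2, mul_comm]
      exact (le_max_right _ _).trans hd
  have hM0 : 0 ≤ s * Ps := by positivity
  rcases hM0.eq_or_lt with hM | hM
  · refine le_trans (le_of_eq ?_) hrhs
    apply Finset.sum_eq_zero
    intro q hq
    obtain ⟨h1, h2, h3, -, -⟩ := hD q hq
    rw [← hM] at h3
    have r1 := rrf_mul N q.1 q.2 h1 h2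
    have hq2 : (0:ℝ) < q.2 := by exact_mod_cast (Finset.mem_Icc.1 h2).1
    have hr : 0 < rrf fc (PN N) q.2 q.1 := by
      rw [← r1] at hq2
      exact pos_of_mul_pos_left hq2 (Nat.cast_nonneg _)
    have : ψ q.1 = 0 := by
      have := (hψ q.1).1
      nlinarith
    simp [hf, this]
  set M := s * Ps with hMd
  have hs0 : 0 < s := by
    rcases hs.eq_or_lt with h | h
    · rw [hMd, ← h, zero_mul] at hM; exact absurd hM (lt_irrefl _)
    · exact h
  have hP0 : 0 < Ps := by
    rcases hPs0.eq_or_lt with h | h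
    · rw [hMd, ← h, mul_zero] at hM; exact absurd hM (lt_irrefl _)
    · exact h
  have inj : ∀ v ∈ Finset.Icc 1 N, ∀ v' ∈ Finset.Icc 1 N, (∀ p ∈ PN N, fc v p = fc v' p) → v = v' := by
    intro v hv v' hv' h
    rw [← prod_fc N v hv, ← prod_fc N v' hv']
    exact Finset.prod_congr rfl (fun p hp => by rw [h p hp])
  have bnd : ∀ n m, n ∈ Finset.Icc 1 N → ψ n * rrf fc (PN N) m n ≤ M →
      f n / M * rrf fc (PN N) m n ≤ rhof fc (PN N) n := by
    intro n m hn h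
    rw [rhof_eq N n hn]
    have : f n / M * rrf fc (PN N) m n = (Nat.totient n : ℝ) / n * (ψ n * rrf fc (PN N) m n / M) := by
      simp only [hf]; ring
    rw [this]
    apply mul_le_of_le_one_right (by positivity)
    rw [div_le_one hM]; exact h
  have hfin := hall fc (lamf t) (fun p => ⟨by unfold lamf; split_ifs <;> positivity, by
      unfold lamf
      split_ifs with h
      · exact div_le_one_of_le₀ h (Nat.cast_nonneg _)
      · norm_num⟩) (lam_sum t ht) (PN N) (fun p hp => (Finset.mem_filter.1 hp).2)
    (Finset.Icc 1 N) (Finset.Icc 1 N) E (fun n => f n / M) (fun n => f n / M) (t / A)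
    ⟨inj, inj, Finset.filter_subset _ _, fun v => div_nonneg (hf0 v) hM.le,
      fun v => div_nonneg (hf0 v) hM.le, fun q hq => by
        obtain ⟨h1, h2, h3, h4, h5⟩ := hD q hq
        refine ⟨bnd _ _ h1 h3, bnd _ _ h2 h4, ?_⟩
        refine le_trans ?_ (LLf_ge N q.1 q.2 h1 h2 t ht)
        rw [div_eq_mul_one_div]
        exact mul_le_mul_of_nonneg_left h5 ht⟩
  have e1 : ∑ q ∈ E, f q.1 / M * (f q.2 / M) = (∑ q ∈ E, f q.1 * f q.2) / M ^ 2 := by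
    rw [Finset.sum_div]; apply Finset.sum_congr rfl; intro q _; rw [div_mul_div_comm, sq]
  have e2 : ∑ n ∈ Finset.Icc 1 N, f n / M = 1 / (2 * s) := by
    rw [← Finset.sum_div]
    have : ∑ n ∈ Finset.Icc 1 N, f n = Ps / 2 := by rw [hPs]; ring
    rw [this, hMd]; field_simp
  simp only [e1, e2] at hfin
  rw [div_le_iff₀ (by positivity)] at hfin
  refine hfin.trans ?_
  have e3 : (1 / (2 * s) * (1 / (2 * s))) ^ a ≤ s ^ (-(2 * a)) := by
    have : (1 / (2 * s) * (1 / (2 * s))) ≤ (s ^ 2)⁻¹ := by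
      rw [div_mul_div_comm, one_mul, ← one_div]
      apply one_div_le_one_div_of_le (by positivity)
      nlinarith
    refine (Real.rpow_le_rpow (by positivity) this (by linarith)).trans (le_of_eq ?_)
    rw [← Real.rpow_natCast, ← Real.rpow_neg hs, ← Real.rpow_mul hs]
    congr 1; push_cast; ring
  have e4 : s ^ (-(2 * a)) * s ^ 2 = s ^ ((1:ℝ)/2 + η) := by
    rw [← Real.rpow_natCast s 2, ← Real.rpow_add hs0]
    congr 1; rw [ha]; push_cast; ring
  have e5 : Real.exp (-(t / A)) ≤ Real.exp (-((1 - η) * t / A)) := by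
    apply Real.exp_le_exp.2
    have : 0 ≤ t / A := by positivity
    rw [mul_div_assoc]
    nlinarith
  calc K * (1 / (2 * s) * (1 / (2 * s))) ^ a * Real.exp (-(t / A)) * M ^ 2
      ≤ K * s ^ (-(2 * a)) * Real.exp (-((1 - η) * t / A)) * M ^ 2 := by gcongr
    _ = K * Ps ^ 2 * (s ^ (-(2 * a)) * s ^ 2) * Real.exp (-((1 - η) * t / A)) := by rw [hMd]; ring
    _ = _ := by rw [e4]
end

section
/- Let ε ∈ (0,1/2). There exists a constant K = K(ε) such that for any real x ≥ 1, any t ≥ 1 and any c ∈ ℝ with ε·c·log t ≥ K, one has the set inclusion {n ≤ x : ∑_{p prime, p ≥ t, p | n} 1/p ≥ c} ⊆ {n ≤ x : ∑_{p prime, p ≥ t^{e^{(1−2ε)c}}, p | n} 1/p ≥ εc}. -/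
open ArithmeticFunction in
/-- Partial sums of `Λ(d)/d`. -/
noncomputable def LamSum (n : ℕ) : ℝ := ∑ d ∈ Finset.Ioc 0 n, vonMangoldt d / (d : ℝ)

open ArithmeticFunction in
lemma log_fact_eq (n : ℕ) :
    ∑ d ∈ Finset.Ioc 0 n, vonMangoldt d * ((n / d : ℕ) : ℝ) = Real.log (n.factorial) := by
  rw [← sum_Ioc_mul_zeta_eq_sum, vonMangoldt_mul_zeta]
  induction n with
  | zero => simp
  | succ k ih =>
    rw [← Finset.insert_Ioc_right_eq_Ioc_add_one (by omega : 0 ≤ k), Finset.sum_insert (by simp), ih,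
      Nat.factorial_succ]
    push_cast
    rw [Real.log_mul (by positivity) (by positivity)]
    simp [log_apply]

open ArithmeticFunction in
lemma LamSum_lower (n : ℕ) (hn : 0 < n) : Real.log n - 6 ≤ LamSum n := by
  have hn' : (0:ℝ) < n := by exact_mod_cast hn
  have h1 : Real.log (n.factorial) ≤ n * LamSum n := by
    rw [← log_fact_eq, LamSum, Finset.mul_sum]
    apply Finset.sum_le_sum
    intro d hd
    have : ((n / d : ℕ) : ℝ) ≤ (n:ℝ) / d := Nat.cast_div_le
    calc vonMangoldt d * ((n / d : ℕ) : ℝ) ≤ vonMangoldt d * ((n:ℝ) / d) :=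
          mul_le_mul_of_nonneg_left this vonMangoldt_nonneg
      _ = _ := by ring
  have h2 : (n:ℝ) * Real.log n - n ≤ Real.log (n.factorial) := by
    have := Real.pow_div_factorial_le_exp (n:ℝ) hn'.le n
    have h3 := Real.log_le_log (by positivity) this
    rw [Real.log_exp, Real.log_div (by positivity) (by positivity), Real.log_pow] at h3
    linarith
  have : (n:ℝ) * (Real.log n - 6) ≤ n * LamSum n := by nlinarith
  exact le_of_mul_le_mul_left this hn'

open ArithmeticFunction in
lemma LamSum_upper (n : ℕ) (hn : 0 < n) : LamSum n ≤ Real.log n + 6 := by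
  have hn' : (0:ℝ) < n := by exact_mod_cast hn
  have h1 : n * LamSum n - Chebyshev.psi n ≤ Real.log (n.factorial) := by
    rw [← log_fact_eq, LamSum, Finset.mul_sum, Chebyshev.psi, Nat.floor_natCast,
      ← Finset.sum_sub_distrib]
    apply Finset.sum_le_sum
    intro d hd
    have hd0 : 0 < d := (Finset.mem_Ioc.1 hd).1
    have : (n:ℝ) / d - 1 ≤ ((n / d : ℕ) : ℝ) := by
      have := Nat.lt_floor_add_one ((n:ℝ) / d)
      rw [Nat.floor_div_natCast, Nat.floor_natCast] at this
      linarith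
    calc _ = vonMangoldt d * ((n:ℝ) / d - 1) := by ring
      _ ≤ _ := mul_le_mul_of_nonneg_left this vonMangoldt_nonneg
  have h2 : Real.log (n.factorial) ≤ (n:ℝ) * Real.log n := by
    rw [← Real.log_pow]
    apply Real.log_le_log (by positivity)
    exact_mod_cast Nat.factorial_le_pow n
  have h3 := Chebyshev.psi_le_const_mul_self hn'.le
  have h4 : Real.log 4 ≤ 2 := by
    have : (4:ℝ) = 2 ^ 2 := by norm_num
    rw [this, Real.log_pow]
    have := Real.log_two_lt_d9
    push_cast
    linarith
  have : (n:ℝ) * LamSum n ≤ n * (Real.log n + 6) := by nlinarith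
  exact le_of_mul_le_mul_left this hn'

open ArithmeticFunction in
lemma LamSum_succ (n : ℕ) :
    LamSum (n+1) = LamSum n + vonMangoldt (n+1) / ((n+1 : ℕ) : ℝ) := by
  rw [LamSum, ← Finset.insert_Ioc_right_eq_Ioc_add_one (by omega : 0 ≤ n),
    Finset.sum_insert (by simp), LamSum]
  ring

/-- Auxiliary potential. -/
noncomputable def Pot (n : ℕ) : ℝ :=
  Real.log (Real.log n) + (LamSum n - Real.log n - 6) / Real.log n

open ArithmeticFunction in
lemma Pot_step (n : ℕ) (hn : 2 ≤ n) :
    vonMangoldt (n+1) / ((n+1 : ℕ) : ℝ) / Real.log ((n+1 : ℕ) : ℝ) ≤ Pot (n+1) - Pot n := by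
  have e : vonMangoldt (n+1) / ((n+1 : ℕ) : ℝ) = LamSum (n+1) - LamSum n := by
    rw [LamSum_succ]; ring
  rw [e]
  have hn2 : (2:ℝ) ≤ n := by exact_mod_cast hn
  have ha : 0 < Real.log n := Real.log_pos (by linarith)
  have hab : Real.log n ≤ Real.log ((n+1 : ℕ) : ℝ) :=
    Real.log_le_log (by linarith) (by push_cast; linarith)
  have hR := LamSum_upper n (by omega)
  unfold Pot
  generalize Real.log ((n+1 : ℕ) : ℝ) = b at *
  generalize Real.log (n : ℝ) = a at *
  generalize LamSum (n+1) = M at *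
  generalize LamSum n = L at *
  have hb : 0 < b := by linarith
  have h1 : 1 - a / b ≤ Real.log b - Real.log a := by
    have := Real.one_sub_inv_le_log_of_pos (div_pos hb ha)
    rwa [inv_div, Real.log_div hb.ne' ha.ne'] at this
  have h2 : (L - a - 6) / a ≤ (L - a - 6) / b := by
    have : (6 + a - L) / b ≤ (6 + a - L) / a :=
      div_le_div_of_nonneg_left (by linarith) ha hab
    have e1 : (L - a - 6) / a = - ((6 + a - L) / a) := by ring
    have e2 : (L - a - 6) / b = - ((6 + a - L) / b) := by ring
    linarith
  have e3 : (M - L) / b = (1 - a / b) + (M - b - 6) / b - (L - a - 6) / b := by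
    field_simp
    ring
  rw [e3]
  linarith

open ArithmeticFunction in
lemma mertens_nat (a b : ℕ) (ha : 2 ≤ a) (hab : a ≤ b) :
    ∑ p ∈ (Finset.Ioc a b).filter Nat.Prime, 1 / (p:ℝ) ≤
      Real.log (Real.log b) - Real.log (Real.log a) + 12 / Real.log a := by
  have key : ∑ p ∈ (Finset.Ioc a b).filter Nat.Prime, 1 / (p:ℝ) ≤ Pot b - Pot a := by
    induction b, hab using Nat.le_induction with
    | base => simp
    | succ n hn ih =>
      rw [← Finset.insert_Ioc_right_eq_Ioc_add_one hn, Finset.filter_insert]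
      have hs := Pot_step n (by omega)
      split_ifs with hp
      · rw [Finset.sum_insert (by simp)]
        rw [vonMangoldt_apply_prime hp] at hs
        have : 0 < Real.log ((n+1 : ℕ) : ℝ) := Real.log_pos (by exact_mod_cast hp.one_lt)
        rw [div_div, mul_comm, ← div_div, div_self this.ne'] at hs
        linarith
      · have : 0 ≤ vonMangoldt (n+1) / ((n+1 : ℕ) : ℝ) / Real.log ((n+1 : ℕ) : ℝ) :=
          div_nonneg (div_nonneg vonMangoldt_nonneg (by positivity)) (Real.log_natCast_nonneg _)
        linarith
  have hla : 0 < Real.log a := Real.log_pos (by exact_mod_cast ha)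
  have hlb : 0 < Real.log b := Real.log_pos (by exact_mod_cast (by omega : 1 < b))
  have h1 := LamSum_upper b (by omega)
  have h2 := LamSum_lower a (by omega)
  have h3 : (LamSum b - Real.log b - 6) / Real.log b ≤ 0 :=
    div_nonpos_of_nonpos_of_nonneg (by linarith) hlb.le
  have h4 : -12 / Real.log a ≤ (LamSum a - Real.log a - 6) / Real.log a :=
    div_le_div_of_nonneg_right (by linarith) hla.le
  have h5 : -12 / Real.log a = - (12 / Real.log a) := by ring
  unfold Pot at key
  linarith

lemma prime_range_bound (t B : ℝ) (ht : 1 < t) (hB : 0 ≤ B) (s : Finset ℕ)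
    (hs : ∀ p ∈ s, p.Prime ∧ t ≤ (p:ℝ) ∧ (p:ℝ) ≤ t ^ Real.exp B) :
    ∑ p ∈ s, 1 / (p:ℝ) ≤ B + 28 / Real.log t := by
  have hlt : 0 < Real.log t := Real.log_pos ht
  set m : ℕ := max 2 ⌊t⌋₊ with hm
  set M : ℕ := ⌊t ^ Real.exp B⌋₊ with hM
  have hm2 : 2 ≤ m := le_max_left _ _
  have hm2' : (2:ℝ) ≤ m := by exact_mod_cast hm2
  have hm0 : (0:ℝ) < m := by linarith
  have htm : t ≤ 2 * m := by
    have h1 := Nat.lt_floor_add_one t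
    have h2 : (⌊t⌋₊ : ℝ) ≤ m := by exact_mod_cast le_max_right _ _
    linarith
  have hlm : 0 < Real.log m := Real.log_pos (by linarith)
  have h2m : Real.log 2 ≤ Real.log m := Real.log_le_log (by norm_num) hm2'
  have hlog : Real.log t ≤ Real.log 2 + Real.log m := by
    rw [← Real.log_mul (by norm_num) hm0.ne']
    exact Real.log_le_log (by linarith) htm
  have hinv : 1 / Real.log m ≤ 2 / Real.log t := by
    rw [div_le_div_iff₀ hlm hlt]; linarith
  have hm1 : 1 / (m:ℝ) ≤ 1 / Real.log m :=
    one_div_le_one_div_of_le hlm ((Real.log_le_sub_one_of_pos hm0).trans (by linarith))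
  have hsub : s ⊆ insert m ((Finset.Ioc m M).filter Nat.Prime) := by
    intro p hp
    obtain ⟨hpp, h1, h2⟩ := hs p hp
    have h3 : m ≤ p := max_le hpp.two_le (Nat.floor_le_of_le h1)
    have h4 : p ≤ M := Nat.le_floor h2
    rw [Finset.mem_insert, Finset.mem_filter, Finset.mem_Ioc]
    rcases h3.eq_or_lt with h | h
    · exact Or.inl h.symm
    · exact Or.inr ⟨⟨h, h4⟩, hpp⟩
  have hsum : ∑ p ∈ s, 1 / (p:ℝ) ≤
      1 / (m:ℝ) + ∑ p ∈ (Finset.Ioc m M).filter Nat.Prime, 1 / (p:ℝ) := by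
    rw [← Finset.sum_insert (f := fun p : ℕ => 1 / (p:ℝ)) (a := m) (by simp)]
    exact Finset.sum_le_sum_of_subset_of_nonneg hsub (fun _ _ _ => by positivity)
  have e28 : 28 / Real.log t = 14 * (2 / Real.log t) := by ring
  have hpos : 0 < 2 / Real.log t := by positivity
  rcases le_total M m with hMm | hMm
  · rw [Finset.Ioc_eq_empty (by omega)] at hsum
    simp only [Finset.filter_empty, Finset.sum_empty] at hsum
    linarith
  · have h := mertens_nat m M hm2 hMm
    have hM2 : (2:ℝ) ≤ M := by exact_mod_cast hm2.trans hMm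
    have hlM : Real.log M ≤ Real.exp B * Real.log t := by
      rw [← Real.log_rpow (by linarith)]
      exact Real.log_le_log (by linarith) (Nat.floor_le (by positivity))
    have hllM : Real.log (Real.log M) ≤ B + Real.log (Real.log t) := by
      have := Real.log_le_log (Real.log_pos (by linarith)) hlM
      rwa [Real.log_mul (Real.exp_pos _).ne' hlt.ne', Real.log_exp] at this
    have hllm : Real.log (Real.log t) - Real.log (Real.log m) ≤ 1 / Real.log m := by
      rw [← Real.log_div hlt.ne' hlm.ne']
      refine (Real.log_le_sub_one_of_pos (by positivity)).trans ?_
      rw [div_sub_one hlm.ne']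
      apply div_le_div_of_nonneg_right _ hlm.le
      have := Real.log_two_lt_d9
      linarith
    have e12 : 12 / Real.log m = 12 * (1 / Real.log m) := by ring
    linarith

/-- **Anatomy improvement trick**: for `ε ∈ (0,1/2)` and `ε c log t`
sufficiently large,
`{n ≤ x : ∑_{p ≥ t, p | n} 1/p ≥ c} ⊆ {n ≤ x : ∑_{p ≥ t^{e^{(1-2ε)c}}, p | n} 1/p ≥ εc}`. -/
theorem anatomy_improvement_trick (ε : ℝ) (hε : ε ∈ Set.Ioo (0:ℝ) (1/2)) :
    ∃ K : ℝ, ∀ (x t c : ℝ), 1 ≤ x → 1 ≤ t → K ≤ ε * c * Real.log t →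
      {n : ℕ | 0 < n ∧ (n : ℝ) ≤ x ∧ c ≤ primeSum t n} ⊆
        {n : ℕ | 0 < n ∧ (n : ℝ) ≤ x ∧
          ε * c ≤ primeSum (t ^ Real.exp ((1 - 2 * ε) * c)) n} := by
  obtain ⟨h0, h1⟩ := hε
  refine ⟨28, ?_⟩
  rintro x t c - ht hK n ⟨hn, hnx, hc⟩
  refine ⟨hn, hnx, ?_⟩
  have hlt0 : 0 ≤ Real.log t := Real.log_nonneg ht
  have hlt : 0 < Real.log t := by
    rcases hlt0.eq_or_lt with h | h
    · rw [← h] at hK; norm_num at hK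
    · exact h
  have ht1 : 1 < t := by
    rcases ht.eq_or_lt with h | h
    · rw [← h] at hlt; simp at hlt
    · exact h
  have hcpos : 0 < c := by
    by_contra hneg
    have : ε * c ≤ 0 := mul_nonpos_of_nonneg_of_nonpos h0.le (not_lt.1 hneg)
    nlinarith
  have hB : 0 ≤ (1 - 2 * ε) * c := mul_nonneg (by linarith) hcpos.le
  have hdiv : 28 / Real.log t ≤ ε * c := (div_le_iff₀ hlt).2 hK
  set B := (1 - 2 * ε) * c with hBdef
  have hb := prime_range_bound t B ht1 hB
    (n.primeFactors.filter (fun p => t ≤ (p:ℝ) ∧ (p:ℝ) ≤ t ^ Real.exp B)) (by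
      intro p hp
      rw [Finset.mem_filter] at hp
      exact ⟨Nat.prime_of_mem_primeFactors hp.1, hp.2⟩)
  have hsplit : primeSum t n ≤ primeSum (t ^ Real.exp B) n +
      ∑ p ∈ n.primeFactors.filter (fun p : ℕ => t ≤ (p:ℝ) ∧ (p:ℝ) ≤ t ^ Real.exp B), 1 / (p:ℝ) := by
    rw [Finset.sum_filter, primeSum, primeSum, ← Finset.sum_add_distrib]
    apply Finset.sum_le_sum
    intro p hp
    have hp0 : 0 ≤ 1 / (p:ℝ) := by positivity
    simp only [Set.indicator_apply, Set.mem_setOf_eq]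
    by_cases c1 : t ≤ (p:ℝ)
    · rcases le_total (p:ℝ) (t ^ Real.exp B) with c2 | c2
      · rw [if_pos c1, if_pos (show t ≤ (p:ℝ) ∧ (p:ℝ) ≤ t ^ Real.exp B from ⟨c1, c2⟩)]
        split_ifs <;> linarith
      · rw [if_pos c1, if_pos c2]
        split_ifs <;> linarith
    · rw [if_neg c1]
      split_ifs <;> linarith
  have : B = c - 2 * (ε * c) := by rw [hBdef]; ring
  linarith
end

section
/- Let ε ∈ (0,1). There exists a constant K = K(ε) such that for any t ≥ e^e and c > 0 with ε·c·(log t)/(log log t) ≥ K, and any real x ≥ 1, the number of positive integers n ≤ x with ∑_{p prime, p ≥ t, p | n} 1/p ≥ c is ≪ x·exp(−100·t^{e^{(1−ε)c}}), with an implied constant independent of t, c, x. -/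
noncomputable def mertA (N : ℕ) : ℝ := ∑ p ∈ (Finset.range (N+1)).filter Nat.Prime, Real.log p / p

lemma log_fact_eq_s16 (N : ℕ) : Real.log (N.factorial) =
    ∑ p ∈ (Finset.range (N+1)).filter Nat.Prime, (N.factorial.factorization p : ℝ) * Real.log p := by
  have h : (N.factorial : ℝ) = ∏ p ∈ (Finset.range (N+1)).filter Nat.Prime, (p : ℝ) ^ (N.factorial.factorization p) := by
    have h1 := Nat.prod_factorization_pow_eq_self (Nat.factorial_ne_zero N)
    rw [Finsupp.prod_of_support_subset (s := (Finset.range (N+1)).filter Nat.Prime)] at h1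
    · conv_lhs => rw [← h1]
      push_cast; rfl
    · intro p hp
      simp only [Nat.support_factorization, Nat.mem_primeFactors] at hp
      simp only [Finset.mem_filter, Finset.mem_range]
      exact ⟨by have := (hp.1.dvd_factorial).1 hp.2.1; omega, hp.1⟩
    · simp
  rw [h, Real.log_prod]
  · simp
  · intro p hp
    simp only [Finset.mem_filter] at hp
    have := hp.2.pos
    positivity

lemma fact_val_le (N p : ℕ) (hp : p.Prime) :
    (N.factorial.factorization p : ℝ) ≤ N / ((p:ℝ) - 1) := by
  have h := Nat.factorization_factorial_le_div_pred hp N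
  have h2 : ((N / (p-1) : ℕ) : ℝ) ≤ (N:ℝ) / ((p - 1 : ℕ) : ℝ) := Nat.cast_div_le
  rw [Nat.cast_sub hp.one_le] at h2
  push_cast at h2
  exact le_trans (by exact_mod_cast h) h2

lemma le_fact_val (N p : ℕ) (hp : p.Prime) :
    N / (p:ℝ) - 1 ≤ (N.factorial.factorization p : ℝ) := by
  have h : N / p ≤ N.factorial.factorization p := by
    rw [Nat.factorization_factorial hp (b := Nat.log p N + 2) (by omega)]
    calc N / p = N / p^1 := by simp
      _ ≤ _ := Finset.single_le_sum (f := fun i => N / p^i) (fun _ _ => Nat.zero_le _) (by simp)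
  have h2 : (N:ℝ)/p < (N / p : ℕ) + 1 := by
    rw [div_lt_iff₀ (by exact_mod_cast hp.pos)]
    exact_mod_cast (by have := Nat.lt_mul_div_succ N hp.pos; rwa [mul_comm] at this : N < (N/p+1) * p)
  have h3 : ((N / p : ℕ):ℝ) ≤ (N.factorial.factorization p : ℝ) := by exact_mod_cast h
  linarith

lemma sum_logp_bdd : ∃ D : ℝ, 0 ≤ D ∧ ∀ N : ℕ, ∑ p ∈ (Finset.range (N+1)).filter Nat.Prime,
    (Real.log p / ((p:ℝ)-1) - Real.log p / p) ≤ D := by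
  have hs : Summable (fun n : ℕ => 4 * (1 / (n:ℝ) ^ (3/2:ℝ))) :=
    (Real.summable_one_div_nat_rpow.2 (by norm_num)).mul_left 4
  refine ⟨∑' n : ℕ, 4 * (1 / (n:ℝ) ^ (3/2:ℝ)), tsum_nonneg (fun n => by positivity), fun N => ?_⟩
  refine le_trans (Finset.sum_le_sum ?_) (hs.sum_le_tsum _ (fun n _ => by positivity))
  intro p hp
  simp only [Finset.mem_filter] at hp
  have h2 : (2:ℝ) ≤ p := by exact_mod_cast hp.2.two_le
  have hp0 : (0:ℝ) < p := by linarith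
  have hl : Real.log p ≤ (p:ℝ)^(1/2:ℝ) / (1/2) := Real.log_le_rpow_div (by linarith) (by norm_num)
  have e : Real.log p / ((p:ℝ)-1) - Real.log p / p = Real.log p / (p * (p-1)) := by
    have : (p:ℝ) - 1 ≠ 0 := by linarith
    field_simp; ring
  have e2 : (p:ℝ)^(3/2:ℝ) * (p:ℝ)^(1/2:ℝ) = p * p := by
    rw [← Real.rpow_add hp0]; norm_num; ring
  have h3 : 0 < (p:ℝ)^(3/2:ℝ) := by positivity
  rw [e, div_le_iff₀ (by nlinarith), mul_one_div, div_mul_eq_mul_div, le_div_iff₀ h3]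
  calc Real.log p * (p:ℝ)^(3/2:ℝ) ≤ ((p:ℝ)^(1/2:ℝ) / (1/2)) * (p:ℝ)^(3/2:ℝ) := by gcongr
    _ = 2 * (p * p) := by rw [← e2]; ring
    _ ≤ _ := by nlinarith

lemma mertens_one : ∃ B : ℝ, 0 ≤ B ∧ ∀ N : ℕ, 1 ≤ N → |mertA N - Real.log N| ≤ B := by
  obtain ⟨D, hD0, hD⟩ := sum_logp_bdd
  refine ⟨D + 1 + Real.log 4, by have := Real.log_nonneg (show (1:ℝ) ≤ 4 by norm_num); linarith, fun N hN => ?_⟩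
  have hN0 : (0:ℝ) < N := by exact_mod_cast hN
  have hl4 := Real.log_nonneg (show (1:ℝ) ≤ 4 by norm_num)
  have hf := log_fact_eq_s16 N
  have up : Real.log N.factorial ≤ N * Real.log N := by
    rw [← Real.log_pow]
    apply Real.log_le_log (by exact_mod_cast Nat.factorial_pos N)
    exact_mod_cast Nat.factorial_le_pow N
  have lo : N * Real.log N - N ≤ Real.log N.factorial := by
    have h := Real.pow_div_factorial_le_exp (x := N) hN0.le N
    have hfp : (0:ℝ) < N.factorial := by exact_mod_cast Nat.factorial_pos N
    have := Real.log_le_log (by positivity) h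
    rw [Real.log_div (by positivity) (by positivity), Real.log_exp, Real.log_pow] at this
    linarith
  have h1 : Real.log N.factorial ≤ N * (mertA N + D) := by
    have : mertA N + D ≥ ∑ p ∈ (Finset.range (N+1)).filter Nat.Prime, Real.log p / ((p:ℝ)-1) := by
      have := hD N
      rw [Finset.sum_sub_distrib] at this
      unfold mertA; linarith
    refine le_trans ?_ (mul_le_mul_of_nonneg_left this hN0.le)
    rw [hf, Finset.mul_sum]
    apply Finset.sum_le_sum
    intro p hp
    simp only [Finset.mem_filter] at hp
    have := mul_le_mul_of_nonneg_right (fact_val_le N p hp.2) (Real.log_natCast_nonneg p)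
    calc _ ≤ _ := this
      _ = _ := by ring
  have h2 : N * mertA N - Real.log 4 * N ≤ Real.log N.factorial := by
    have ht : ∑ p ∈ (Finset.range (N+1)).filter Nat.Prime, Real.log p ≤ Real.log 4 * N := by
      have := Chebyshev.theta_le_log4_mul_x hN0.le
      rw [Chebyshev.theta_eq_sum_Icc, Nat.floor_natCast] at this
      rwa [Finset.range_eq_Ico, Finset.Ico_add_one_right_eq_Icc]
    have : N * mertA N - ∑ p ∈ (Finset.range (N+1)).filter Nat.Prime, Real.log p ≤ Real.log N.factorial := by
      rw [hf, mertA, Finset.mul_sum, ← Finset.sum_sub_distrib]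
      apply Finset.sum_le_sum
      intro p hp
      simp only [Finset.mem_filter] at hp
      have := mul_le_mul_of_nonneg_right (le_fact_val N p hp.2) (Real.log_natCast_nonneg p)
      calc _ = _ := by ring
        _ ≤ _ := this
    linarith
  rw [abs_le]
  constructor
  · have : N * (Real.log N - 1) ≤ N * (mertA N + D) := by linarith
    have := le_of_mul_le_mul_left this hN0
    linarith
  · have : N * (mertA N - Real.log 4) ≤ N * Real.log N := by linarith
    have := le_of_mul_le_mul_left this hN0
    linarith

lemma mertens_two_aux (B : ℝ) (hB : ∀ N : ℕ, 1 ≤ N → |mertA N - Real.log N| ≤ B) (T : ℕ) (hT : 2 ≤ T)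
    (N : ℕ) (hN : T ≤ N) :
    ∑ p ∈ (Finset.Ioc T N).filter Nat.Prime, (1:ℝ) / p ≤
      Real.log (Real.log N) - Real.log (Real.log T) + (mertA N - Real.log N) / Real.log N
      - (mertA T - Real.log T) / Real.log T + B * (1 / Real.log T - 1 / Real.log N) := by
  induction N, hN using Nat.le_induction with
  | base => simp
  | succ N hN ih =>
    have hN2 : (2:ℝ) ≤ N := by exact_mod_cast hT.trans hN
    have hl : 0 < Real.log N := Real.log_pos (by linarith)
    have hll : Real.log N ≤ Real.log ((N+1:ℕ):ℝ) := Real.log_le_log (by linarith) (by push_cast; linarith)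
    have hl' : 0 < Real.log ((N+1:ℕ):ℝ) := by linarith
    have hM := (abs_le.1 (hB N (by omega))).2
    have step : ∑ p ∈ (Finset.Ioc T (N+1)).filter Nat.Prime, (1:ℝ) / p =
        ∑ p ∈ (Finset.Ioc T N).filter Nat.Prime, (1:ℝ) / p + (mertA (N+1) - mertA N) / Real.log ((N+1:ℕ):ℝ) := by
      have hi : Finset.Ioc T (N+1) = insert (N+1) (Finset.Ioc T N) := by
        ext; simp; omega
      unfold mertA
      rw [hi, Finset.range_add_one (n := N+1), Finset.filter_insert, Finset.filter_insert]
      split_ifs with hp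
      · rw [Finset.sum_insert (by simp), Finset.sum_insert (by simp)]
        have : ((N+1:ℕ):ℝ) ≠ 0 := by positivity
        field_simp
        ring
      · simp
    have hlog : 1 - Real.log N / Real.log ((N+1:ℕ):ℝ) ≤ Real.log (Real.log ((N+1:ℕ):ℝ)) - Real.log (Real.log N) := by
      have := Real.one_sub_inv_le_log_of_pos (div_pos hl' hl)
      rw [inv_div, Real.log_div hl'.ne' hl.ne'] at this
      exact this
    have hinv : 1 / Real.log ((N+1:ℕ):ℝ) ≤ 1 / Real.log N := one_div_le_one_div_of_le hl hll
    have key : (mertA N - Real.log N) * (1 / Real.log N - 1 / Real.log ((N+1:ℕ):ℝ)) ≤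
        B * (1 / Real.log N - 1 / Real.log ((N+1:ℕ):ℝ)) :=
      mul_le_mul_of_nonneg_right hM (by linarith)
    rw [step]
    have e1 : (mertA (N+1) - mertA N) / Real.log ((N+1:ℕ):ℝ) =
      (1 - Real.log N / Real.log ((N+1:ℕ):ℝ)) + (mertA (N+1) - Real.log ((N+1:ℕ):ℝ)) / Real.log ((N+1:ℕ):ℝ)
       - (mertA N - Real.log N) * (1 / Real.log ((N+1:ℕ):ℝ)) := by
      field_simp; ring
    have e2 : (mertA N - Real.log N) / Real.log N = (mertA N - Real.log N) * (1 / Real.log N) := by ring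
    rw [e1]
    rw [e2] at ih
    nlinarith

lemma mertens_two : ∃ A : ℝ, 0 ≤ A ∧ ∀ t z : ℝ, Real.exp 1 ≤ t → t ≤ z →
    ∑ p ∈ (Finset.range (⌊z⌋₊+1)).filter (fun p : ℕ => p.Prime ∧ t ≤ p), (1:ℝ) / p ≤
      Real.log (Real.log z) - Real.log (Real.log t) + A / Real.log t := by
  obtain ⟨B, hB0, hB⟩ := mertens_one
  refine ⟨2 * B + 1, by linarith, fun t z ht hz => ?_⟩
  have ht2 : 2 ≤ t := by have := Real.add_one_le_exp (1:ℝ); linarith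
  have hL : 0 < Real.log t := Real.log_pos (by linarith)
  have hLz : Real.log t ≤ Real.log z := Real.log_le_log (by linarith) hz
  have hLL : Real.log (Real.log t) ≤ Real.log (Real.log z) := Real.log_le_log hL hLz
  by_cases hc : ⌈t⌉₊ ≤ ⌊z⌋₊
  · set T := ⌈t⌉₊
    set N := ⌊z⌋₊
    have htT : t ≤ T := Nat.le_ceil t
    have hT2 : 2 ≤ T := by exact_mod_cast ht2.trans htT
    have hNz : (N:ℝ) ≤ z := Nat.floor_le (by linarith)
    have hN2 : (2:ℝ) ≤ N := by exact_mod_cast hT2.trans hc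
    have h := mertens_two_aux B hB T hT2 N hc
    have hlT : Real.log t ≤ Real.log T := Real.log_le_log (by linarith) htT
    have hllT : Real.log (Real.log t) ≤ Real.log (Real.log T) := Real.log_le_log hL hlT
    have hlN0 : 0 < Real.log N := Real.log_pos (by linarith)
    have hlN : Real.log N ≤ Real.log z := Real.log_le_log (by linarith) hNz
    have hllN : Real.log (Real.log N) ≤ Real.log (Real.log z) := Real.log_le_log hlN0 hlN
    have hsub : ∑ p ∈ (Finset.range (N+1)).filter (fun p : ℕ => p.Prime ∧ t ≤ p), (1:ℝ) / p ≤
        1 / T + ∑ p ∈ (Finset.Ioc T N).filter Nat.Prime, (1:ℝ) / p := by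
      rw [← Finset.sum_insert (f := fun p : ℕ => (1:ℝ)/p) (a := T) (by simp)]
      apply Finset.sum_le_sum_of_subset_of_nonneg
      · intro p hp
        simp only [Finset.mem_filter, Finset.mem_range] at hp
        have : T ≤ p := Nat.ceil_le.2 hp.2.2
        simp only [Finset.mem_insert, Finset.mem_filter, Finset.mem_Ioc]
        rcases this.eq_or_lt with h | h
        · exact Or.inl h.symm
        · exact Or.inr ⟨⟨h, by omega⟩, hp.2.1⟩
      · intros; positivity
    have hT1 : (1:ℝ) / T ≤ 1 / Real.log t := by
      apply one_div_le_one_div_of_le hL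
      have := Real.log_le_sub_one_of_pos (show 0 < t by linarith)
      linarith
    have hM1 : (mertA N - Real.log N) / Real.log N ≤ B * (1 / Real.log N) := by
      rw [mul_one_div]
      have := (abs_le.1 (hB N (by omega))).2
      gcongr
    have hlT0 : 0 < Real.log T := by linarith
    have hM2 : -(B * (1 / Real.log T)) ≤ (mertA T - Real.log T) / Real.log T := by
      rw [mul_one_div, ← neg_div]
      have := (abs_le.1 (hB T (by omega))).1
      gcongr
    have hM3 : B * (1 / Real.log T) ≤ B * (1 / Real.log t) :=
      mul_le_mul_of_nonneg_left (one_div_le_one_div_of_le hL hlT) hB0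
    have e : (2 * B + 1) / Real.log t = 2 * (B * (1 / Real.log t)) + 1 / Real.log t := by ring
    rw [e]
    nlinarith
  · rw [Finset.filter_false_of_mem]
    · simp only [Finset.sum_empty]
      have : 0 ≤ (2 * B + 1) / Real.log t := by positivity
      linarith
    · rintro p hp ⟨_, h2⟩
      have := Nat.ceil_le.2 h2
      simp only [Finset.mem_range] at hp
      omega

lemma rankin (h : ℕ → ℝ) (hh : ∀ p, 0 ≤ h p) (X : ℕ) :
    ∑ n ∈ Finset.Ioc 0 X, ∏ p ∈ n.primeFactors, (1 + h p) ≤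
      X * ∏ p ∈ (Finset.range (X+1)).filter Nat.Prime, (1 + h p / p) := by
  set P := (Finset.range (X+1)).filter Nat.Prime with hP
  have h1 : ∀ n ∈ Finset.Ioc 0 X, ∏ p ∈ n.primeFactors, (1 + h p) =
      ∑ s ∈ P.powerset, if s ⊆ n.primeFactors then ∏ p ∈ s, h p else 0 := by
    intro n hn
    rw [Finset.mem_Ioc] at hn
    rw [Finset.prod_one_add, ← Finset.sum_filter]
    apply Finset.sum_congr _ (fun _ _ => rfl)
    ext s
    simp only [Finset.mem_powerset, Finset.mem_filter]
    constructor
    · intro hs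
      refine ⟨fun p hp => ?_, hs⟩
      have h2 := hs hp
      have h3 := Nat.le_of_mem_primeFactors h2
      simp only [hP, Finset.mem_filter, Finset.mem_range]
      exact ⟨by omega, Nat.prime_of_mem_primeFactors h2⟩
    · exact fun h => h.2
  rw [Finset.sum_congr rfl h1, Finset.sum_comm, Finset.prod_one_add, Finset.mul_sum]
  apply Finset.sum_le_sum
  intro s hs
  rw [Finset.mem_powerset] at hs
  have hsp : ∀ p ∈ s, Nat.Prime p := fun p hp => (Finset.mem_filter.1 (hs hp)).2
  rw [← Finset.sum_filter, Finset.sum_const, nsmul_eq_mul, Finset.prod_div_distrib]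
  have hc : (((Finset.Ioc 0 X).filter (fun n => s ⊆ n.primeFactors)).card : ℝ) ≤ X / ∏ p ∈ s, (p:ℝ) := by
    have : ((Finset.Ioc 0 X).filter (fun n => s ⊆ n.primeFactors)).card ≤ X / ∏ p ∈ s, p := by
      rw [← Nat.Ioc_filter_dvd_card_eq_div]
      apply Finset.card_le_card
      intro n hn
      simp only [Finset.mem_filter] at hn ⊢
      refine ⟨hn.1, Finset.prod_primes_dvd n (fun p hp => (hsp p hp).prime) 
        (fun p hp => Nat.dvd_of_mem_primeFactors (hn.2 hp))⟩
    calc _ ≤ ((X / ∏ p ∈ s, p : ℕ) : ℝ) := by exact_mod_cast this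
      _ ≤ (X:ℝ) / ((∏ p ∈ s, p : ℕ) : ℝ) := Nat.cast_div_le
      _ = _ := by push_cast; rfl
  calc _ ≤ (X / ∏ p ∈ s, (p:ℝ)) * ∏ p ∈ s, h p :=
        mul_le_mul_of_nonneg_right hc (Finset.prod_nonneg (fun p _ => hh p))
    _ = _ := by ring

lemma exp_primeSum (t l : ℝ) (n : ℕ) : Real.exp (l * primeSum t n) =
    ∏ p ∈ n.primeFactors, (1 + (if t ≤ (p:ℝ) then Real.exp (l / p) - 1 else 0)) := by
  unfold primeSum
  rw [Finset.mul_sum, Real.exp_sum]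
  apply Finset.prod_congr rfl
  intro p _
  by_cases h : t ≤ (p:ℝ)
  · rw [Set.indicator_of_mem (by exact h), if_pos h, mul_one_div]; ring
  · rw [Set.indicator_of_notMem (by exact h), if_neg h]; simp

lemma tail_sum (l : ℝ) (hl : 1 ≤ l) (X : ℕ) :
    ∑ p ∈ (Finset.range (X+1)).filter (fun p : ℕ => l < p), 2 * l / (p:ℝ)^2 ≤ 4 := by
  have h1 := sum_Ioo_inv_sq_le (α := ℝ) ⌊l⌋₊ (X+1)
  have hf : l < ⌊l⌋₊ + 1 := Nat.lt_floor_add_one l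
  calc _ ≤ ∑ p ∈ Finset.Ioo ⌊l⌋₊ (X+1), 2 * l / (p:ℝ)^2 := by
        apply Finset.sum_le_sum_of_subset_of_nonneg
        · intro p hp
          simp only [Finset.mem_filter, Finset.mem_range] at hp
          rw [Finset.mem_Ioo]
          exact ⟨(Nat.floor_lt (by linarith)).2 hp.2, hp.1⟩
        · intros; positivity
    _ = 2 * l * ∑ p ∈ Finset.Ioo ⌊l⌋₊ (X+1), ((p:ℝ)^2)⁻¹ := by
        rw [Finset.mul_sum]; rfl
    _ ≤ 2 * l * (2 / (⌊l⌋₊ + 1)) := mul_le_mul_of_nonneg_left h1 (by linarith)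
    _ ≤ 4 := by
        rw [← mul_div_assoc, div_le_iff₀ (by positivity)]; linarith

lemma prod_bound (t l : ℝ) (ht : 1 ≤ t) (hl : 1 ≤ l) (X : ℕ) :
    ∏ p ∈ (Finset.range (X+1)).filter Nat.Prime,
      (1 + (if t ≤ (p:ℝ) then Real.exp (l / p) - 1 else 0) / p) ≤
    Real.exp (l * (∑ p ∈ (Finset.range (⌊l⌋₊+1)).filter (fun p : ℕ => p.Prime ∧ t ≤ p), (1:ℝ) / p) + 4) := by
  have h1 : ∀ p ∈ (Finset.range (X+1)).filter Nat.Prime,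
      (1 + (if t ≤ (p:ℝ) then Real.exp (l / p) - 1 else 0) / p) ≤
      Real.exp ((if t ≤ (p:ℝ) ∧ (p:ℝ) ≤ l then l / p else 0) + (if l < p then 2 * l / (p:ℝ)^2 else 0)) := by
    intro p hp
    have hp1 : (1:ℝ) ≤ p := by exact_mod_cast (Finset.mem_filter.1 hp).2.one_le
    by_cases h : t ≤ (p:ℝ)
    · by_cases h2 : (p:ℝ) ≤ l
      · rw [if_pos h, if_pos ⟨h, h2⟩, if_neg (by linarith), add_zero]
        have : 0 ≤ Real.exp (l / p) - 1 := by
          have := Real.add_one_le_exp (l / p)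
          have : 0 ≤ l / p := by positivity
          linarith
        have := div_le_self this hp1
        linarith
      · rw [if_pos h, if_neg (by tauto), if_pos (by linarith), zero_add]
        have hu : l / p ≤ 1 := by rw [div_le_one (by linarith)]; linarith
        have hu0 : 0 ≤ l / p := by positivity
        have h3 : Real.exp (l/p) - 1 ≤ 2 * (l / p) := by
          have := Real.abs_exp_sub_one_le (x := l / p) (by rw [abs_of_nonneg hu0]; exact hu)
          rw [abs_of_nonneg hu0] at this
          exact (le_abs_self _).trans this
        have h4 : (Real.exp (l/p) - 1) / p ≤ 2 * l / (p:ℝ)^2 := by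
          calc _ ≤ 2 * (l / p) / p := by gcongr
            _ = _ := by field_simp
        have := Real.add_one_le_exp (2 * l / (p:ℝ)^2)
        linarith
    · rw [if_neg h]
      simp only [zero_div, add_zero]
      apply Real.one_le_exp
      have : 0 ≤ (if l < p then 2 * l / (p:ℝ)^2 else 0) := by split_ifs <;> positivity
      have : 0 ≤ (if t ≤ (p:ℝ) ∧ (p:ℝ) ≤ l then l / (p:ℝ) else 0) := by split_ifs <;> positivity
      linarith
  refine le_trans (Finset.prod_le_prod (fun p _ => ?_) h1) ?_
  · have : 0 ≤ (if t ≤ (p:ℝ) then Real.exp (l / p) - 1 else 0) := by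
      split_ifs
      · have := Real.one_le_exp (show 0 ≤ l / p by positivity); linarith
      · exact le_rfl
    positivity
  rw [← Real.exp_sum, Real.exp_le_exp, Finset.sum_add_distrib]
  apply add_le_add
  · rw [← Finset.sum_filter, Finset.mul_sum]
    simp only [mul_one_div]
    apply Finset.sum_le_sum_of_subset_of_nonneg
    · intro p hp
      simp only [Finset.mem_filter, Finset.mem_range] at hp ⊢
      exact ⟨Nat.lt_succ_of_le (Nat.le_floor hp.2.2), hp.1.2, hp.2.1⟩
    · intros; positivity
  · rw [← Finset.sum_filter]
    refine le_trans (Finset.sum_le_sum_of_subset_of_nonneg ?_ ?_) (tail_sum l hl X)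
    · intro p hp
      simp only [Finset.mem_filter] at hp ⊢
      exact ⟨hp.1.1, hp.2⟩
    · intros; positivity

lemma count_bound (t l c x : ℝ) (ht : 1 ≤ t) (hl : 1 ≤ l) (hx : 1 ≤ x) :
    (Set.ncard {n : ℕ | 0 < n ∧ (n : ℝ) ≤ x ∧ c ≤ primeSum t n} : ℝ) ≤
      x * Real.exp (l * (∑ p ∈ (Finset.range (⌊l⌋₊+1)).filter (fun p : ℕ => p.Prime ∧ t ≤ p), (1:ℝ) / p) + 4
        - l * c) := by
  classical
  have hs : {n : ℕ | 0 < n ∧ (n : ℝ) ≤ x ∧ c ≤ primeSum t n} =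
      ((Finset.Ioc 0 ⌊x⌋₊).filter (fun n => c ≤ primeSum t n) : Finset ℕ) := by
    ext n
    simp only [Set.mem_setOf_eq, Finset.coe_filter, Finset.mem_Ioc, Nat.le_floor_iff (show 0 ≤ x by linarith)]
    tauto
  rw [hs, Set.ncard_coe_finset, Real.exp_sub, ← mul_div_assoc, le_div_iff₀ (Real.exp_pos _)]
  calc _ = ∑ n ∈ (Finset.Ioc 0 ⌊x⌋₊).filter (fun n => c ≤ primeSum t n), Real.exp (l * c) := by simp
    _ ≤ ∑ n ∈ (Finset.Ioc 0 ⌊x⌋₊).filter (fun n => c ≤ primeSum t n), Real.exp (l * primeSum t n) := by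
        apply Finset.sum_le_sum
        intro n hn
        have := (Finset.mem_filter.1 hn).2
        gcongr
    _ ≤ ∑ n ∈ Finset.Ioc 0 ⌊x⌋₊, Real.exp (l * primeSum t n) :=
        Finset.sum_le_sum_of_subset_of_nonneg (Finset.filter_subset _ _) (fun _ _ _ => (Real.exp_pos _).le)
    _ ≤ _ := by
        simp only [exp_primeSum]
        refine rankin (fun p => if t ≤ (p:ℝ) then Real.exp (l / p) - 1 else 0) (fun p => ?_) _
        split_ifs
        · have := Real.one_le_exp (show 0 ≤ l / p by positivity); linarith
        · exact le_rfl
    _ ≤ ⌊x⌋₊ * Real.exp (l * (∑ p ∈ (Finset.range (⌊l⌋₊+1)).filter (fun p : ℕ => p.Prime ∧ t ≤ p), (1:ℝ) / p) + 4) :=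
        mul_le_mul_of_nonneg_left (prod_bound t l ht hl _) (by positivity)
    _ ≤ _ := mul_le_mul_of_nonneg_right (Nat.floor_le (by linarith)) (Real.exp_pos _).le

theorem unweighted_anatomy_improved (ε : ℝ) (hε : ε ∈ Set.Ioo (0:ℝ) 1) :
    ∃ K C : ℝ, 0 < C ∧ ∀ (t c x : ℝ),
      Real.exp (Real.exp 1) ≤ t → 0 < c →
      K ≤ ε * c * Real.log t / Real.log (Real.log t) → 1 ≤ x →
      (Set.ncard {n : ℕ | 0 < n ∧ (n : ℝ) ≤ x ∧ c ≤ primeSum t n} : ℝ) ≤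
        C * x * Real.exp (-(100 * t ^ Real.exp ((1 - ε) * c))) := by
  obtain ⟨A, hA0, hA⟩ := mertens_two
  obtain ⟨he0, he1⟩ := hε
  refine ⟨4 * A + 400, Real.exp 4, Real.exp_pos _, fun t c x ht hc hK hx => ?_⟩
  have hte : Real.exp 1 ≤ t := by
    have := Real.add_one_le_exp (Real.exp 1); linarith
  have ht1 : 1 ≤ t := by
    have := Real.add_one_le_exp (1:ℝ); linarith
  have ht0 : 0 < t := by linarith
  have hL : Real.exp 1 ≤ Real.log t := (Real.le_log_iff_exp_le ht0).2 ht
  have hL0 : 0 < Real.log t := lt_of_lt_of_le (Real.exp_pos _) hL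
  have hll : 1 ≤ Real.log (Real.log t) := (Real.le_log_iff_exp_le hL0).2 hL
  have hexpll : Real.exp (Real.log (Real.log t)) = Real.log t := Real.exp_log hL0
  set L := Real.log t with hLdef
  set m := Real.log L with hm
  rw [le_div_iff₀ (by linarith)] at hK
  have hec : 0 < ε * c := by positivity
  have hAm : A ≤ A * m := le_mul_of_one_le_right hA0 hll
  have hK1 : 4 * A + 400 * m ≤ ε * c * L := by linarith
  set y := t ^ Real.exp ((1 - ε) * c) with hy
  set l := t ^ Real.exp ((1 - ε/2) * c) with hl
  have hlt : t ≤ l := by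
    rw [hl]
    conv_lhs => rw [← Real.rpow_one t]
    apply Real.rpow_le_rpow_of_exponent_le ht1
    apply Real.one_le_exp
    have : 0 < 1 - ε/2 := by linarith
    positivity
  have hl1 : 1 ≤ l := ht1.trans hlt
  have hlogl : Real.log (Real.log l) = (1 - ε/2) * c + m := by
    rw [hl, Real.log_rpow ht0, Real.log_mul (Real.exp_pos _).ne' hL0.ne', Real.log_exp]
  have hs := hA t l hte hlt
  rw [hlogl] at hs
  have hy0 : 0 < y := by positivity
  have hAL : A / L ≤ ε * c / 4 := by
    rw [div_le_iff₀ hL0]; linarith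
  have hly : y * L ≤ l := by
    have hd : ε * c / 2 ≤ Real.exp ((1 - ε/2) * c) - Real.exp ((1 - ε) * c) := by
      have e : Real.exp ((1 - ε/2) * c) = Real.exp ((1 - ε) * c) * Real.exp (ε * c / 2) := by
        rw [← Real.exp_add]; congr 1; ring
      have h1 : 1 ≤ Real.exp ((1 - ε) * c) := Real.one_le_exp (by
        have : 0 < 1 - ε := by linarith
        positivity)
      have h2 := Real.add_one_le_exp (ε * c / 2)
      rw [e]
      nlinarith
    calc y * L = Real.exp (L * Real.exp ((1 - ε) * c) + m) := by
          rw [Real.exp_add, hexpll, hy, Real.rpow_def_of_pos ht0]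
      _ ≤ Real.exp (L * Real.exp ((1 - ε/2) * c)) := by
          apply Real.exp_le_exp.2
          nlinarith [mul_le_mul_of_nonneg_left hd hL0.le]
      _ = l := by rw [hl, Real.rpow_def_of_pos ht0]
  have hfin : 100 * y ≤ l * (ε * c / 4) := by
    have h1 : y * L * (ε * c / 4) ≤ l * (ε * c / 4) := mul_le_mul_of_nonneg_right hly (by positivity)
    have h2 : 400 ≤ ε * c * L := by linarith
    nlinarith [mul_le_mul_of_nonneg_left h2 hy0.le]
  refine (count_bound t l c x ht1 hl1 hx).trans ?_
  rw [mul_comm (Real.exp 4) x, mul_assoc, ← Real.exp_add]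
  refine mul_le_mul_of_nonneg_left (Real.exp_le_exp.2 ?_) (by linarith)
  have h3 := mul_le_mul_of_nonneg_left (hs.trans (show _ ≤ c - ε * c / 4 by linarith)) (show 0 ≤ l by linarith)
  linarith
end

section
/- Let ε ∈ (0,1). There exists a constant K = K(ε) such that for any t ≥ e^e and c > 0 with ε·c·(log t)/(log log t) ≥ K, the following holds: if f: ℕ → ℝ≥0 is a multiplicative function satisfying (1⋆f)(n) ≤ n for all n ≥ 1, then for any M ∈ ℕ, ∑_{(m,n): mn = M, ∑_{p prime, p ≥ t, p | m} 1/p ≥ c} f(n) ≪ M·exp(−100·t^{e^{(1−ε)c}}), with an implied constant independent of t, c, M and f. -/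
open Finset in
lemma log_factorial_eq_aux (N : ℕ) : Real.log (N.factorial : ℝ) =
    ∑ d ∈ Ioc 0 N, ArithmeticFunction.vonMangoldt d * ((N / d : ℕ) : ℝ) := by
  have h1 : Real.log (N.factorial : ℝ) = ∑ n ∈ Ioc 0 N, Real.log n := by
    induction N with
    | zero => simp
    | succ k ih =>
      rw [Nat.factorial_succ, Nat.cast_mul, Real.log_mul (by positivity) (by positivity), ih,
        ← Finset.insert_Ioc_right_eq_Ioc_add_one (by omega), sum_insert (by simp)]
  rw [h1]
  calc ∑ n ∈ Ioc 0 N, Real.log n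
      = ∑ n ∈ Ioc 0 N, ∑ d ∈ n.divisors, ArithmeticFunction.vonMangoldt d := by
        simp_rw [ArithmeticFunction.vonMangoldt_sum]
    _ = ∑ d ∈ Ioc 0 N, ∑ n ∈ (Ioc 0 N).filter (fun n => d ∣ n), ArithmeticFunction.vonMangoldt d := by
        apply sum_comm'
        intro x y
        simp only [mem_Ioc, Nat.mem_divisors, mem_filter]
        constructor
        · rintro ⟨⟨h1, h2⟩, h3, h4⟩
          exact ⟨⟨⟨h1, h2⟩, h3⟩, Nat.pos_of_dvd_of_pos h3 h1, (Nat.le_of_dvd h1 h3).trans h2⟩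
        · rintro ⟨⟨⟨h1, h2⟩, h3⟩, h4⟩
          exact ⟨⟨h1, h2⟩, h3, by omega⟩
    _ = _ := by
        apply sum_congr rfl
        intro d _
        rw [sum_const, Nat.Ioc_filter_dvd_card_eq_div, nsmul_eq_mul, mul_comm]

/-- first Mertens sum -/
noncomputable def mertensA (N : ℕ) : ℝ :=
  ∑ d ∈ Finset.Ioc 0 N, ArithmeticFunction.vonMangoldt d / d

open Finset in
lemma mertensA_lower (N : ℕ) (hN : 1 ≤ N) : Real.log N - 1 ≤ mertensA N := by
  have h1 : Real.log (N.factorial : ℝ) ≤ N * mertensA N := by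
    rw [log_factorial_eq_aux, mertensA, mul_sum]
    apply sum_le_sum
    intro d hd
    have : ((N / d : ℕ) : ℝ) ≤ N / d := Nat.cast_div_le
    calc _ ≤ ArithmeticFunction.vonMangoldt d * ((N : ℝ) / d) :=
          mul_le_mul_of_nonneg_left this ArithmeticFunction.vonMangoldt_nonneg
      _ = _ := by ring
  have h2 := Stirling.le_log_factorial_stirling (n := N) (by omega)
  have h3 : (0:ℝ) ≤ Real.log N := Real.log_natCast_nonneg N
  have h4 : (0:ℝ) ≤ Real.log (2 * Real.pi) := Real.log_nonneg (by nlinarith [Real.pi_gt_three])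
  have h5 : (0:ℝ) < N := by exact_mod_cast hN
  have : (N:ℝ) * (Real.log N - 1) ≤ N * mertensA N := by linarith
  exact le_of_mul_le_mul_left this h5

open Finset in
lemma mertensA_upper (N : ℕ) (hN : 1 ≤ N) : mertensA N ≤ Real.log N + 6 := by
  have h5 : (0:ℝ) < N := by exact_mod_cast hN
  have h1 : N * mertensA N ≤ Real.log (N.factorial : ℝ) + Chebyshev.psi N := by
    rw [log_factorial_eq_aux, mertensA, mul_sum, Chebyshev.psi, Nat.floor_natCast,
      ← sum_add_distrib]
    apply sum_le_sum
    intro d hd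
    have hd0 : 0 < d := (mem_Ioc.1 hd).1
    have : (N : ℝ) / d ≤ ((N / d : ℕ) : ℝ) + 1 := by
      rw [div_le_iff₀ (by exact_mod_cast hd0)]
      have := Nat.lt_div_mul_add (a := N) hd0
      have h : N ≤ (N / d + 1) * d := by nlinarith
      exact_mod_cast h
    calc _ = ArithmeticFunction.vonMangoldt d * ((N : ℝ) / d) := by ring
      _ ≤ ArithmeticFunction.vonMangoldt d * (((N / d : ℕ) : ℝ) + 1) :=
          mul_le_mul_of_nonneg_left this ArithmeticFunction.vonMangoldt_nonneg
      _ = _ := by ring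
  have h2 : Real.log (N.factorial : ℝ) ≤ N * Real.log N := by
    rw [← Real.log_pow]
    apply Real.log_le_log (by positivity)
    exact_mod_cast Nat.factorial_le_pow N
  have h3 := Chebyshev.psi_le_const_mul_self (x := N) h5.le
  have h4 : Real.log 4 ≤ 2 := by
    rw [show (4:ℝ) = 2 ^ 2 by norm_num, Real.log_pow]
    have := Real.log_two_lt_d9
    push_cast; linarith
  have : (N:ℝ) * mertensA N ≤ N * (Real.log N + 6) := by nlinarith
  exact le_of_mul_le_mul_left this h5

open Finset in
lemma mertens_two_nat (a : ℕ) (ha : 2 ≤ a) (b : ℕ) (hab : a ≤ b) :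
    ∑ n ∈ Ioc a b, ArithmeticFunction.vonMangoldt n / n / Real.log n ≤
      mertensA b / Real.log b - (Real.log a - 1) / Real.log a +
      Real.log (Real.log b) - Real.log (Real.log a) + 6 * (1 / Real.log a - 1 / Real.log b) := by
  induction b, hab using Nat.le_induction with
  | base =>
    have hl : 0 < Real.log a := Real.log_pos (by exact_mod_cast ha)
    have := mertensA_lower a (by omega)
    have : (Real.log a - 1) / Real.log a ≤ mertensA a / Real.log a := by gcongr
    simp; linarith
  | succ b hab ih =>
    rw [← Finset.insert_Ioc_right_eq_Ioc_add_one (by omega), sum_insert (by simp)]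
    have hA : mertensA (b+1) =
        ArithmeticFunction.vonMangoldt (b+1) / ((b+1 : ℕ):ℝ) + mertensA b := by
      rw [mertensA, ← Finset.insert_Ioc_right_eq_Ioc_add_one (by omega), sum_insert (by simp)]
      rfl
    have hb : 0 < Real.log b := Real.log_pos (by exact_mod_cast (by omega : 1 < b))
    have hb1 : Real.log b ≤ Real.log (b+1:ℕ) :=
      Real.log_le_log (by exact_mod_cast (by omega : 0 < b)) (by push_cast; linarith)
    have hb0 : 0 < Real.log (b+1:ℕ) := by linarith
    have hU := mertensA_upper b (by omega)
    have hd : 0 ≤ 1 / Real.log b - 1 / Real.log (b+1:ℕ) :=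
      sub_nonneg.2 (one_div_le_one_div_of_le hb hb1)
    have h1 := mul_le_mul_of_nonneg_right hU hd
    have h2 : Real.log b * (1 / Real.log b - 1 / Real.log (b+1:ℕ)) ≤
        Real.log (Real.log (b+1:ℕ)) - Real.log (Real.log b) := by
      rw [← Real.log_div hb0.ne' hb.ne']
      have := Real.one_sub_inv_le_log_of_pos (x := Real.log (b+1:ℕ) / Real.log b) (by positivity)
      refine le_trans (le_of_eq ?_) this
      field_simp
    have h3 : mertensA (b+1) / Real.log (b+1:ℕ) =
      ArithmeticFunction.vonMangoldt (b+1) / ((b+1 : ℕ):ℝ) / Real.log (b+1:ℕ) +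
       mertensA b / Real.log b - mertensA b * (1 / Real.log b - 1 / Real.log (b+1:ℕ)) := by
      rw [hA]; ring
    rw [h3]
    linarith

open Finset in
lemma mertens_two_s17 (t y : ℝ) (ht : 4 ≤ t) (hty : t ≤ y) (s : Finset ℕ)
    (hs : ∀ p ∈ s, p.Prime ∧ t ≤ p ∧ (p:ℝ) ≤ y) :
    ∑ p ∈ s, 1 / (p:ℝ) ≤ Real.log (Real.log y) - Real.log (Real.log t) + 16 / Real.log t := by
  obtain ⟨a, ha⟩ : ∃ a, ⌈t⌉₊ = a + 1 :=
    Nat.exists_eq_succ_of_ne_zero (Nat.ceil_pos.2 (by linarith)).ne'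
  have hat : (a:ℝ) < t := by
    apply Nat.lt_ceil.1; omega
  have hta : t ≤ a + 1 := by
    have := Nat.le_ceil t
    rw [ha] at this; exact_mod_cast this
  have ha3 : 3 ≤ a := by
    have : (3:ℝ) ≤ a := by linarith
    exact_mod_cast this
  have ha3' : (3:ℝ) ≤ a := by exact_mod_cast ha3
  set b := ⌊y⌋₊ with hb
  have hab : a ≤ b := Nat.le_floor (by linarith)
  have h1 : ∑ p ∈ s, 1 / (p:ℝ) ≤
      ∑ n ∈ Ioc a b, ArithmeticFunction.vonMangoldt n / n / Real.log n := by
    calc ∑ p ∈ s, 1 / (p:ℝ) = ∑ n ∈ s, ArithmeticFunction.vonMangoldt n / n / Real.log n := by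
          apply sum_congr rfl
          intro p hp
          have hpp := (hs p hp).1
          have : Real.log p ≠ 0 := (Real.log_pos (by exact_mod_cast hpp.one_lt)).ne'
          rw [ArithmeticFunction.vonMangoldt_apply_prime hpp]
          field_simp
      _ ≤ _ := by
          apply sum_le_sum_of_subset_of_nonneg
          · intro p hp
            obtain ⟨_, h2, h3⟩ := hs p hp
            rw [mem_Ioc]
            refine ⟨?_, Nat.le_floor h3⟩
            exact_mod_cast hat.trans_le h2
          · intro n _ _
            have := ArithmeticFunction.vonMangoldt_nonneg (n := n)
            have := Real.log_natCast_nonneg n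
            positivity
  have h2 := mertens_two_nat a (by omega) b hab
  have hU := mertensA_upper b (by omega)
  have hla : 0 < Real.log a := Real.log_pos (by linarith)
  have hlab : Real.log a ≤ Real.log b :=
    Real.log_le_log (by linarith) (by exact_mod_cast hab)
  have hlb : 0 < Real.log b := by linarith
  have hlt : 0 < Real.log t := Real.log_pos (by linarith)
  have h3 : mertensA b / Real.log b ≤ 1 + 6 * (1 / Real.log b) := by
    rw [div_le_iff₀ hlb]
    field_simp
    exact hU
  have h4 : (Real.log a - 1) / Real.log a = 1 - 1 / Real.log a := by field_simp
  have hby : (b:ℝ) ≤ y := Nat.floor_le (by linarith)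
  have h5 : Real.log (Real.log b) ≤ Real.log (Real.log y) := by
    apply Real.log_le_log hlb
    apply Real.log_le_log _ hby
    exact_mod_cast (by omega : 0 < b)
  have h6 : Real.log t - Real.log a ≤ 1 := by
    rw [← Real.log_div (by linarith) (by linarith)]
    have := Real.log_le_sub_one_of_pos (x := t / a) (by positivity)
    have h : t / a ≤ 2 := by
      rw [div_le_iff₀ (by linarith)]; linarith
    linarith
  have h7 : Real.log (Real.log t) - Real.log (Real.log a) ≤ 1 / Real.log a := by
    rw [← Real.log_div (by linarith) (by linarith)]
    have := Real.log_le_sub_one_of_pos (x := Real.log t / Real.log a) (by positivity)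
    refine this.trans ?_
    rw [div_sub_one hla.ne']
    gcongr
  have h8 : 1 / Real.log a ≤ 2 / Real.log t := by
    rw [div_le_div_iff₀ hla hlt]
    have : Real.log t ≤ Real.log ((a:ℝ)^2) := Real.log_le_log (by linarith) (by nlinarith)
    rw [Real.log_pow] at this
    push_cast at this; linarith
  have h9 : 16 / Real.log t = 8 * (2 / Real.log t) := by ring
  rw [h4] at h2
  linarith
/-- pointwise weight -/
noncomputable def wgt (t l : ℝ) (p : ℕ) : ℝ :=
  Real.exp (l * Set.indicator {q : ℕ | t ≤ (q : ℝ)} (fun q => 1 / (q : ℝ)) p)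

noncomputable def wArith (t l : ℝ) : ArithmeticFunction ℝ :=
  ⟨fun m => if m = 0 then 0 else Real.exp (l * primeSum t m), by simp⟩

noncomputable def fArith (f : ℕ → ℝ) : ArithmeticFunction ℝ :=
  ⟨fun m => if m = 0 then 0 else f m, by simp⟩

lemma wArith_mult (t l : ℝ) : (wArith t l).IsMultiplicative := by
  rw [ArithmeticFunction.IsMultiplicative.iff_ne_zero]
  constructor
  · simp [wArith, primeSum]
  · intro m n hm hn hmn
    simp only [wArith, ArithmeticFunction.coe_mk, hm, hn, mul_eq_zero, or_self, if_false]
    rw [← Real.exp_add, ← mul_add]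
    congr 2
    unfold primeSum
    rw [hmn.primeFactors_mul, Finset.sum_union hmn.disjoint_primeFactors]

lemma fArith_mult (f : ℕ → ℝ) (h1 : f 1 = 1)
    (hf : ∀ a b : ℕ, Nat.Coprime a b → f (a * b) = f a * f b) :
    (fArith f).IsMultiplicative := by
  rw [ArithmeticFunction.IsMultiplicative.iff_ne_zero]
  constructor
  · simp [fArith, h1]
  · intro m n hm hn hmn
    simp [fArith, hm, hn, hf m n hmn]

lemma conv_eq (t l : ℝ) (f : ℕ → ℝ) (M : ℕ) :
    (wArith t l * fArith f) M = ∑ m ∈ M.divisors, Real.exp (l * primeSum t m) * f (M / m) := by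
  rw [ArithmeticFunction.mul_apply,
    Nat.sum_divisorsAntidiagonal (fun i j => wArith t l i * fArith f j)]
  apply Finset.sum_congr rfl
  intro m hm
  have hm0 : m ≠ 0 := (Nat.pos_of_mem_divisors hm).ne'
  have hd : M / m ≠ 0 := by
    have := Nat.mem_divisors.1 hm
    exact (Nat.div_pos (Nat.le_of_dvd (by omega) this.1) (by omega)).ne'
  simp only [wArith, fArith, ArithmeticFunction.coe_mk, hm0, hd, if_false]

lemma conv_prime_pow (t l : ℝ) (hl : 0 ≤ l) (f : ℕ → ℝ)
    (hf : ∀ n : ℕ, 1 ≤ n → ∑ d ∈ n.divisors, f d ≤ (n : ℝ)) (p k : ℕ) (hp : p.Prime)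
    (hk : k ≠ 0) :
    (wArith t l * fArith f) (p ^ k) ≤ (p:ℝ) ^ k * (1 + (wgt t l p - 1) / p) := by
  obtain ⟨k, rfl⟩ := Nat.exists_eq_succ_of_ne_zero hk
  rw [conv_eq, Nat.sum_divisors_prime_pow hp, Finset.sum_range_succ']
  have hps : ∀ i, primeSum t (p ^ (i+1)) =
      Set.indicator {q : ℕ | t ≤ (q : ℝ)} (fun q => 1 / (q : ℝ)) p := by
    intro i
    simp [primeSum, Nat.primeFactors_prime_pow (Nat.succ_ne_zero i) hp]
  have e1 : ∑ i ∈ Finset.range (k+1), Real.exp (l * primeSum t (p^(i+1))) * f (p ^ (k+1) / p^(i+1))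
      = wgt t l p * ∑ i ∈ Finset.range (k+1), f (p ^ i) := by
    rw [Finset.mul_sum, ← Finset.sum_range_reflect (fun i => wgt t l p * f (p^i))]
    apply Finset.sum_congr rfl
    intro i hi
    rw [Finset.mem_range] at hi
    rw [hps, Nat.pow_div (by omega) hp.pos, wgt]
    congr 3
    omega
  rw [e1]
  have a1 := hf (p^(k+1)) (Nat.pow_pos hp.pos)
  have a2 := hf (p^k) (Nat.pow_pos hp.pos)
  rw [Nat.sum_divisors_prime_pow hp] at a1 a2
  rw [Finset.sum_range_succ] at a1
  push_cast at a1 a2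
  have hw : 0 ≤ wgt t l p - 1 := by
    rw [sub_nonneg, wgt]
    apply Real.one_le_exp
    apply mul_nonneg hl
    apply Set.indicator_nonneg
    intro x _; positivity
  have hp0 : (p:ℝ) ≠ 0 := by exact_mod_cast hp.ne_zero
  have e2 : (p:ℝ) ^ (k+1) * (1 + (wgt t l p - 1) / p) = p^(k+1) + (wgt t l p - 1) * p ^ k := by
    field_simp
    ring
  rw [Nat.succ_eq_add_one, e2]
  have a3 := mul_le_mul_of_nonneg_left a2 hw
  have e3 : Real.exp (l * primeSum t (p^0)) * f (p^(k+1) / p^0) = f (p^(k+1)) := by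
    simp [primeSum]
  rw [e3]
  linarith

lemma conv_bound (t l : ℝ) (hl : 0 ≤ l) (f : ℕ → ℝ) (h0 : ∀ n, 0 ≤ f n) (h1 : f 1 = 1)
    (hm : ∀ a b : ℕ, Nat.Coprime a b → f (a * b) = f a * f b)
    (hf : ∀ n : ℕ, 1 ≤ n → ∑ d ∈ n.divisors, f d ≤ (n : ℝ)) (M : ℕ) (hM : M ≠ 0) :
    ∑ m ∈ M.divisors, Real.exp (l * primeSum t m) * f (M / m) ≤
      M * ∏ p ∈ M.primeFactors, (1 + (wgt t l p - 1) / p) := by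
  have hM' : (M:ℝ) = ∏ p ∈ M.primeFactors, (p:ℝ) ^ M.factorization p := by
    conv_lhs => rw [← Nat.prod_factorization_pow_eq_self hM]
    rw [Finsupp.prod, Nat.support_factorization]
    push_cast; rfl
  rw [← conv_eq, ArithmeticFunction.IsMultiplicative.multiplicative_factorization _
    ((wArith_mult t l).mul (fArith_mult f h1 hm)) hM, Finsupp.prod, Nat.support_factorization]
  conv_rhs => rw [hM']
  rw [← Finset.prod_mul_distrib]
  apply Finset.prod_le_prod
  · intro p _
    rw [conv_eq]
    exact Finset.sum_nonneg fun i _ => mul_nonneg (Real.exp_pos _).le (h0 _)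
  · intro p hp
    have hpp := Nat.prime_of_mem_primeFactors hp
    apply conv_prime_pow t l hl f hf p _ hpp
    exact (hpp.factorization_pos_of_dvd hM (Nat.dvd_of_mem_primeFactors hp)).ne'

lemma prod_bound_s17 (t l : ℝ) (ht : 4 ≤ t) (hl : t ≤ l) (M : ℕ) :
    ∏ p ∈ M.primeFactors, (1 + (wgt t l p - 1) / p) ≤
      Real.exp (l * (Real.log (Real.log l) - Real.log (Real.log t) + 16 / Real.log t) + 4) := by
  have hl0 : 0 < l := by linarith
  have hpt : ∀ p ∈ M.primeFactors, 1 + (wgt t l p - 1) / p ≤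
      Real.exp ((if t ≤ (p:ℝ) ∧ (p:ℝ) ≤ l then l * (1 / (p:ℝ)) else 0) +
        (if l < (p:ℝ) then 2 * l * (((p:ℝ)^2)⁻¹) else 0)) := by
    intro p hp
    have hp1 : (1:ℝ) ≤ p := by exact_mod_cast (Nat.prime_of_mem_primeFactors hp).one_le
    have hp0 : (0:ℝ) < p := by linarith
    by_cases h1 : t ≤ (p:ℝ)
    · have hw : wgt t l p = Real.exp (l * (1 / (p:ℝ))) := by
        rw [wgt, Set.indicator_of_mem (by exact h1)]
      rw [hw]
      by_cases h2 : (p:ℝ) ≤ l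
      · rw [if_pos ⟨h1, h2⟩, if_neg (not_lt.2 h2), add_zero]
        have : 1 ≤ Real.exp (l * (1 / (p:ℝ))) := Real.one_le_exp (by positivity)
        have := div_le_self (sub_nonneg.2 this) hp1
        linarith
      · push Not at h2
        rw [if_neg (fun h => absurd h.2 (not_le.2 h2)), if_pos h2, zero_add]
        have hx0 : 0 ≤ l * (1 / (p:ℝ)) := by positivity
        have hx1 : l * (1 / (p:ℝ)) ≤ 1 := by
          rw [mul_one_div, div_le_one hp0]; exact h2.le
        have hb : Real.exp (l * (1 / (p:ℝ))) - 1 ≤ 2 * (l * (1 / (p:ℝ))) := by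
          have := Real.abs_exp_sub_one_le (x := l * (1 / (p:ℝ))) (by rwa [abs_of_nonneg hx0])
          rw [abs_of_nonneg hx0] at this
          exact (le_abs_self _).trans this
        have hc : (Real.exp (l * (1 / (p:ℝ))) - 1) / p ≤ 2 * l * (((p:ℝ)^2)⁻¹) := by
          rw [div_le_iff₀ hp0]
          refine hb.trans (le_of_eq ?_)
          field_simp
        have := Real.add_one_le_exp (2 * l * (((p:ℝ)^2)⁻¹))
        linarith
    · have hw : wgt t l p = 1 := by
        rw [wgt, Set.indicator_of_notMem (by exact h1)]; simp
      rw [hw, if_neg (fun h => h1 h.1), if_neg (fun h => h1 (hl.trans h.le))]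
      simp
  have hnn : ∀ p ∈ M.primeFactors, 0 ≤ 1 + (wgt t l p - 1) / p := by
    intro p hp
    have : 1 ≤ wgt t l p := by
      rw [wgt]
      apply Real.one_le_exp
      apply mul_nonneg hl0.le
      apply Set.indicator_nonneg
      intro x _; positivity
    have := sub_nonneg.2 this
    positivity
  refine (Finset.prod_le_prod hnn hpt).trans ?_
  rw [← Real.exp_sum, Real.exp_le_exp, Finset.sum_add_distrib]
  apply add_le_add
  · rw [← Finset.sum_filter, ← Finset.mul_sum]
    apply mul_le_mul_of_nonneg_left _ hl0.le
    apply mertens_two_s17 t l ht hl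
    intro p hp
    rw [Finset.mem_filter] at hp
    exact ⟨Nat.prime_of_mem_primeFactors hp.1, hp.2⟩
  · rw [← Finset.sum_filter, ← Finset.mul_sum]
    have hs : ∑ p ∈ M.primeFactors with l < ((p:ℕ):ℝ), (((p:ℝ)^2)⁻¹) ≤ 2 / ((⌊l⌋₊:ℝ) + 1) := by
      refine le_trans ?_ (sum_Ioo_inv_sq_le ⌊l⌋₊ (M + 1))
      apply Finset.sum_le_sum_of_subset_of_nonneg
      · intro p hp
        rw [Finset.mem_filter] at hp
        rw [Finset.mem_Ioo]
        exact ⟨(Nat.floor_lt hl0.le).2 hp.2, Nat.lt_succ_of_le (Nat.le_of_mem_primeFactors hp.1)⟩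
      · intros; positivity
    have h2 : 2 / ((⌊l⌋₊:ℝ) + 1) ≤ 2 / l := by
      have := (Nat.lt_floor_add_one l).le
      gcongr
    calc _ ≤ 2 * l * (2 / l) := by
          apply mul_le_mul_of_nonneg_left (hs.trans h2) (by linarith)
      _ = 4 := by field_simp; norm_num

theorem divisor_anatomy_improved (ε : ℝ) (hε : ε ∈ Set.Ioo (0:ℝ) 1) :
    ∃ K C : ℝ, 0 < C ∧ ∀ (t c : ℝ),
      Real.exp (Real.exp 1) ≤ t → 0 < c →
      K ≤ ε * c * Real.log t / Real.log (Real.log t) →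
      ∀ (f : ℕ → ℝ), (∀ n, 0 ≤ f n) → f 1 = 1 →
      (∀ a b : ℕ, Nat.Coprime a b → f (a * b) = f a * f b) →
      (∀ n : ℕ, 1 ≤ n → ∑ d ∈ n.divisors, f d ≤ (n : ℝ)) →
      ∀ M : ℕ,
        (∑ m ∈ M.divisors,
          Set.indicator {m' : ℕ | c ≤ primeSum t m'} (fun m' => f (M / m')) m) ≤
          C * M * Real.exp (-(100 * t ^ Real.exp ((1 - ε) * c))) := by
  refine ⟨400, Real.exp 4, Real.exp_pos _, ?_⟩
  intro t c ht hc hK f h0 h1 hm hf M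
  rcases eq_or_ne M 0 with rfl | hM
  · simp
  obtain ⟨hε0, hε1⟩ := hε
  have he : (2:ℝ) < Real.exp 1 := by have := Real.exp_one_gt_d9; linarith
  have ht0 : 0 < t := (Real.exp_pos _).trans_le ht
  have hL : Real.exp 1 ≤ Real.log t := by
    rwa [Real.le_log_iff_exp_le ht0]
  have hL0 : 0 < Real.log t := by linarith
  have hLL : 1 ≤ Real.log (Real.log t) := by
    rwa [Real.le_log_iff_exp_le hL0]
  have ht4 : 4 ≤ t := by
    have h2 : Real.exp 2 ≤ t := le_trans (Real.exp_le_exp.2 he.le) ht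
    have h3 : Real.exp 2 = Real.exp 1 * Real.exp 1 := by rw [← Real.exp_add]; norm_num
    nlinarith
  have hKL : 400 * Real.log (Real.log t) ≤ ε * c * Real.log t := by
    rwa [le_div_iff₀ (by linarith)] at hK
  have hx0 : 0 < ε * c := by positivity
  set x := ε * c with hx
  set L := Real.log t with hLdef
  set E := Real.exp ((1 - ε) * c) with hE
  set E' := Real.exp ((1 - ε / 2) * c) with hE'
  have hE1 : 1 ≤ E := Real.one_le_exp (mul_nonneg (by linarith) hc.le)
  have hEE : E + x / 2 ≤ E' := by
    have : E' = E * Real.exp (x / 2) := by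
      rw [hE, hE', hx, ← Real.exp_add]; congr 1; ring
    rw [this]
    have := Real.add_one_le_exp (x / 2)
    nlinarith
  set l := t ^ E' with hl
  have hl' : l = Real.exp (L * E') := by rw [hl, Real.rpow_def_of_pos ht0]
  have hlog : Real.log l = E' * L := Real.log_rpow ht0 _
  have hloglog : Real.log (Real.log l) = (1 - ε / 2) * c + Real.log L := by
    rw [hlog, Real.log_mul (Real.exp_pos _).ne' hL0.ne', Real.log_exp]
  have htl : t ≤ l := by
    rw [hl]
    exact Real.self_le_rpow_of_one_le (by linarith) (by linarith)
  have hl0 : 0 < l := by linarith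
  -- key numeric inequality
  have hnum : 100 * t ^ E ≤ l * (x / 4) := by
    have e1 : t ^ E * Real.exp (L * x / 2) ≤ l := by
      rw [hl', Real.rpow_def_of_pos ht0, ← Real.exp_add, Real.exp_le_exp]
      nlinarith
    have e2 : L ≤ Real.exp (L * x / 2) := by
      rw [← Real.log_le_iff_le_exp hL0]
      nlinarith
    have e3 : 100 ≤ L * (x / 4) := by nlinarith
    have hT : 0 < t ^ E := Real.rpow_pos_of_pos ht0 _
    calc 100 * t ^ E ≤ (L * (x / 4)) * t ^ E := by gcongr
      _ = t ^ E * L * (x / 4) := by ring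
      _ ≤ t ^ E * Real.exp (L * x / 2) * (x / 4) := by gcongr
      _ ≤ l * (x / 4) := by gcongr
  have hexp : l * (Real.log (Real.log l) - Real.log L + 16 / L) + 4 - l * c ≤
      4 - 100 * t ^ E := by
    have h16 : 16 / L ≤ x / 4 := by
      rw [div_le_iff₀ hL0]; nlinarith
    have := mul_le_mul_of_nonneg_left h16 hl0.le
    rw [hloglog]
    have e : l * ((1 - ε / 2) * c + Real.log L - Real.log L + 16 / L) + 4 - l * c
      = l * (16 / L) + 4 - 2 * (l * (x / 4)) := by rw [hx]; ring
    rw [e]; linarith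
  have hR : ∑ m ∈ M.divisors,
      Set.indicator {m' : ℕ | c ≤ primeSum t m'} (fun m' => f (M / m')) m ≤
      Real.exp (-(l * c)) * ∑ m ∈ M.divisors, Real.exp (l * primeSum t m) * f (M / m) := by
    rw [Finset.mul_sum]
    apply Finset.sum_le_sum
    intro m _
    rw [← mul_assoc, ← Real.exp_add]
    by_cases h : c ≤ primeSum t m
    · rw [Set.indicator_of_mem (by exact h)]
      apply le_mul_of_one_le_left (h0 _)
      apply Real.one_le_exp
      nlinarith
    · rw [Set.indicator_of_notMem (by exact h)]
      exact mul_nonneg (Real.exp_pos _).le (h0 _)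
  refine hR.trans ?_
  have hB := (conv_bound t l hl0.le f h0 h1 hm hf M hM).trans
    (mul_le_mul_of_nonneg_left (prod_bound_s17 t l ht4 htl M) (Nat.cast_nonneg M))
  calc _ ≤ Real.exp (-(l * c)) * _ := mul_le_mul_of_nonneg_left hB (Real.exp_pos _).le
    _ = M * Real.exp (l * (Real.log (Real.log l) - Real.log L + 16 / L) + 4 - l * c) := by
        rw [mul_left_comm, ← Real.exp_add]; congr 2; ring
    _ ≤ M * Real.exp (4 - 100 * t ^ E) := by
        gcongr
    _ = _ := by
        rw [sub_eq_add_neg, Real.exp_add]; ring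
end

section
/- There exists a constant K > 0 such that for any t ≥ 1 and any c, ε > 0 with ε·c·log t ≥ K, and any real x ≥ 1, the number of positive integers n ≤ x with ∑_{p prime, p ≥ t, p | n} 1/p ≥ c is at least x·exp(−t^{e^{(1+ε)c}}) − 1. -/
open Finset Real

theorem logfact (N : ℕ) : log (N.factorial : ℝ) =
    ∑ p ∈ Nat.primesLE N, (N.factorial.factorization p : ℝ) * log p := by
  rw [log_nat_eq_sum_factorization, Finsupp.sum]
  apply Finset.sum_subset
  · intro p hp
    rw [Nat.support_factorization, Nat.mem_primeFactors] at hp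
    rw [Nat.mem_primesLE]
    exact ⟨(hp.1.dvd_factorial).1 hp.2.1, hp.1⟩
  · intro p _ hp
    rw [Finsupp.notMem_support_iff] at hp
    simp [hp]

noncomputable def WW (N : ℕ) : ℝ := ∑ p ∈ Nat.primesLE N, log (p : ℝ) / p

theorem WW_upper (N : ℕ) (hN : 1 ≤ N) : WW N ≤ log N + log 4 := by
  have hN' : (0:ℝ) < N := by exact_mod_cast hN
  have h1 : log (N.factorial : ℝ) ≤ N * log N := by
    rw [← log_pow]
    apply log_le_log (by exact_mod_cast N.factorial_pos)
    exact_mod_cast N.factorial_le_pow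
  have h2 : (N:ℝ) * WW N - Chebyshev.theta N ≤ log (N.factorial : ℝ) := by
    rw [logfact, WW, Chebyshev.theta_eq_sum_primesLE_log, Finset.mul_sum, ← Finset.sum_sub_distrib]
    apply Finset.sum_le_sum
    intro p hp
    rw [Nat.mem_primesLE] at hp
    have hl : 0 ≤ log (p:ℝ) := log_natCast_nonneg p
    have hp0 : (0:ℝ) < p := by exact_mod_cast hp.2.pos
    have : (N/p : ℕ) ≤ N.factorial.factorization p := by
      rw [Nat.factorization_factorial hp.2 (Nat.lt_succ_self _)]
      have := Finset.single_le_sum (s := Finset.Ico 1 (Nat.log p N + 1)) (f := fun i => N / p^i)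
        (fun i _ => Nat.zero_le _) (a := 1) (by
          simp only [Finset.mem_Ico, le_refl, true_and]
          have := Nat.log_pos hp.2.one_lt hp.1
          omega)
      simpa using this
    have h3 : (N:ℝ)/p - 1 ≤ ((N/p : ℕ):ℝ) := by
      rw [← Nat.floor_div_eq_div (K := ℝ)]
      exact (Nat.sub_one_lt_floor _).le
    have h4 : ((N/p : ℕ):ℝ) ≤ (N.factorial.factorization p : ℝ) := by exact_mod_cast this
    calc (N:ℝ) * (log p / p) - log p = (N/p - 1) * log p := by ring
      _ ≤ _ := mul_le_mul_of_nonneg_right (h3.trans h4) hl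
  have h3 := Chebyshev.theta_le_log4_mul_x hN'.le
  have : (N:ℝ) * WW N ≤ N * (log N + log 4) := by linarith
  exact le_of_mul_le_mul_left this hN'

theorem sumC : ∃ C : ℝ, ∀ N, ∑ p ∈ Nat.primesLE N, log (p:ℝ) / (p * (p-1)) ≤ C := by
  have hs : Summable (fun n : ℕ => 4 * (1 / (n:ℝ) ^ (3/2 : ℝ))) :=
    (Real.summable_one_div_nat_rpow.2 (by norm_num)).mul_left 4
  refine ⟨∑' n : ℕ, 4 * (1 / (n:ℝ) ^ (3/2 : ℝ)), fun N => ?_⟩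
  refine le_trans (Finset.sum_le_sum ?_) (hs.sum_le_tsum (Nat.primesLE N) (fun i _ => by positivity))
  intro p hp
  rw [Nat.mem_primesLE] at hp
  have h2 : (2:ℝ) ≤ p := by exact_mod_cast hp.2.two_le
  have h3 : log (p:ℝ) ≤ 2 * (p:ℝ)^(1/2:ℝ) := by
    have := Real.log_le_rpow_div (x := p) (by linarith) (ε := 1/2) (by norm_num)
    linarith
  have h4 : (p:ℝ)^(1/2:ℝ) * (p:ℝ)^(3/2:ℝ) = p * p := by
    rw [← rpow_add (by linarith)]; norm_num; ring
  have h5 : (0:ℝ) < (p:ℝ)^(3/2:ℝ) := by positivity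
  rw [mul_one_div, div_le_div_iff₀ (by nlinarith) h5]
  nlinarith [mul_le_mul_of_nonneg_right h3 h5.le]

theorem WW_lower : ∃ C : ℝ, ∀ N : ℕ, 1 ≤ N → log N - C ≤ WW N := by
  obtain ⟨C, hC⟩ := sumC
  refine ⟨C + 1, fun N hN => ?_⟩
  have hN' : (0:ℝ) < N := by exact_mod_cast hN
  have h1 : N * log N - N ≤ log (N.factorial : ℝ) := by
    have h := Stirling.le_log_factorial_stirling (n := N) (by omega)
    have a : 0 ≤ log (N:ℝ) := log_natCast_nonneg _
    have b : 0 ≤ log (2 * π) := log_nonneg (by linarith [pi_gt_three])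
    linarith
  have h2 : log (N.factorial : ℝ) ≤ N * (WW N + ∑ p ∈ Nat.primesLE N, log (p:ℝ) / (p * (p-1))) := by
    rw [logfact, WW, ← Finset.sum_add_distrib, Finset.mul_sum]
    apply Finset.sum_le_sum
    intro p hp
    rw [Nat.mem_primesLE] at hp
    have hl : 0 ≤ log (p:ℝ) := log_natCast_nonneg p
    have hp2 : (2:ℝ) ≤ p := by exact_mod_cast hp.2.two_le
    have h := Nat.factorization_factorial_le_div_pred hp.2 N
    have h3 : (N.factorial.factorization p : ℝ) ≤ N / (p - 1) := by
      calc (N.factorial.factorization p : ℝ) ≤ ((N/(p-1) : ℕ) : ℝ) := by exact_mod_cast h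
        _ ≤ N / ((p-1 : ℕ):ℝ) := Nat.cast_div_le
        _ = _ := by rw [Nat.cast_sub hp.2.one_lt.le]; simp
    refine (mul_le_mul_of_nonneg_right h3 hl).trans (le_of_eq ?_)
    have : (p:ℝ) - 1 ≠ 0 := by linarith
    have : (p:ℝ) ≠ 0 := by linarith
    field_simp
    ring
  have h3 := hC N
  have : (N:ℝ) * (log N - (C+1)) ≤ N * WW N := by nlinarith
  exact le_of_mul_le_mul_left this hN'

theorem abel (g d : ℕ → ℝ) (T : ℕ) (C : ℝ) 
    (hg : ∀ n, T ≤ n → g (n+1) ≤ g n)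
    (hd : ∀ n, T ≤ n → -C ≤ ∑ i ∈ Ico T n, d i) (n : ℕ) (hn : T ≤ n) :
    (∑ i ∈ Ico T n, d i + C) * g n - C * g T ≤ ∑ i ∈ Ico T n, d i * g i := by
  induction n, hn using Nat.le_induction with
  | base => simp
  | succ n hn ih =>
    have h := hd (n+1) (by omega)
    rw [Finset.sum_Ico_succ_top hn] at h ⊢
    rw [Finset.sum_Ico_succ_top hn]
    nlinarith [hg n hn]

theorem mertens : ∃ C : ℝ, 0 ≤ C ∧ ∀ T N : ℕ, 2 ≤ T → T ≤ N →
    log (log N) - log (log T) - C / log T ≤ ∑ p ∈ Ico T N with p.Prime, 1 / (p:ℝ) := by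
  obtain ⟨C, hC⟩ := WW_lower
  have hu := WW_upper
  have hC0 : 0 ≤ C := by
    have h := hC 1 le_rfl
    have : WW 1 = 0 := by
      rw [WW, Finset.sum_eq_zero]
      intro p hp
      rw [Nat.mem_primesLE] at hp
      have := hp.2.two_le
      omega
    rw [this] at h
    simp at h; exact h
  have l4 : 0 ≤ log 4 := log_nonneg (by norm_num)
  have l2 : 0 ≤ log 2 := log_nonneg (by norm_num)
  let a : ℕ → ℝ := fun n => if n.Prime then log n / n else 0
  have hW : ∀ N, WW N = ∑ i ∈ range (N+1), a i := by
    intro N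
    rw [WW, Nat.primesLE, Nat.primesBelow, Finset.sum_filter]
  let b : ℕ → ℝ := fun n => log ((n+1 : ℕ):ℝ) - log n
  have hb : ∀ T n, T ≤ n → ∑ i ∈ Ico T n, b i = log n - log T := by
    intro T n h
    exact Finset.sum_Ico_sub (fun n : ℕ => log (n:ℝ)) h
  refine ⟨C + log 4 + log 2, by positivity, fun T N hT hTN => ?_⟩
  have hd : ∀ n, T ≤ n → -(C + log 4 + log 2) ≤ ∑ i ∈ Ico T n, (a i - b i) := by
    intro n hn
    rw [Finset.sum_sub_distrib, hb T n hn, Finset.sum_Ico_eq_sub _ hn]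
    obtain ⟨n, rfl⟩ : ∃ k, n = k + 1 := ⟨n-1, by omega⟩
    obtain ⟨T, rfl⟩ : ∃ k, T = k + 1 := ⟨T-1, by omega⟩
    rw [← hW, ← hW]
    have h1 := hC n (by omega)
    have h2 := hu T (by omega)
    have h3 : log (T:ℝ) ≤ log ((T+1:ℕ):ℝ) := log_le_log (by exact_mod_cast (by omega : 0 < T)) (by simp)
    have h4 : log ((n+1:ℕ):ℝ) ≤ log n + log 2 := by
      have : (1:ℝ) ≤ n := by exact_mod_cast (by omega : 1 ≤ n)
      rw [← log_mul (by linarith) (by norm_num)]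
      apply log_le_log (by positivity)
      push_cast; linarith
    linarith
  have key := abel (fun n => 1 / log n) (fun n => a n - b n) T (C + log 4 + log 2)
    (by
      intro n hn
      have : 0 < log (n:ℝ) := log_pos (by exact_mod_cast (by omega : 1 < n))
      have : log (n:ℝ) ≤ log ((n+1:ℕ):ℝ) := log_le_log (by exact_mod_cast (by omega : 0 < n)) (by simp)
      gcongr)
    hd N hTN
  have hpos : 0 ≤ (∑ i ∈ Ico T N, (a i - b i) + (C + log 4 + log 2)) * (1 / log (N:ℝ)) := by
    have := hd N hTN
    apply mul_nonneg (by linarith)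
    have := log_natCast_nonneg N
    positivity
  have e1 : ∑ i ∈ Ico T N, (a i - b i) * (1 / log (i:ℝ)) =
      ∑ p ∈ Ico T N with p.Prime, 1 / (p:ℝ) - ∑ i ∈ Ico T N, b i / log i := by
    rw [Finset.sum_filter, ← Finset.sum_sub_distrib]
    apply Finset.sum_congr rfl
    intro i hi
    rw [Finset.mem_Ico] at hi
    have : 0 < log (i:ℝ) := log_pos (by exact_mod_cast (by omega : 1 < i))
    have : (0:ℝ) < i := by exact_mod_cast (by omega : 0 < i)
    simp only [a]
    split_ifs
    · field_simp
    · ring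
  have e2 : log (log N) - log (log T) ≤ ∑ i ∈ Ico T N, b i / log i := by
    rw [← Finset.sum_Ico_sub (fun n : ℕ => log (log (n:ℝ))) hTN]
    apply Finset.sum_le_sum
    intro i hi
    rw [Finset.mem_Ico] at hi
    have p1 : 0 < log (i:ℝ) := log_pos (by exact_mod_cast (by omega : 1 < i))
    have p2 : 0 < log ((i+1:ℕ):ℝ) := log_pos (by exact_mod_cast (by omega : 1 < i+1))
    rw [← log_div p2.ne' p1.ne']
    refine (log_le_sub_one_of_pos (by positivity)).trans (le_of_eq ?_)
    simp only [b]
    field_simp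
  rw [e1] at key
  have : (C + log 4 + log 2) * (1 / log (T:ℝ)) = (C + log 4 + log 2) / log T := by ring
  linarith

theorem multiples (t c x : ℝ) (m : ℕ) (hm : 0 < m) (hx : 1 ≤ x)
    (h : ∀ k : ℕ, 0 < k → c ≤ primeSum t (m * k)) :
    x / m - 1 ≤ (Set.ncard {n : ℕ | 0 < n ∧ (n : ℝ) ≤ x ∧ c ≤ primeSum t n} : ℝ) := by
  have hm' : (0:ℝ) < m := by exact_mod_cast hm
  have hfin : {n : ℕ | 0 < n ∧ (n : ℝ) ≤ x ∧ c ≤ primeSum t n}.Finite := by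
    apply (Set.finite_Iic ⌊x⌋₊).subset
    intro n hn
    exact Nat.le_floor hn.2.1
  have hsub : (((Icc 1 ⌊x / m⌋₊).image (fun k => m * k) : Finset ℕ) : Set ℕ) ⊆
      {n : ℕ | 0 < n ∧ (n : ℝ) ≤ x ∧ c ≤ primeSum t n} := by
    intro n hn
    simp only [coe_image, Set.mem_image, mem_coe, Finset.mem_Icc] at hn
    obtain ⟨k, ⟨hk1, hk2⟩, rfl⟩ := hn
    refine ⟨by positivity, ?_, h k hk1⟩
    have := (Nat.le_floor_iff (by positivity)).1 hk2
    rw [le_div_iff₀ hm'] at this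
    push_cast; linarith
  have h1 := Set.ncard_le_ncard hsub hfin
  rw [Set.ncard_coe_finset, Finset.card_image_of_injective _ (fun a b hab =>
    Nat.eq_of_mul_eq_mul_left hm hab), Nat.card_Icc, Nat.add_sub_cancel] at h1
  have h2 : ((⌊x / m⌋₊ : ℕ) : ℝ) ≤ (Set.ncard {n : ℕ | 0 < n ∧ (n : ℝ) ≤ x ∧ c ≤ primeSum t n} : ℝ) := by
    exact_mod_cast h1
  exact (Nat.sub_one_lt_floor _).le.trans h2

theorem primeSum_primorial (t : ℝ) (M k : ℕ) (hk : 0 < k) :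
    ∑ p ∈ Ico ⌈t⌉₊ (M+1) with p.Prime, 1 / (p:ℝ) ≤ primeSum t (primorial M * k) := by
  unfold primeSum
  have h1 : ∑ p ∈ Ico ⌈t⌉₊ (M+1) with p.Prime, 1 / (p:ℝ) =
     ∑ p ∈ Ico ⌈t⌉₊ (M+1) with p.Prime, Set.indicator {q : ℕ | t ≤ (q : ℝ)} (fun q => 1 / (q : ℝ)) p := by
    apply Finset.sum_congr rfl
    intro p hp
    rw [Finset.mem_filter, Finset.mem_Ico] at hp
    rw [Set.indicator_of_mem]
    exact Nat.ceil_le.1 hp.1.1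
  rw [h1]
  apply Finset.sum_le_sum_of_subset_of_nonneg
  · intro p hp
    rw [Finset.mem_filter, Finset.mem_Ico] at hp
    have h0 : p ∣ primorial M := by
      have : p ∈ (primorial M).primeFactors := by
        rw [primeFactors_primorial, Nat.mem_primesLE]; exact ⟨by omega, hp.2⟩
      exact Nat.dvd_of_mem_primeFactors this
    rw [Nat.mem_primeFactors]
    exact ⟨hp.2, h0.mul_right k, (Nat.mul_pos (primorial_pos M) hk).ne'⟩
  · intro p _ _
    apply Set.indicator_nonneg
    intro q _
    positivity

theorem anatomy_lower_bound :
    ∃ K : ℝ, 0 < K ∧ ∀ (t c ε x : ℝ),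
      1 ≤ t → 0 < c → 0 < ε → K ≤ ε * c * Real.log t → 1 ≤ x →
      x * Real.exp (-(t ^ Real.exp ((1 + ε) * c))) - 1 ≤
        (Set.ncard {n : ℕ | 0 < n ∧ (n : ℝ) ≤ x ∧ c ≤ primeSum t n} : ℝ) := by
  obtain ⟨C, hC0, hC⟩ := mertens
  refine ⟨C + 2, by linarith, ?_⟩
  intro t c ε x ht hc hε hK hx
  have hL : 0 < log t := by
    by_contra hcon
    have : log t = 0 := le_antisymm (not_lt.1 hcon) (log_nonneg ht)
    rw [this] at hK
    linarith
  have ht1 : 1 < t := by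
    by_contra hcon
    have : t = 1 := le_antisymm (not_lt.1 hcon) ht
    simp [this] at hL
  have ht0 : 0 < t := by linarith
  set L := log t with hLdef
  set Y := t ^ exp ((1 + ε) * c) with hY
  have hY0 : 0 < Y := rpow_pos_of_pos ht0 _
  have hlogY : log Y = exp ((1 + ε) * c) * L := log_rpow ht0 _
  have hlogy : log (Y / 2) = log Y - log 2 := log_div hY0.ne' (by norm_num)
  have hmain : exp (c + (C + 1) / L) * L ≤ log (Y / 2) := by
    have e1 : c + (C+1)/L + 1 / L ≤ (1 + ε) * c := by
      have : (C + 2) / L ≤ ε * c := by rw [div_le_iff₀ hL]; exact hK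
      have h2 : (C + 2) / L = (C+1)/L + 1/L := by ring
      linarith
    have e2 : exp (c + (C+1)/L) * (1 + 1/L) ≤ exp ((1 + ε) * c) := by
      refine le_trans ?_ (exp_le_exp.2 e1)
      rw [exp_add (c + (C+1)/L)]
      gcongr
      linarith [add_one_le_exp (1/L)]
    have e3 : 1 ≤ exp (c + (C+1)/L) := one_le_exp (by positivity)
    have e4 : exp (c + (C+1)/L) * (1 + 1/L) * L = exp (c + (C+1)/L) * L + exp (c + (C+1)/L) := by
      field_simp
    have e5 := mul_le_mul_of_nonneg_right e2 hL.le
    have e6 : log 2 ≤ 1 := by linarith [log_two_lt_d9]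
    rw [hlogy, hlogY]
    linarith
  have hLy : L ≤ log (Y / 2) := by
    refine le_trans ?_ hmain
    have : 1 ≤ exp (c + (C+1)/L) := one_le_exp (by positivity)
    nlinarith
  have hty : t ≤ Y / 2 := (log_le_log_iff ht0 (by positivity)).1 hLy
  have hT2 : 2 ≤ ⌈t⌉₊ := by
    have : 1 < ⌈t⌉₊ := Nat.lt_ceil.2 (by simpa using ht1)
    omega
  have hTN : ⌈t⌉₊ ≤ ⌊Y / 2⌋₊ + 1 := by
    rw [Nat.ceil_le]
    push_cast
    linarith [Nat.lt_floor_add_one (Y / 2)]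
  have hmer := hC ⌈t⌉₊ (⌊Y / 2⌋₊ + 1) hT2 hTN
  have hsum : c ≤ ∑ p ∈ Ico ⌈t⌉₊ (⌊Y / 2⌋₊ + 1) with p.Prime, 1 / (p:ℝ) := by
    refine le_trans ?_ hmer
    have a1 : c + (C+1)/L + log L ≤ log (log ((⌊Y / 2⌋₊ + 1 : ℕ) : ℝ)) := by
      have : c + (C+1)/L + log L = log (exp (c + (C + 1) / L) * L) := by
        rw [log_mul (exp_pos _).ne' hL.ne', log_exp]
      rw [this]
      apply log_le_log (by positivity)
      refine hmain.trans ?_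
      apply log_le_log (by positivity)
      push_cast
      linarith [Nat.lt_floor_add_one (Y / 2)]
    have hLT : L ≤ log (⌈t⌉₊ : ℝ) := log_le_log ht0 (Nat.le_ceil t)
    have a2 : log (log (⌈t⌉₊ : ℝ)) ≤ log L + 1 / L := by
      have b1 : (⌈t⌉₊ : ℝ) ≤ t * 2 := by
        linarith [Nat.ceil_lt_add_one ht0.le]
      have b2 : log (⌈t⌉₊ : ℝ) ≤ L + 1 := by
        have := log_le_log (by linarith [Nat.le_ceil t]) b1
        rw [log_mul ht0.ne' (by norm_num)] at this
        linarith [log_two_lt_d9]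
      have b3 : log (log (⌈t⌉₊ : ℝ)) ≤ log (L * (1 + 1/L)) := by
        apply log_le_log (by linarith)
        refine b2.trans (le_of_eq ?_)
        field_simp
      rw [log_mul hL.ne' (by positivity)] at b3
      have := log_le_sub_one_of_pos (show 0 < 1 + 1/L by positivity)
      linarith
    have a3 : C / log (⌈t⌉₊ : ℝ) ≤ C / L := by gcongr
    have a4 : (C+1)/L = C/L + 1/L := by ring
    linarith
  have hmul := multiples t c x (primorial ⌊Y / 2⌋₊) (primorial_pos _) hx
    (fun k hk => hsum.trans (primeSum_primorial t _ k hk))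
  refine le_trans ?_ hmul
  have hm0 : (0:ℝ) < primorial ⌊Y / 2⌋₊ := by exact_mod_cast primorial_pos _
  have hmY : (primorial ⌊Y / 2⌋₊ : ℝ) ≤ exp Y := by
    rw [← log_le_iff_le_exp hm0, ← Chebyshev.theta_eq_log_primorial]
    refine (Chebyshev.theta_le_log4_mul_x (by positivity)).trans ?_
    have : log 4 ≤ 2 := by
      rw [show (4:ℝ) = 2^2 by norm_num, log_pow]
      push_cast; linarith [log_two_lt_d9]
    nlinarith
  have : x * exp (-Y) ≤ x / primorial ⌊Y / 2⌋₊ := by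
    rw [exp_neg, ← div_eq_mul_inv]
    gcongr
  linarith
end

section
/- There exist absolute constants K > 0 and t₀ such that for any t ≥ t₀, any real x ≥ 1 and any c ∈ ℝ with c·log t ≤ 1/2, the number of positive integers n ≤ x with ∑_{p prime, p ≥ t, p | n} 1/p ≥ c is at least x·e^{−Kt} − 1. -/
open Chebyshev in
lemma theta_lower_aux : ∀ᶠ y : ℝ in Filter.atTop, 0.6 * y ≤ Chebyshev.theta y := by
  have h := (isLittleO_log_rpow_atTop (r := 1/2) (by norm_num)).bound (c := 0.01) (by norm_num)
  filter_upwards [h, Filter.eventually_ge_atTop 1000] with y hy hy1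
  have h1 := Chebyshev.theta_ge' (x := y) (by linarith)
  have hl : 0 ≤ Real.log y := Real.log_nonneg (by linarith)
  rw [← Real.sqrt_eq_rpow, Real.norm_of_nonneg hl, Real.norm_of_nonneg (Real.sqrt_nonneg y)] at hy
  have hs : √y * √y = y := Real.mul_self_sqrt (by linarith)
  have hs1 : 1 ≤ √y := Real.one_le_sqrt.2 (by linarith)
  have h2 : Real.log (y + 2) ≤ 2 * Real.log y := by
    have e : Real.log (y ^ 2) = 2 * Real.log y := by rw [Real.log_pow]; norm_num
    rw [← e]
    apply Real.log_le_log (by linarith)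
    nlinarith
  have h3 : √y * Real.log y ≤ 0.01 * y := by nlinarith
  have h4 : √y ≤ y := by nlinarith
  have := Real.log_two_gt_d9
  have : 0.69 * (y - 1) ≤ (y - 1) * Real.log 2 := by nlinarith
  linarith

lemma sum_lower_aux : ∀ᶠ t : ℝ in Filter.atTop, ∀ n : ℕ, 0 < n → primorial ⌊100 * t⌋₊ ∣ n →
    1 / (2 * Real.log t) ≤ primeSum t n := by
  have hT : Filter.Tendsto (fun t : ℝ => 100 * t) Filter.atTop Filter.atTop :=
    Filter.tendsto_id.const_mul_atTop (by norm_num)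
  filter_upwards [hT.eventually theta_lower_aux, Filter.eventually_ge_atTop 2,
    Real.tendsto_log_atTop.eventually_ge_atTop (100 * Real.log 100)] with t hth ht2 hlog n hn hdvd
  have hl100 : 0 < Real.log 100 := Real.log_pos (by norm_num)
  have hlt : 0 < Real.log t := Real.log_pos (by linarith)
  have hL : Real.log (100 * t) = Real.log 100 + Real.log t :=
    Real.log_mul (by norm_num) (by linarith)
  have hup := Chebyshev.theta_le_log4_mul_x (x := t) (by linarith)
  have hl4 : Real.log 4 ≤ 2 := by
    rw [show (4:ℝ) = 2 ^ 2 by norm_num, Real.log_pow]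
    have := Real.log_two_lt_d9
    push_cast; linarith
  have hdiff : 58 * t ≤ Chebyshev.theta (100 * t) - Chebyshev.theta t := by nlinarith
  set S := (Finset.Ioc 0 ⌊100 * t⌋₊).filter Nat.Prime with hS
  have hSn : S ⊆ n.primeFactors := by
    intro p hp
    simp only [hS, Finset.mem_filter, Finset.mem_Ioc] at hp
    exact Nat.mem_primeFactors.2 ⟨hp.2, ((hp.2.dvd_primorial_iff).2 hp.1.2).trans hdvd, hn.ne'⟩
  set D := 100 * t * Real.log (100 * t) with hD
  have hDpos : 0 < D := by rw [hD, hL]; positivity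
  have hind : ∀ p : ℕ, 0 ≤ Set.indicator {q : ℕ | t ≤ (q : ℝ)} (fun q => 1 / (q : ℝ)) p :=
    fun p => Set.indicator_nonneg (fun _ _ => by positivity) p
  have h1 : ∑ p ∈ S, Set.indicator {q : ℕ | t ≤ (q : ℝ)} (fun q => 1 / (q : ℝ)) p ≤ primeSum t n :=
    Finset.sum_le_sum_of_subset_of_nonneg hSn fun p _ _ => hind p
  have hsub : (Finset.Ioc 0 ⌊t⌋₊).filter Nat.Prime ⊆ S := by
    apply Finset.filter_subset_filter
    apply Finset.Ioc_subset_Ioc_right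
    exact Nat.floor_le_floor (by linarith)
  have h2 : (Chebyshev.theta (100 * t) - Chebyshev.theta t) / D ≤
      ∑ p ∈ S, Set.indicator {q : ℕ | t ≤ (q : ℝ)} (fun q => 1 / (q : ℝ)) p := by
    unfold Chebyshev.theta
    rw [← Finset.sum_sdiff hsub, add_sub_cancel_right, Finset.sum_div]
    refine le_trans (Finset.sum_le_sum fun p hp => ?_)
      (Finset.sum_le_sum_of_subset_of_nonneg Finset.sdiff_subset fun p _ _ => hind p)
    simp only [hS, Finset.mem_sdiff, Finset.mem_filter, Finset.mem_Ioc] at hp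
    obtain ⟨⟨⟨hp0, hpN⟩, hpp⟩, hnot⟩ := hp
    have hpt : t ≤ (p : ℝ) := by
      by_contra! hlt'
      exact hnot ⟨⟨hp0, Nat.le_floor hlt'.le⟩, hpp⟩
    have hp100 : (p : ℝ) ≤ 100 * t := (Nat.le_floor_iff (by linarith)).1 hpN
    have hppos : (0:ℝ) < p := by exact_mod_cast hp0
    rw [Set.indicator_of_mem (by exact hpt), div_le_div_iff₀ hDpos hppos, one_mul, mul_comm]
    exact mul_le_mul hp100 (Real.log_le_log hppos hp100) (Real.log_natCast_nonneg p) (by linarith)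
  refine le_trans ?_ (h2.trans h1)
  rw [div_le_div_iff₀ (by positivity) hDpos]
  have : D ≤ 101 * t * Real.log t := by
    rw [hD, hL]; nlinarith
  have := mul_le_mul_of_nonneg_right hdiff (by positivity : 0 ≤ 2 * Real.log t)
  have : 0 < t * Real.log t := by positivity
  nlinarith

/-- **Lower bound for small `c log t`**: there are absolute constants `K > 0`
and `t₀` such that for `t ≥ t₀`, `x ≥ 1` and `c ∈ ℝ` with `c log t ≤ 1/2`,
`#{n ≤ x : ∑_{p ≥ t, p | n} 1/p ≥ c} ≥ x e^{-Kt} - 1`. -/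
theorem anatomy_lower_bound_small_c :
    ∃ K t₀ : ℝ, 0 < K ∧ ∀ (t x c : ℝ),
      t₀ ≤ t → 1 ≤ x → c * Real.log t ≤ 1/2 →
      x * Real.exp (-(K * t)) - 1 ≤
        (Set.ncard {n : ℕ | 0 < n ∧ (n : ℝ) ≤ x ∧ c ≤ primeSum t n} : ℝ) := by
  obtain ⟨t₁, ht₁⟩ := Filter.eventually_atTop.1 sum_lower_aux
  refine ⟨100 * Real.log 4, max t₁ 2, by have := Real.log_pos (x := 4) (by norm_num); positivity,
    fun t x c ht hx hc => ?_⟩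
  have ht2 : 2 ≤ t := (le_max_right _ _).trans ht
  have hlt : 0 < Real.log t := Real.log_pos (by linarith)
  have key := ht₁ t ((le_max_left _ _).trans ht)
  have hc' : c ≤ 1 / (2 * Real.log t) := by
    rw [le_div_iff₀ (by positivity)]; linarith
  set P := primorial ⌊100 * t⌋₊ with hP
  have hPpos : 0 < P := primorial_pos _
  have hfin : {n : ℕ | 0 < n ∧ (n : ℝ) ≤ x ∧ c ≤ primeSum t n}.Finite :=
    (Set.finite_Iic ⌊x⌋₊).subset fun n hn => Nat.le_floor hn.2.1
  have hcard : ⌊x⌋₊ / P ≤ Set.ncard {n : ℕ | 0 < n ∧ (n : ℝ) ≤ x ∧ c ≤ primeSum t n} := by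
    rw [← Nat.Ioc_filter_dvd_card_eq_div, ← Set.ncard_coe_finset]
    apply Set.ncard_le_ncard _ hfin
    intro n hn
    simp only [Finset.coe_filter, Finset.mem_Ioc, Set.mem_ofPred_eq] at hn
    exact ⟨hn.1.1, (Nat.le_floor_iff (by linarith)).1 hn.1.2, hc'.trans (key n hn.1.1 hn.2)⟩
  have hPle : (P : ℝ) ≤ Real.exp (100 * Real.log 4 * t) := by
    rw [← Real.log_le_iff_le_exp (by exact_mod_cast hPpos), hP, ← Chebyshev.theta_eq_log_primorial]
    have := Chebyshev.theta_le_log4_mul_x (x := 100 * t) (by linarith)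
    linarith
  have h1 : x * Real.exp (-(100 * Real.log 4 * t)) ≤ x / P := by
    rw [Real.exp_neg, ← div_eq_mul_inv]
    have : (0:ℝ) < P := by exact_mod_cast hPpos
    gcongr
  have h2 : x / P - 1 ≤ ((⌊x⌋₊ / P : ℕ) : ℝ) := by
    rw [← Nat.floor_div_natCast]
    exact (Nat.sub_one_lt_floor _).le
  have h3 : ((⌊x⌋₊ / P : ℕ) : ℝ) ≤ _ := Nat.cast_le.2 hcard
  linarith
end
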